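/- Let G be 1-tough with σ₃(G) ≥ n ≥ 3 and not complete. Then the circumference c(G) satisfies c(G) ≥ min{n, 2·NC2(G)}. -/

import Mathlib

open scoped Classical

namespace Paper

noncomputable section

variable {V : Type*}

/-- degree as cardinality of neighbor set -/
def deg (G : SimpleGraph V) (x : V) : ℕ := (G.neighborSet x).ncard

/-- G is 1-tough -/
def OneTough (G : SimpleGraph V) : Prop :=
  ∀ S : Set V, S.Nonempty → Nat.card ((G.induce Sᶜ).ConnectedComponent) ≤ S.ncard

def IsIndepTriple (G : SimpleGraph V) (s : Finset V) : Prop :=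
  s.card = 3 ∧ ∀ x ∈ s, ∀ y ∈ s, x ≠ y → ¬ G.Adj x y

def sigma3 [Fintype V] (G : SimpleGraph V) : ℕ :=
  if ∃ s : Finset V, IsIndepTriple G s then
    sInf {k | ∃ s : Finset V, IsIndepTriple G s ∧ ∑ x ∈ s, deg G x = k}
  else 3 * (Fintype.card V - 1)

def NC2 [Fintype V] (G : SimpleGraph V) : ℕ :=
  if G = ⊤ then Fintype.card V - 1
  else sInf {k | ∃ x y : V, G.dist x y = 2 ∧ (G.neighborSet x ∪ G.neighborSet y).ncard = k}

def circumference (G : SimpleGraph V) : ℕ :=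
  sSup {k | ∃ (a : V) (w : G.Walk a a), w.IsCycle ∧ w.length = k}

def IsLongestCycle (G : SimpleGraph V) {a : V} (c : G.Walk a a) : Prop :=
  c.IsCycle ∧ ∀ (b : V) (w : G.Walk b b), w.IsCycle → w.length ≤ c.length

/-- successor of a vertex along the oriented cycle `c` (identity off the cycle) -/
def cSucc [DecidableEq V] {G : SimpleGraph V} {a : V} (c : G.Walk a a) (x : V) : V :=
  if h : x ∈ c.support.tail then c.support.tail.next x h else x

/-- predecessor of a vertex along the oriented cycle `c` (identity off the cycle) -/
def cPred [DecidableEq V] {G : SimpleGraph V} {a : V} (c : G.Walk a a) (x : V) : V :=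
  if h : x ∈ c.support.tail then c.support.tail.prev x h else x

/-- vertices strictly between `x` and `y` going forward along `c` -/
def arc [DecidableEq V] {G : SimpleGraph V} {a : V} (c : G.Walk a a) (x y : V) : Set V :=
  {z | ∃ i k : ℕ, 0 < i ∧ i < k ∧ k < c.length ∧ (cSucc c)^[k] x = y ∧ z = (cSucc c)^[i] x}

/-- length of the interval of the cycle `c` starting at `b` determined by `B` -/
def intervalLen [DecidableEq V] {G : SimpleGraph V} {a : V} (c : G.Walk a a)
    (B : Set V) (b : V) : ℕ :=
  sInf {k | 0 < k ∧ (cSucc c)^[k] b ∈ B}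

/-- inner vertices of the interval of the cycle `c` starting at `b` determined by `B` -/
def innerVerts [DecidableEq V] {G : SimpleGraph V} {a : V} (c : G.Walk a a)
    (B : Set V) (b : V) : Set V :=
  {x | ∃ i, 0 < i ∧ i < intervalLen c B b ∧ x = (cSucc c)^[i] b}

/-- the union of the neighborhoods of the vertices in `S` -/
def nbhdSet (G : SimpleGraph V) (S : Set V) : Set V := {z | ∃ y ∈ S, G.Adj y z}

/-- a set of vertices is independent -/
def IsIndepSet (G : SimpleGraph V) (S : Set V) : Prop :=
  ∀ x ∈ S, ∀ y ∈ S, ¬ G.Adj x y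

section

/-- `l` is a walk from `x` to `y`, listed by its vertices. -/
def Pth (G : SimpleGraph V) (l : List V) (x y : V) : Prop :=
  l.IsChain G.Adj ∧ l.head? = some x ∧ l.getLast? = some y

/-- The multiset `m` can be arranged as a walk from `x` to `y`. -/
def HP (G : SimpleGraph V) (x y : V) (m : Multiset V) : Prop :=
  ∃ l : List V, Pth G l x y ∧ (l : Multiset V) = m

variable {G : SimpleGraph V}

theorem Pth.reverse {l : List V} {x y : V} (h : Pth G l x y) : Pth G l.reverse y x := by
  refine ⟨?_, ?_, ?_⟩
  · rw [List.isChain_reverse]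
    refine h.1.imp ?_
    intro a b hab
    exact hab.symm
  · rw [List.head?_reverse]; exact h.2.2
  · rw [List.getLast?_reverse]; exact h.2.1

theorem Pth.ne_nil {l : List V} {x y : V} (h : Pth G l x y) : l ≠ [] := by
  rintro rfl
  simp [Pth] at h

theorem Pth.head_mem {l : List V} {x y : V} (h : Pth G l x y) : x ∈ l :=
  List.mem_of_mem_head? (by rw [h.2.1]; rfl)

theorem Pth.last_mem {l : List V} {x y : V} (h : Pth G l x y) : y ∈ l :=
  List.mem_of_mem_getLast? (by rw [h.2.2]; rfl)

theorem Pth.append {l l' : List V} {x y z w : V} (h : Pth G l x y) (h' : Pth G l' z w)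
    (a : G.Adj y z) : Pth G (l ++ l') x w := by
  refine ⟨?_, ?_, ?_⟩
  · rw [List.isChain_append]
    refine ⟨h.1, h'.1, ?_⟩
    intro u hu v hv
    rw [h.2.2] at hu
    rw [h'.2.1] at hv
    simp at hu hv
    subst hu hv
    exact a
  · rw [List.head?_append, h.2.1]; rfl
  · rw [List.getLast?_append, h'.2.2]; rfl

theorem Pth.eq_cons {l : List V} {x y : V} (h : Pth G l x y) : ∃ t, l = x :: t := by
  cases l with
  | nil => simp [Pth] at h
  | cons a t => exact ⟨t, by have := h.2.1; simp at this; rw [this]⟩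

theorem Pth.eq_concat {l : List V} {x y : V} (h : Pth G l x y) : ∃ t, l = t ++ [y] := by
  have h1 := h.2.2
  rw [List.getLast?_eq_some_iff] at h1
  exact h1

theorem pth_singleton (x : V) : Pth G [x] x x := ⟨List.isChain_singleton x, rfl, rfl⟩

theorem Pth.eq_of_singleton {x y z : V} (h : Pth G [x] y z) : y = x ∧ z = x := by
  have h1 := h.2.1
  have h2 := h.2.2
  simp at h1 h2
  exact ⟨h1.symm, h2.symm⟩

/-- Cutting a walk in two nonempty parts. -/
theorem Pth.split {l l' : List V} {x y : V} (h : Pth G (l ++ l') x y) (hl : l ≠ [])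
    (hl' : l' ≠ []) : ∃ z w, Pth G l x z ∧ Pth G l' w y ∧ G.Adj z w := by
  obtain ⟨h1, h2, h3⟩ := h
  rw [List.isChain_append] at h1
  obtain ⟨c1, c2, c3⟩ := h1
  refine ⟨l.getLast hl, l'.head hl', ⟨c1, ?_, List.getLast?_eq_some_getLast hl⟩,
    ⟨c2, List.head?_eq_some_head hl', ?_⟩, ?_⟩
  · rw [List.head?_append, List.head?_eq_some_head hl] at h2
    rw [List.head?_eq_some_head hl]
    simpa using h2
  · rw [List.getLast?_append, List.getLast?_eq_some_getLast hl'] at h3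
    rw [List.getLast?_eq_some_getLast hl']
    simpa using h3
  · exact c3 _ (List.getLast?_eq_some_getLast hl) _ (List.head?_eq_some_head hl')

theorem Pth.cut {l l' : List V} {x y z w : V} (h : Pth G (l ++ z :: w :: l') x y) :
    Pth G (l ++ [z]) x z ∧ Pth G (w :: l') w y ∧ G.Adj z w := by
  have h0 : Pth G ((l ++ [z]) ++ (w :: l')) x y := by simpa using h
  obtain ⟨a, b, h1, h2, h3⟩ := h0.split (by simp) (by simp)
  have e1 := h1.2.2
  have e2 := h2.2.1
  simp at e1 e2
  subst e1 e2
  exact ⟨h1, h2, h3⟩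

theorem Pth.prefix_to {l l' : List V} {x y z : V} (h : Pth G (l ++ z :: l') x y) :
    Pth G (l ++ [z]) x z := by
  cases l' with
  | nil =>
    have := h.2.2
    simp at this
    subst this
    exact h
  | cons w l' => exact h.cut.1

theorem Pth.suffix_from {l l' : List V} {x y z : V} (h : Pth G (l ++ z :: l') x y) :
    Pth G (z :: l') z y := by
  rcases List.eq_nil_or_concat l with rfl | ⟨t, a, rfl⟩
  · have := h.2.1
    simp at this
    subst this
    exact h
  · have h0 : Pth G (t ++ a :: z :: l') x y := by simpa using h
    exact h0.cut.2.1

theorem Pth.hp {l : List V} {x y : V} (h : Pth G l x y) : HP G x y (l : Multiset V) :=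
  ⟨l, h, rfl⟩

theorem HP.symm {x y : V} {m : Multiset V} (h : HP G x y m) : HP G y x m := by
  obtain ⟨l, h1, rfl⟩ := h
  exact ⟨l.reverse, h1.reverse, by simp⟩

theorem HP.glue {x y z w : V} {m m' : Multiset V} (h : HP G x y m) (h' : HP G z w m')
    (a : G.Adj y z) : HP G x w (m + m') := by
  obtain ⟨l, h1, rfl⟩ := h
  obtain ⟨l', h1', rfl⟩ := h'
  exact ⟨l ++ l', h1.append h1' a, by simp⟩

theorem hp_singleton (x : V) : HP G x x {x} := ⟨[x], pth_singleton x, rfl⟩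

/-- Cutting a walk between consecutive vertices. -/
theorem Pth.cut_infix {L : List V} {x y z w : V} (h : Pth G L x y) (hz : [z, w] <:+: L) :
    ∃ m m', HP G x z m ∧ HP G w y m' ∧ m + m' = (L : Multiset V) := by
  obtain ⟨s, t, rfl⟩ := hz
  have h0 : Pth G (s ++ z :: w :: t) x y := by simpa using h
  exact ⟨_, _, h0.cut.1.hp, h0.cut.2.1.hp, by simp⟩

/-- Cutting a walk by removing an inner vertex. -/
theorem Pth.cut_infix_skip {L : List V} {x y z u w : V} (h : Pth G L x y)
    (hz : [z, u, w] <:+: L) :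
    ∃ m m', HP G x z m ∧ HP G w y m' ∧ u ::ₘ (m + m') = (L : Multiset V) := by
  obtain ⟨s, t, rfl⟩ := hz
  have h0 : Pth G (s ++ z :: u :: (w :: t)) x y := by simpa using h
  have h1 : Pth G ([] ++ u :: w :: t) u y := by simpa using h0.cut.2.1
  refine ⟨_, _, h0.cut.1.hp, h1.cut.2.1.hp, ?_⟩
  rw [Multiset.coe_add, Multiset.cons_coe, Multiset.coe_eq_coe]
  have : s ++ [z, u, w] ++ t = (s ++ [z]) ++ u :: (w :: t) := by simp
  rw [this]
  exact List.perm_middle.symm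

theorem infix_append_left {l l' m : List V} (h : m <:+: l) : m <:+: l ++ l' :=
  h.trans (List.prefix_append l l').isInfix

theorem infix_append_right {l l' m : List V} (h : m <:+: l') : m <:+: l ++ l' :=
  h.trans (List.suffix_append l l').isInfix

/-- In a duplicate-free list, a vertex has at most one successor. -/
theorem next_unique {L : List V} (hL : L.Nodup) {z w w' : V} (h : [z, w] <:+: L)
    (h' : [z, w'] <:+: L) : w = w' := by
  induction L with
  | nil => simp at h
  | cons a L ih =>
    have hnd := List.nodup_cons.1 hL
    rw [List.infix_cons_iff] at h h'
    rcases h with h | h <;> rcases h' with h' | h'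
    · rw [List.cons_prefix_cons] at h h'
      obtain ⟨_, h⟩ := h
      obtain ⟨_, h'⟩ := h'
      cases L with
      | nil => simp at h
      | cons b L =>
        rw [List.cons_prefix_cons] at h h'
        rw [h.1, h'.1]
    · rw [List.cons_prefix_cons] at h
      exact absurd (h.1 ▸ h'.subset (by simp)) hnd.1
    · rw [List.cons_prefix_cons] at h'
      exact absurd (h'.1 ▸ h.subset (by simp)) hnd.1
    · exact ih hnd.2 h h'

theorem prev_unique {L : List V} (hL : L.Nodup) {z z' w : V} (h : [z, w] <:+: L)
    (h' : [z', w] <:+: L) : z = z' := by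
  have h1 : [w, z] <:+: L.reverse := by
    have := List.reverse_infix.2 h; simpa using this
  have h2 : [w, z'] <:+: L.reverse := by
    have := List.reverse_infix.2 h'; simpa using this
  exact next_unique (List.nodup_reverse.2 hL) h1 h2

/-- Every vertex of a list that is not its last one has a successor. -/
theorem exists_next {L : List V} {x y u : V} (h : Pth G L x y) (hu : u ∈ L) (huy : u ≠ y) :
    ∃ w, [u, w] <:+: L := by
  obtain ⟨s, t, rfl⟩ := List.append_of_mem hu
  cases t with
  | nil =>
    have := h.2.2
    simp at this
    exact absurd this huy
  | cons w t => exact ⟨w, s, t, by simp⟩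

/-- The successor counting inequality along a list. -/
theorem countP_tail_add_le (P Q R : V → Prop) (L : List V)
    (h1 : ∀ z w, [z, w] <:+: L → Q z → ¬ P w) (h2 : ∀ z ∈ L, R z → ¬ Q z)
    (h3 : ∀ z w, [z, w] <:+: L → R z → ¬ P w) :
    L.tail.countP P + L.countP Q + L.countP R ≤ L.length := by
  induction L with
  | nil => simp
  | cons a L ih =>
    have key : L.tail.countP P + L.countP Q + L.countP R ≤ L.length := by
      apply ih
      · intro z w h; exact h1 z w (h.trans (List.suffix_cons a L).isInfix)
      · intro z h; exact h2 z (List.mem_cons_of_mem _ h)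
      · intro z w h; exact h3 z w (h.trans (List.suffix_cons a L).isInfix)
    have ha := h2 a (by simp)
    cases L with
    | nil =>
      by_cases q : Q a <;> by_cases r : R a <;> simp_all
    | cons b L =>
      have hb1 := h1 a b ⟨[], L, by simp⟩
      have hb3 := h3 a b ⟨[], L, by simp⟩
      simp only [List.tail_cons, List.countP_cons, List.length_cons] at key ⊢
      by_cases q : Q a <;> by_cases r : R a <;> by_cases p : P b <;> simp_all <;> omega

end

section

variable {G : SimpleGraph V}

/-- A cyclic arrangement of `Cm` into two `A`-free intervals `Is`, `It` and two blocks
`B1`, `B2` whose ends are in `A`. -/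
structure Conf (G : SimpleGraph V) (A : Finset V) (Cm : Multiset V) where
  (Is B1 It B2 : List V)
  (xs ys f1 g1 xt yt f2 g2 : V)
  pIs : Pth G Is xs ys
  pB1 : Pth G B1 f1 g1
  pIt : Pth G It xt yt
  pB2 : Pth G B2 f2 g2
  e1 : G.Adj ys f1
  e2 : G.Adj g1 xt
  e3 : G.Adj yt f2
  e4 : G.Adj g2 xs
  hC : (Is : Multiset V) + B1 + It + B2 = Cm
  f1A : f1 ∈ A
  g1A : g1 ∈ A
  f2A : f2 ∈ A
  g2A : g2 ∈ A
  sA : ∀ v ∈ Is, v ∉ A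
  tA : ∀ v ∈ It, v ∉ A

variable {A H : Finset V} {Cm : Multiset V} {Λ : V → Prop}

/-- Exchanging the two intervals. -/
def Conf.swap (K : Conf G A Cm) : Conf G A Cm where
  Is := K.It
  B1 := K.B2
  It := K.Is
  B2 := K.B1
  xs := K.xt
  ys := K.yt
  f1 := K.f2
  g1 := K.g2
  xt := K.xs
  yt := K.ys
  f2 := K.f1
  g2 := K.g1
  pIs := K.pIt
  pB1 := K.pB2
  pIt := K.pIs
  pB2 := K.pB1
  e1 := K.e3
  e2 := K.e4
  e3 := K.e1
  e4 := K.e2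
  hC := Eq.trans (by abel) K.hC
  f1A := K.f2A
  g1A := K.g2A
  f2A := K.f1A
  g2A := K.g1A
  sA := K.tA
  tA := K.sA

/-- Reversing the orientation. -/
def Conf.rev (K : Conf G A Cm) : Conf G A Cm where
  Is := K.Is.reverse
  B1 := K.B2.reverse
  It := K.It.reverse
  B2 := K.B1.reverse
  xs := K.ys
  ys := K.xs
  f1 := K.g2
  g1 := K.f2
  xt := K.yt
  yt := K.xt
  f2 := K.g1
  g2 := K.f1
  pIs := K.pIs.reverse
  pB1 := K.pB2.reverse
  pIt := K.pIt.reverse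
  pB2 := K.pB1.reverse
  e1 := K.e4.symm
  e2 := K.e3.symm
  e3 := K.e2.symm
  e4 := K.e1.symm
  hC := Eq.trans (by simp only [Multiset.coe_reverse]; abel) K.hC
  f1A := K.g2A
  g1A := K.f2A
  f2A := K.g1A
  g2A := K.f1A
  sA := fun v hv => K.sA v (List.mem_reverse.1 hv)
  tA := fun v hv => K.tA v (List.mem_reverse.1 hv)

/-- `O` is a rearrangement of the first interval starting at `p` whose end is adjacent to
the head of the following block. -/
def XO (K : Conf G A Cm) (O : List V) (p : V) : Prop :=
  ∃ e, Pth G O p e ∧ (O : Multiset V) = K.Is ∧ G.Adj e K.f1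

theorem Conf.xo (K : Conf G A Cm) : XO K K.Is K.xs := ⟨K.ys, K.pIs, rfl, K.e1⟩

/-- `H` is a component of the complement of a longest cycle `Cm`, with attachments `A`. -/
structure Base (G : SimpleGraph V) (H A : Finset V) (Cm : Multiset V) : Prop where
  nd : Cm.Nodup
  dj : ∀ v ∈ Cm, v ∉ H
  AC : ∀ a ∈ A, a ∈ Cm
  A2 : 2 ≤ A.card
  Hne : H.Nonempty
  HE : ∀ u ∈ H, ∀ w, G.Adj u w → w ∈ H ∨ w ∈ A
  L1 : ∀ x y m, HP G x y m → G.Adj y x → m.Nodup → (∀ v ∈ m, v ∉ H) → 3 ≤ m.card →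
    m.card ≤ Cm.card
  AA : ∀ a ∈ A, ∀ b ∈ A, a ≠ b → ∀ m, HP G a b m → m.Nodup → (∀ v ∈ m, v ∉ H) →
    m.card < Cm.card

/-- The extremal properties used in the main lemma. -/
structure Sys [Fintype V] (G : SimpleGraph V) (H A : Finset V) (Cm : Multiset V)
    (Λ : V → Prop) : Prop extends Base G H A Cm where
  SK : ∀ a ∈ A, ∀ b ∈ A, a ≠ b → ∀ m y, HP G a b m → y ::ₘ m = Cm → Λ y
  NL : ∀ (K : Conf G A Cm) (O : List V) (p : V), XO K O p → ¬ Λ p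
  L3 : ∀ p q, p ∉ A → q ∉ A → p ∉ H → q ∉ H → p ≠ q → ¬ G.Adj p q →
    Fintype.card V + 1 ≤ (Finset.univ.filter (G.Adj p)).card
      + (Finset.univ.filter (G.Adj q)).card + A.card + H.card

/-- A pair of disjoint walks covering `Cm` and ending in `A`. -/
structure Duo (G : SimpleGraph V) (A : Finset V) (Cm : Multiset V) (L M : List V)
    (p q g h : V) : Prop where
  pL : Pth G L p g
  pM : Pth G M q h
  gA : g ∈ A
  hA : h ∈ A
  hC : (L : Multiset V) + M = Cm

theorem Duo.symm {L M : List V} {p q g h : V} (D : Duo G A Cm L M p q g h) :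
    Duo G A Cm M L q p h g :=
  ⟨D.pM, D.pL, D.hA, D.gA, by rw [add_comm]; exact D.hC⟩


theorem Base.full (S : Base G H A Cm) {a b : V} {m : Multiset V} (h : HP G a b m)
    (hm : m = Cm) (ha : a ∈ A) (hb : b ∈ A) (hab : a ≠ b) : False := by
  subst hm
  exact lt_irrefl _ (S.AA a ha b hb hab _ h S.nd S.dj)

theorem Base.ins (S : Base G H A Cm) {a b w : V} {m : Multiset V} (h : HP G a b m)
    (hm : m = w ::ₘ Cm) (hw : w ∉ Cm) (hwH : w ∉ H) (ha : a ∈ A) (hb : b ∈ A) (hab : a ≠ b) :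
    False := by
  subst hm
  have := S.AA a ha b hb hab _ h (Multiset.nodup_cons.2 ⟨hw, S.nd⟩) (by
    intro v hv
    rcases Multiset.mem_cons.1 hv with rfl | hv
    · exact hwH
    · exact S.dj v hv)
  simp at this

theorem Base.nodup_append (S : Base G H A Cm) {L M : List V}
    (h : (L : Multiset V) + M = Cm) : (L ++ M).Nodup := by
  have := S.nd
  rw [← h, Multiset.coe_add, Multiset.coe_nodup] at this
  exact this

theorem Duo.disj {L M : List V} {p q g h : V} (D : Duo G A Cm L M p q g h)
    (S : Base G H A Cm) {u v : V} (hu : u ∈ L) (hv : v ∈ M) : u ≠ v := by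
  rintro rfl
  exact (List.nodup_append.1 (S.nodup_append D.hC)).2.2 _ hu _ hv rfl

theorem Duo.ne {L M : List V} {p q g h : V} (D : Duo G A Cm L M p q g h)
    (S : Base G H A Cm) : g ≠ h := D.disj S D.pL.last_mem D.pM.last_mem

theorem Duo.not_adj {L M : List V} {p q g h : V} (D : Duo G A Cm L M p q g h)
    (S : Base G H A Cm) : ¬ G.Adj p q := fun a =>
  S.full (D.pL.hp.symm.glue D.pM.hp a) D.hC D.gA D.hA (D.ne S)

theorem Duo.cross {L M : List V} {p q g h z w : V} (D : Duo G A Cm L M p q g h)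
    (S : Base G H A Cm) (hz : [z, w] <:+: L) (a : G.Adj q z) : ¬ G.Adj p w := by
  intro b
  obtain ⟨m, m', h1, h2, hm⟩ := D.pL.cut_infix hz
  exact S.full ((h2.symm.glue h1 b.symm).glue D.pM.hp a.symm)
    (by rw [← D.hC, ← hm]; abel) D.gA D.hA (D.ne S)

theorem Duo.off {L M : List V} {p q g h w : V} (D : Duo G A Cm L M p q g h)
    (S : Base G H A Cm) (hw : w ∉ Cm) (hwH : w ∉ H) (a : G.Adj q w) : ¬ G.Adj p w := by
  intro b
  exact S.ins ((D.pL.hp.symm.glue (hp_singleton w) b).glue D.pM.hp a.symm)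
    (by rw [← D.hC, ← Multiset.singleton_add]; abel) hw hwH D.gA D.hA (D.ne S)

variable [Fintype V]

theorem Duo.skip {L M : List V} {p q g h z y w : V} (D : Duo G A Cm L M p q g h)
    (S : Sys G H A Cm Λ) (hz : [z, y, w] <:+: M) (hy : ¬ Λ y) (a : G.Adj p z) :
    ¬ G.Adj q w := by
  intro b
  obtain ⟨m, m', h1, h2, hm⟩ := D.pM.cut_infix_skip hz
  exact hy (S.SK _ D.gA _ D.hA (D.ne S.toBase) _ y
    ((D.pL.hp.symm.glue h1.symm a).glue h2 b)
    (by rw [← D.hC, ← hm, ← Multiset.singleton_add, ← Multiset.singleton_add]; abel))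

theorem Duo.skip_head {L M t : List V} {p q g h z : V} (D : Duo G A Cm L M p q g h)
    (S : Sys G H A Cm Λ) (hM : M = q :: z :: t) (hy : ¬ Λ q) : ¬ G.Adj p z := by
  intro a
  have h1 := D.pM
  rw [hM] at h1
  have h2 : Pth G ([] ++ q :: z :: t) q h := h1
  exact hy (S.SK _ D.gA _ D.hA (D.ne S.toBase) _ q (D.pL.hp.symm.glue h2.cut.2.1.hp a)
    (by rw [← D.hC, hM, ← Multiset.cons_coe q, ← Multiset.singleton_add,
          ← Multiset.singleton_add]; abel))

/-- A vertex contributing nothing to the degree sum of the heads of a `Duo`. -/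
def Miss (G : SimpleGraph V) (L M : List V) (p q u : V) : Prop :=
  (u ∈ L ∧ ¬ G.Adj q u ∧ ∀ w, [u, w] <:+: L → ¬ G.Adj p w) ∨
  (u ∈ M ∧ ¬ G.Adj p u ∧ ∀ w, [u, w] <:+: M → ¬ G.Adj q w) ∨
  (u ∉ L ∧ u ∉ M ∧ ¬ G.Adj p u ∧ ¬ G.Adj q u)

theorem Miss.symm {L M : List V} {p q u : V} (h : Miss G L M p q u) : Miss G M L q p u := by
  unfold Miss at *
  tauto

theorem card_filter_le_of_lists {H : Finset V} {L M : List V} (P : V → Prop)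
    (hP : ∀ u ∈ H, ¬ P u) :
    (Finset.univ.filter P).card ≤ L.countP P + M.countP P
      + (Finset.univ.filter fun u => (u ∉ L ∧ u ∉ M ∧ u ∉ H) ∧ P u).card := by
  have h1 : Finset.univ.filter P ⊆ ((L.filter P).toFinset ∪ (M.filter P).toFinset)
      ∪ (Finset.univ.filter fun u => (u ∉ L ∧ u ∉ M ∧ u ∉ H) ∧ P u) := by
    intro u hu
    have hu' : P u := by simpa using hu
    have := fun h => hP u h hu'
    simp only [Finset.mem_union, List.mem_toFinset, List.mem_filter, Finset.mem_filter,
      Finset.mem_univ, true_and, decide_eq_true_eq]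
    tauto
  refine (Finset.card_le_card h1).trans ((Finset.card_union_le _ _).trans ?_)
  refine Nat.add_le_add_right ((Finset.card_union_le _ _).trans ?_) _
  have e1 := List.toFinset_card_le (L.filter P)
  have e2 := List.toFinset_card_le (M.filter P)
  rw [List.countP_eq_length_filter, List.countP_eq_length_filter]
  omega

theorem Duo.card_add {L M : List V} {p q g h : V} (D : Duo G A Cm L M p q g h)
    (S : Base G H A Cm) (pA : p ∉ A) (qA : q ∉ A) (T : Finset V)
    (hT : ∀ u ∈ T, u ∉ H ∧ Miss G L M p q u) :
    (Finset.univ.filter (G.Adj p)).card + (Finset.univ.filter (G.Adj q)).card + T.card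
      + H.card ≤ Fintype.card V := by
  have hnd := S.nodup_append D.hC
  have hLM := List.nodup_append.1 hnd
  have mL : ∀ u ∈ L, u ∈ Cm := fun u hu => by rw [← D.hC]; simp [hu]
  have mM : ∀ u ∈ M, u ∈ Cm := fun u hu => by rw [← D.hC]; simp [hu]
  have pH : ∀ u ∈ H, ¬ G.Adj p u := fun u hu a => by
    rcases S.HE u hu p a.symm with h | h
    · exact S.dj p (mL p D.pL.head_mem) h
    · exact pA h
  have qH : ∀ u ∈ H, ¬ G.Adj q u := fun u hu a => by
    rcases S.HE u hu q a.symm with h | h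
    · exact S.dj q (mM q D.pM.head_mem) h
    · exact qA h
  obtain ⟨R, hR⟩ : ∃ R : V → Prop, ∀ u, R u ↔ u ∈ T := ⟨_, fun _ => Iff.rfl⟩
  replace hT : ∀ u, R u → u ∉ H ∧ Miss G L M p q u := fun u hu => hT u ((hR u).1 hu)
  have TH : ∀ u ∈ H, ¬ R u := fun u hu a => (hT u a).1 hu
  have c1 := card_filter_le_of_lists (L := L) (M := M) _ pH
  have c2 := card_filter_le_of_lists (L := L) (M := M) _ qH
  have c3 := card_filter_le_of_lists (L := L) (M := M) _ TH
  replace c3 := (Finset.card_le_card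
    (fun u hu => Finset.mem_filter.2 ⟨Finset.mem_univ u, (hR u).2 hu⟩)).trans c3
  have hML : ∀ u ∈ M, u ∉ L := fun u hu hl => hLM.2.2 u hl u hu rfl
  have l1 := countP_tail_add_le (G.Adj p) (G.Adj q) R L
    (fun z w hz a => D.cross S hz a)
    (fun z hz ht => by
      rcases (hT z ht).2 with h | h | h
      · exact h.2.1
      · exact absurd hz (hML z h.1)
      · exact absurd hz h.1)
    (fun z w hz ht => by
      have hzL : z ∈ L := hz.subset (by simp)
      rcases (hT z ht).2 with h | h | h
      · exact h.2.2 w hz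
      · exact absurd hzL (hML z h.1)
      · exact absurd hzL h.1)
  have l2 := countP_tail_add_le (G.Adj q) (G.Adj p) R M
    (fun z w hz a => D.symm.cross S hz a)
    (fun z hz ht => by
      rcases (hT z ht).2 with h | h | h
      · exact absurd h.1 (hML z hz)
      · exact h.2.1
      · exact absurd hz h.2.1)
    (fun z w hz ht => by
      have hzL : z ∈ M := hz.subset (by simp)
      rcases (hT z ht).2 with h | h | h
      · exact absurd h.1 (hML z hzL)
      · exact h.2.2 w hz
      · exact absurd hzL h.2.1)
  have t1 : L.countP (G.Adj p) = L.tail.countP (G.Adj p) := by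
    obtain ⟨t, ht⟩ := D.pL.eq_cons
    rw [ht]; simp
  have t2 : M.countP (G.Adj q) = M.tail.countP (G.Adj q) := by
    obtain ⟨t, ht⟩ := D.pM.eq_cons
    rw [ht]; simp
  set F := Finset.univ.filter fun u => (u ∉ L ∧ u ∉ M ∧ u ∉ H) with hF
  have f1 : (Finset.univ.filter fun u => (u ∉ L ∧ u ∉ M ∧ u ∉ H) ∧ G.Adj p u).card
      + (Finset.univ.filter fun u => (u ∉ L ∧ u ∉ M ∧ u ∉ H) ∧ G.Adj q u).card
      + (Finset.univ.filter fun u => (u ∉ L ∧ u ∉ M ∧ u ∉ H) ∧ R u).card ≤ F.card := by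
    rw [← Finset.card_union_of_disjoint, ← Finset.card_union_of_disjoint]
    · apply Finset.card_le_card
      intro u hu
      simp only [Finset.mem_union, Finset.mem_filter, Finset.mem_univ, true_and, hF] at hu ⊢
      tauto
    · rw [Finset.disjoint_left]
      intro u hu hu'
      simp only [Finset.mem_union, Finset.mem_filter, Finset.mem_univ, true_and] at hu hu'
      rcases (hT u hu'.2).2 with h | h | h <;> tauto
    · rw [Finset.disjoint_left]
      intro u hu hu'
      simp only [Finset.mem_filter, Finset.mem_univ, true_and] at hu hu'
      have hC : u ∉ Cm := by
        rw [← D.hC]; simp; tauto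
      exact D.off S hC hu.1.2.2 hu'.2 hu.2
  have tot : L.length + M.length + F.card + H.card ≤ Fintype.card V := by
    have n1 : L.toFinset.card = L.length := List.toFinset_card_of_nodup hLM.1
    have n2 : M.toFinset.card = M.length := List.toFinset_card_of_nodup hLM.2.1
    rw [← n1, ← n2, ← Finset.card_union_of_disjoint, ← Finset.card_union_of_disjoint,
      ← Finset.card_union_of_disjoint]
    · exact Finset.card_le_univ _
    · rw [Finset.disjoint_left]
      intro u hu hu'
      simp only [Finset.mem_union, Finset.mem_filter, Finset.mem_univ, true_and, hF,
        List.mem_toFinset] at hu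
      rcases hu with (hu | hu) | hu
      · exact S.dj u (mL u hu) hu'
      · exact S.dj u (mM u hu) hu'
      · exact hu.2.2 hu'
    · rw [Finset.disjoint_left]
      intro u hu hu'
      simp only [Finset.mem_union, Finset.mem_filter, Finset.mem_univ, true_and, hF,
        List.mem_toFinset] at hu hu'
      tauto
    · rw [Finset.disjoint_left]
      intro u hu hu'
      simp only [List.mem_toFinset] at hu hu'
      exact hML u hu' hu
  omega

end

section

variable {G : SimpleGraph V} {A H : Finset V} {Cm : Multiset V} {Λ : V → Prop}

theorem fst_mem {L : List V} {z w : V} (h : [z, w] <:+: L) : z ∈ L := h.subset (by simp)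

theorem snd_mem {L : List V} {z w : V} (h : [z, w] <:+: L) : w ∈ L := h.subset (by simp)

theorem exists_interval {L : List V} {x y : V} (h : Pth G L x y) (hx : x ∉ A) (hy : y ∈ A) :
    ∃ I b R, L = I ++ b :: R ∧ b ∈ A ∧ I ≠ [] ∧ ∀ v ∈ I, v ∉ A := by
  induction L generalizing x with
  | nil => simp [Pth] at h
  | cons c t ih =>
    have hc : c = x := by simpa using h.2.1
    subst hc
    cases t with
    | nil => exact absurd (h.eq_of_singleton.2 ▸ hy) hx
    | cons d t =>
      have h' : Pth G ([] ++ c :: d :: t) c y := h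
      by_cases hd : d ∈ A
      · exact ⟨[c], d, t, rfl, hd, by simp, by simpa using hx⟩
      · obtain ⟨I, b, R, e, hb, hI, hv⟩ := ih h'.cut.2.1 hd
        refine ⟨c :: I, b, R, by simp [e], hb, by simp, ?_⟩
        intro v hv'
        rcases List.mem_cons.1 hv' with rfl | h1
        · exact hx
        · exact hv v h1

theorem XO.perm {K : Conf G A Cm} {O : List V} {p : V} (h : XO K O p) : O.Perm K.Is := by
  obtain ⟨e, _, h2, _⟩ := h
  exact Multiset.coe_eq_coe.1 h2

theorem XO.mem {K : Conf G A Cm} {O : List V} {p : V} (h : XO K O p) {u : V} :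
    u ∈ O ↔ u ∈ K.Is := h.perm.mem_iff

theorem XO.head_mem {K : Conf G A Cm} {O : List V} {p : V} (h : XO K O p) : p ∈ K.Is := by
  obtain ⟨e, h1, _, _⟩ := id h
  exact h.mem.1 h1.head_mem

theorem XO.path {K : Conf G A Cm} {O : List V} {p : V} (h : XO K O p) :
    Pth G (O ++ K.B1) p K.g1 := by
  obtain ⟨e, h1, _, h3⟩ := h
  exact h1.append K.pB1 h3

theorem Conf.duo (K : Conf G A Cm) {O Q : List V} {p q : V} (hO : XO K O p)
    (hQ : XO K.swap Q q) : Duo G A Cm (O ++ K.B1) (Q ++ K.B2) p q K.g1 K.g2 where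
  pL := hO.path
  pM := hQ.path
  gA := K.g1A
  hA := K.g2A
  hC := by
    have h1 : (O : Multiset V) = K.Is := Multiset.coe_eq_coe.2 hO.perm
    have h2 : (Q : Multiset V) = K.It := Multiset.coe_eq_coe.2 hQ.perm
    rw [← Multiset.coe_add, ← Multiset.coe_add, h1, h2, ← add_assoc]
    exact K.hC

theorem Conf.nodup (K : Conf G A Cm) (S : Base G H A Cm) :
    (K.Is ++ K.B1 ++ K.It ++ K.B2).Nodup := by
  have := S.nd
  rw [← K.hC] at this
  simpa [Multiset.coe_add] using this

theorem Conf.mem_iff (K : Conf G A Cm) {u : V} :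
    u ∈ Cm ↔ u ∈ K.Is ∨ u ∈ K.B1 ∨ u ∈ K.It ∨ u ∈ K.B2 := by
  have h : u ∈ (K.Is : Multiset V) + K.B1 + K.It + K.B2 ↔ u ∈ Cm := by rw [K.hC]
  rw [← h]; simp

/-- Vertices that are not successors of `A`-vertices inside the blocks. -/
def Side (K : Conf G A Cm) (u : V) : Prop :=
  u ∈ K.Is ∨ u = K.f1 ∨ u ∈ K.It ∨ u = K.f2 ∨ u ∉ Cm

theorem Side.swap {K : Conf G A Cm} {u : V} (h : Side K u) : Side K.swap u := by
  unfold Side at *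
  change u ∈ K.It ∨ u = K.f2 ∨ u ∈ K.Is ∨ u = K.f1 ∨ u ∉ Cm
  tauto

theorem Conf.g_ne (K : Conf G A Cm) (S : Base G H A Cm) : K.g1 ≠ K.g2 :=
  (K.duo K.xo K.swap.xo).ne S

/-- The interval following an `A`-vertex inside the first block. -/
theorem Conf.split_fst (K : Conf G A Cm) (S : Base G H A Cm) {a x : V} (ha : a ∈ A)
    (hx : [a, x] <:+: K.B1) :
    x ∉ A ∧ ∃ K' : Conf G A Cm, K'.xs = x ∧ K'.It = K.It ∧ K'.xt = K.xt ∧ K'.yt = K.yt ∧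
      K'.f2 = K.f2 := by
  obtain ⟨P, R, hB⟩ := hx
  have hB' : K.B1 = P ++ a :: x :: R := by rw [← hB]; simp
  have pB := K.pB1
  rw [hB'] at pB
  obtain ⟨c1, c2, c3⟩ := pB.cut
  have hxA : x ∉ A := by
    intro hx
    have hnd := K.nodup S
    rw [hB'] at hnd
    have hax : x ≠ a := by
      rintro rfl
      simp [List.nodup_append] at hnd
    refine S.full (((((c2.hp).glue K.pIt.hp K.e2).glue K.pB2.hp K.e3).glue K.pIs.hp K.e4).glue
      c1.hp K.e1) ?_ hx ha hax
    refine Eq.trans ?_ K.hC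
    rw [hB']
    have : ((P ++ a :: x :: R : List V) : Multiset V)
        = ((P ++ [a] : List V) : Multiset V) + ((x :: R : List V) : Multiset V) := by simp
    rw [this]; abel
  refine ⟨hxA, ?_⟩
  obtain ⟨I, b, R', e, hb, hI, hv⟩ := exists_interval c2 hxA K.g1A
  rw [e] at c2
  obtain ⟨z, w, d1, d2, d3⟩ := c2.split hI (by simp)
  have hwb : w = b := by have := d2.2.1; simpa using this.symm
  subst hwb
  refine ⟨{
    Is := I, B1 := w :: R', It := K.It, B2 := K.B2 ++ K.Is ++ (P ++ [a])
    xs := x, ys := z, f1 := w, g1 := K.g1, xt := K.xt, yt := K.yt, f2 := K.f2, g2 := a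
    pIs := d1, pB1 := d2, pIt := K.pIt
    pB2 := (K.pB2.append K.pIs K.e4).append c1 K.e1
    e1 := d3, e2 := K.e2, e3 := K.e3, e4 := c3
    hC := ?_, f1A := hb, g1A := K.g1A, f2A := K.f2A, g2A := ha, sA := hv, tA := K.tA },
    rfl, rfl, rfl, rfl, rfl⟩
  refine Eq.trans ?_ K.hC
  rw [hB', show P ++ a :: x :: R = (P ++ [a]) ++ (x :: R) by simp, e]
  simp only [← Multiset.coe_add]
  abel

/-- A successor of an `A`-vertex in the first block is missed if it cannot be skipped. -/
theorem Conf.miss_of_skip (K : Conf G A Cm) (S : Base G H A Cm) {O Q : List V} {p q a x : V}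
    (hO : XO K O p) (hQ : XO K.swap Q q) (ha : a ∈ A) (hx : [a, x] <:+: K.B1)
    (hs : ∀ m, HP G a K.g2 m → x ::ₘ m = Cm → False) :
    Miss G (O ++ K.B1) (Q ++ K.B2) p q x := by
  have D := K.duo hO hQ
  have hnd := S.nodup_append D.hC
  have hL := (List.nodup_append.1 hnd).1
  have hxA := (K.split_fst S ha hx).1
  have hxB : x ∈ K.B1 := snd_mem hx
  have hB1 := (List.nodup_append.1 hL).2.1
  refine Or.inl ⟨List.mem_append_right _ hxB, ?_, ?_⟩
  · intro hqx
    obtain ⟨m, m', h1, h2, hm⟩ := K.pB1.cut_infix hx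
    have hag : a ≠ K.g1 := by
      intro h
      obtain ⟨s, t, e⟩ := hx
      have h3 := K.pB1.2.2
      rw [← e] at hB1 h3
      have : K.g1 ∈ x :: t := by
        have h4 : (x :: t).getLast? = some K.g1 := by
          rw [← h3, show s ++ [a, x] ++ t = (s ++ [a]) ++ x :: t by simp,
            List.getLast?_append, List.getLast?_eq_some_getLast (List.cons_ne_nil x t)]
          rfl
        exact List.mem_of_mem_getLast? (by rw [h4]; rfl)
      rw [← h] at this
      simp [List.nodup_append] at hB1 this
      tauto
    obtain ⟨e, pQ, eQ, aQ⟩ := hQ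
    refine S.full ((((h1.symm.glue K.pIs.hp.symm K.e1.symm).glue K.pB2.hp.symm K.e4.symm).glue
      pQ.hp.symm aQ.symm).glue h2 hqx) ?_ ha K.g1A hag
    refine Eq.trans ?_ K.hC
    rw [← hm, eQ]
    change _ + (K.It : Multiset V) + _ = _
    abel
  · intro w hw hpw
    obtain ⟨s, t, e⟩ := hx
    cases t with
    | nil =>
      have h3 := K.pB1.2.2
      rw [← e] at h3
      simp at h3
      exact hxA (h3 ▸ K.g1A)
    | cons w' t =>
      have hw' : [x, w'] <:+: O ++ K.B1 :=
        infix_append_right ⟨s ++ [a], t, by rw [← e]; simp⟩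
      have := next_unique hL hw hw'
      subst this
      obtain ⟨m, m', h1, h2, hm⟩ :=
        K.pB1.cut_infix_skip (z := a) (u := x) (w := w) ⟨s, t, by rw [← e]; simp⟩
      obtain ⟨o, pO, eO, aO⟩ := hO
      refine hs _ ((((h1.symm.glue pO.hp.symm aO.symm).glue h2 hpw).glue K.pIt.hp K.e2).glue
          K.pB2.hp K.e3) ?_
      refine Eq.trans ?_ K.hC
      rw [← hm, eO, ← Multiset.singleton_add, ← Multiset.singleton_add]
      abel

variable [Fintype V]

theorem Conf.not_light_fst (K : Conf G A Cm) (S : Sys G H A Cm Λ) {a x : V} (ha : a ∈ A)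
    (hx : [a, x] <:+: K.B1) : ¬ Λ x := by
  obtain ⟨_, K', h, _⟩ := K.split_fst S.toBase ha hx
  exact h ▸ S.NL K' _ _ K'.xo

/-- Successors of `A`-vertices in the first block are missed. -/
theorem Conf.forced_fst (K : Conf G A Cm) (S : Sys G H A Cm Λ) {O Q : List V} {p q a x : V}
    (hO : XO K O p) (hQ : XO K.swap Q q) (ha : a ∈ A) (hx : [a, x] <:+: K.B1) :
    Miss G (O ++ K.B1) (Q ++ K.B2) p q x := by
  have D := K.duo hO hQ
  have hag : a ≠ K.g2 := D.disj S.toBase (List.mem_append_right _ (fst_mem hx)) D.pM.last_mem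
  exact K.miss_of_skip S.toBase hO hQ ha hx fun m hm e =>
    K.not_light_fst S ha hx (S.SK a ha K.g2 K.g2A hag m x hm e)

/-- Successors of `A`-vertices in the second block are missed. -/
theorem Conf.forced_snd (K : Conf G A Cm) (S : Sys G H A Cm Λ) {O Q : List V} {p q a x : V}
    (hO : XO K O p) (hQ : XO K.swap Q q) (ha : a ∈ A) (hx : [a, x] <:+: K.B2) :
    Miss G (O ++ K.B1) (Q ++ K.B2) p q x :=
  (K.swap.forced_fst S hQ hO ha hx).symm

theorem Side.not_next {K : Conf G A Cm} {u a : V} (h : Side K u) (S : Sys G H A Cm Λ) :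
    ¬ [a, u] <:+: K.B1 := by
  intro hu
  have huB : u ∈ K.B1 := snd_mem hu
  have hnd := K.nodup S.toBase
  simp only [List.nodup_append, List.mem_append] at hnd
  rcases h with h | h | h | h | h
  · exact hnd.1.1.2.2 u h u huB rfl
  · subst h
    obtain ⟨t, ht⟩ := K.pB1.eq_cons
    have hn := hnd.1.1.2.1
    rw [ht] at hn hu
    rw [List.infix_cons_iff] at hu
    rcases hu with hu | hu
    · rw [List.cons_prefix_cons] at hu
      exact (List.nodup_cons.1 hn).1 (hu.2.subset (by simp))
    · exact (List.nodup_cons.1 hn).1 (snd_mem hu)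
  · exact hnd.1.2.2 u (Or.inr huB) u h rfl
  · subst h
    exact hnd.2.2 _ (Or.inl (Or.inr huB)) _ K.pB2.head_mem rfl
  · exact h (K.mem_iff.2 (by tauto))

/-- Two distinct additional missed vertices are impossible. -/
theorem Conf.two_miss (K : Conf G A Cm) (S : Sys G H A Cm Λ) {O Q : List V} {p q u w : V}
    (hO : XO K O p) (hQ : XO K.swap Q q) (huw : u ≠ w)
    (mu : Miss G (O ++ K.B1) (Q ++ K.B2) p q u) (mw : Miss G (O ++ K.B1) (Q ++ K.B2) p q w)
    (su : Side K u) (sw : Side K w) (uH : u ∉ H) (wH : w ∉ H) : False := by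
  have D := K.duo hO hQ
  have hnx : ∀ a ∈ (A.erase K.g1).erase K.g2,
      ∃ x, [a, x] <:+: K.B1 ∨ [a, x] <:+: K.B2 := by
    intro a ha
    simp only [Finset.mem_erase] at ha
    rcases K.mem_iff.1 (S.AC a ha.2.2) with h | h | h | h
    · exact absurd ha.2.2 (K.sA a h)
    · obtain ⟨x, hx⟩ := exists_next K.pB1 h ha.2.1
      exact ⟨x, Or.inl hx⟩
    · exact absurd ha.2.2 (K.tA a h)
    · obtain ⟨x, hx⟩ := exists_next K.pB2 h ha.1
      exact ⟨x, Or.inr hx⟩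
  choose! s hs using hnx
  have hnd := K.nodup S.toBase
  simp only [List.nodup_append, List.mem_append] at hnd
  have inj : Set.InjOn s ((A.erase K.g1).erase K.g2 : Finset V) := by
    intro a ha b hb hab
    have h1 := hs a ha
    have h2 := hs b hb
    rw [← hab] at h2
    rcases h1 with h1 | h1 <;> rcases h2 with h2 | h2
    · exact prev_unique hnd.1.1.2.1 h1 h2
    · exact absurd rfl (hnd.2.2 _ (Or.inl (Or.inr (snd_mem h1))) _
        (snd_mem h2))
    · exact absurd rfl (hnd.2.2 _ (Or.inl (Or.inr (snd_mem h2))) _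
        (snd_mem h1))
    · exact prev_unique hnd.2.1 h1 h2
  set T0 := ((A.erase K.g1).erase K.g2).image s with hT0
  have cT0 : T0.card = A.card - 1 - 1 := by
    rw [hT0, Finset.card_image_of_injOn inj, Finset.card_erase_of_mem, Finset.card_erase_of_mem]
    · exact K.g1A
    · exact Finset.mem_erase.2 ⟨(K.g_ne S.toBase).symm, K.g2A⟩
  have key : ∀ v, Side K v → v ∉ T0 := by
    intro v hv hv'
    obtain ⟨a, ha, rfl⟩ := Finset.mem_image.1 hv'
    rcases hs a ha with h | h
    · exact hv.not_next S h
    · exact hv.swap.not_next S h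
  have cT : (insert u (insert w T0)).card = A.card := by
    rw [Finset.card_insert_of_notMem, Finset.card_insert_of_notMem (key w sw), cT0]
    · have := S.A2
      omega
    · simp only [Finset.mem_insert, not_or]
      exact ⟨huw, key u su⟩
  have pA : p ∉ A := K.sA p hO.head_mem
  have qA : q ∉ A := K.tA q hQ.head_mem
  have cnt := D.card_add S.toBase pA qA (insert u (insert w T0)) (by
    intro v hv
    simp only [Finset.mem_insert] at hv
    rcases hv with rfl | rfl | hv
    · exact ⟨uH, mu⟩
    · exact ⟨wH, mw⟩
    · obtain ⟨a, ha, rfl⟩ := Finset.mem_image.1 hv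
      have haA : a ∈ A := Finset.mem_of_mem_erase (Finset.mem_of_mem_erase ha)
      rcases hs a ha with h | h
      · exact ⟨S.dj _ (K.mem_iff.2 (Or.inr (Or.inl (snd_mem h)))),
          K.forced_fst S hO hQ haA h⟩
      · exact ⟨S.dj _ (K.mem_iff.2 (Or.inr (Or.inr (Or.inr (snd_mem h))))),
          K.forced_snd S hO hQ haA h⟩)
  have hpC : p ∈ Cm := K.mem_iff.2 (Or.inl hO.head_mem)
  have hqC : q ∈ Cm := K.mem_iff.2 (Or.inr (Or.inr (Or.inl hQ.head_mem)))
  have := S.L3 p q pA qA (S.dj p hpC) (S.dj q hqC)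
    (D.disj S.toBase D.pL.head_mem D.pM.head_mem) (D.not_adj S.toBase)
  omega

end

section

variable {G : SimpleGraph V} {A H : Finset V} {Cm : Multiset V} {Λ : V → Prop}

theorem exists_first {P : V → Prop} {L : List V} {y : V} (hy : y ∈ L) (hP : P y) :
    ∃ U z W, L = U ++ z :: W ∧ P z ∧ ∀ u ∈ U, ¬ P u := by
  induction L with
  | nil => simp at hy
  | cons a L ih =>
    by_cases ha : P a
    · exact ⟨[], a, L, rfl, ha, by simp⟩
    · have hyL : y ∈ L := by
        rcases List.mem_cons.1 hy with rfl | h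
        · exact absurd hP ha
        · exact h
      obtain ⟨U, z, W, h1, h2, h3⟩ := ih hyL
      refine ⟨a :: U, z, W, by simp [h1], h2, ?_⟩
      intro u hu
      rcases List.mem_cons.1 hu with rfl | h
      · exact ha
      · exact h3 u h

theorem Conf.ext_fst (K : Conf G A Cm) {O l : List V} (h : l <:+: O ++ [K.f1]) :
    l <:+: O ++ K.B1 := by
  obtain ⟨t, ht⟩ := K.pB1.eq_cons
  rw [ht, show O ++ K.f1 :: t = (O ++ [K.f1]) ++ t by simp]
  exact infix_append_left h

theorem Conf.ext_snd (K : Conf G A Cm) {O l : List V} (h : l <:+: O ++ [K.f2]) :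
    l <:+: O ++ K.B2 := K.swap.ext_fst h

theorem XO.symm_mem {K : Conf G A Cm} {Q : List V} {q : V} (h : XO K.swap Q q) {u : V} :
    u ∈ Q ↔ u ∈ K.It := h.mem

theorem XO.exists_next {K : Conf G A Cm} {O : List V} {p u : V} (h : XO K O p)
    (hu : u ∈ O) (hf : K.f1 ∉ O) : ∃ w, [u, w] <:+: O ++ [K.f1] := by
  obtain ⟨e, h1, _, h3⟩ := h
  refine Paper.exists_next (h1.append (pth_singleton _) h3) (List.mem_append_left _ hu) ?_
  rintro rfl
  exact hf hu

theorem Conf.f2_not_mem (K : Conf G A Cm) {Q : List V} {q : V} (hQ : XO K.swap Q q) :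
    K.f2 ∉ Q := fun h => K.tA _ (hQ.symm_mem.1 h) K.f2A

theorem Conf.mem_ext_side (K : Conf G A Cm) {Q : List V} {q u : V} (hQ : XO K.swap Q q)
    (hu : u ∈ Q ++ [K.f2]) : Side K u := by
  rcases List.mem_append.1 hu with h | h
  · exact Or.inr (Or.inr (Or.inl (hQ.symm_mem.1 h)))
  · exact Or.inr (Or.inr (Or.inr (Or.inl (by simpa using h))))

theorem infix_ne {L : List V} (hL : L.Nodup) {z w : V} (h : [z, w] <:+: L) : z ≠ w := by
  have := hL.sublist h.sublist
  simpa using this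

theorem Conf.exists_next_snd (K : Conf G A Cm) {Q : List V} {q u : V}
    (hQ : XO K.swap Q q) (hu : u ∈ Q) : ∃ w, [u, w] <:+: Q ++ [K.f2] :=
  XO.exists_next hQ hu (K.f2_not_mem hQ)

variable [Fintype V]

theorem Conf.ne_of_mem (K : Conf G A Cm) (S : Sys G H A Cm Λ) {u v : V} (hu : u ∈ K.B1)
    (hv : v ∈ K.B2) : u ≠ v :=
  (K.duo K.xo K.swap.xo).disj S.toBase (List.mem_append_right _ hu) (List.mem_append_right _ hv)

theorem Conf.reroute (K : Conf G A Cm) (S : Sys G H A Cm Λ) {O : List V} {e e' z w : V}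
    (pO : Pth G O e e') (hO : (O : Multiset V) = K.Is)
    (hz : [z, w] <:+: K.B1 ++ K.It ++ K.B2) (a : G.Adj e z) : ¬ G.Adj e' w := by
  intro b
  obtain ⟨m, m', h1, h2, hm⟩ :=
    ((K.pB1.append K.pIt K.e2).append K.pB2 K.e3).cut_infix hz
  refine S.full ((h1.glue pO.hp a.symm).glue h2 b) (Eq.trans ?_ K.hC) K.f1A K.g2A
    (K.ne_of_mem S K.pB1.head_mem K.pB2.last_mem)
  rw [hO]
  simp only [← Multiset.coe_add] at hm
  rw [show m + (K.Is : Multiset V) + m' = K.Is + (m + m') by abel, hm]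
  abel

theorem Conf.reroute_It (K : Conf G A Cm) (S : Sys G H A Cm Λ) {O : List V} {e e' z w : V}
    (pO : Pth G O e e') (hO : (O : Multiset V) = K.Is)
    (hz : [z, w] <:+: K.It ++ [K.f2]) (a : G.Adj e z) : ¬ G.Adj e' w :=
  K.reroute S pO hO
    (by rw [List.append_assoc]; exact infix_append_right (K.ext_snd hz)) a

theorem Conf.not_adj_next_f1 (K : Conf G A Cm) (S : Sys G H A Cm Λ) {O : List V} {p x : V}
    (hO : XO K O p) (hx : [K.f1, x] <:+: K.B1) : ¬ G.Adj p x := by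
  intro a
  obtain ⟨o, pO, eO, aO⟩ := hO
  have pB := K.pB1
  obtain ⟨t, ht⟩ := pB.eq_cons
  have hnd := (K.nodup S.toBase)
  simp only [List.nodup_append] at hnd
  have hn := hnd.1.1.2.1
  cases t with
  | nil =>
    rw [ht] at hx
    have := hx.length_le
    simp at this
  | cons x' t =>
    have hxx : [K.f1, x'] <:+: K.B1 := ⟨[], t, by rw [ht]; rfl⟩
    have := next_unique hn hx hxx
    subst this
    rw [ht] at pB
    have pB' : Pth G ([] ++ K.f1 :: x :: t) K.f1 K.g1 := pB
    refine S.full ((((hp_singleton K.f1).glue pO.hp.symm aO.symm).glue pB'.cut.2.1.hp a).glue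
      K.pIt.hp K.e2 |>.glue K.pB2.hp K.e3) (Eq.trans ?_ K.hC) K.f1A K.g2A
      (K.ne_of_mem S K.pB1.head_mem K.pB2.last_mem)
    rw [eO, ht, ← Multiset.cons_coe K.f1, ← Multiset.singleton_add]
    abel

theorem Conf.nodup_snd (K : Conf G A Cm) (S : Sys G H A Cm Λ) {Q : List V} {q : V}
    (hQ : XO K.swap Q q) : (Q ++ K.B2).Nodup :=
  (List.nodup_append.1 (S.nodup_append (K.duo K.xo hQ).hC)).2.1

theorem Conf.miss_snd (K : Conf G A Cm) (S : Sys G H A Cm Λ) {L Q : List V} {p q u w : V}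
    (hQ : XO K.swap Q q) (hw : [u, w] <:+: Q ++ [K.f2])
    (h1 : ¬ G.Adj p u) (h2 : ¬ G.Adj q w) : Miss G L (Q ++ K.B2) p q u := by
  refine Or.inr (Or.inl ⟨fst_mem (K.ext_snd hw), h1, ?_⟩)
  intro w' hw'
  rw [next_unique (K.nodup_snd S hQ) hw' (K.ext_snd hw)]
  exact h2

theorem Conf.miss_f2 (K : Conf G A Cm) (S : Sys G H A Cm Λ) {L Q : List V} {p q : V}
    (hQ : XO K.swap Q q) (h1 : ¬ G.Adj p K.f2) : Miss G L (Q ++ K.B2) p q K.f2 := by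
  refine Or.inr (Or.inl ⟨List.mem_append_right _ K.pB2.head_mem, h1, ?_⟩)
  intro w hw
  by_cases hfg : K.f2 = K.g2
  · obtain ⟨s, t, e⟩ := hw
    have hnd := K.nodup_snd S hQ
    have hp := hQ.path
    change Pth G (Q ++ K.B2) q K.g2 at hp
    rw [← e] at hnd hp
    have h3 : Pth G (s ++ K.f2 :: w :: t) q K.g2 := by simpa using hp
    have h4 := h3.cut.2.1.last_mem
    rw [← hfg] at h4
    have : (s ++ K.f2 :: w :: t).Nodup := by simpa using hnd
    exact absurd h4 (List.nodup_cons.1 (List.nodup_append.1 this).2.1).1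
  · obtain ⟨w', hw'⟩ := Paper.exists_next K.pB2 K.pB2.head_mem hfg
    rw [next_unique (K.nodup_snd S hQ) hw (infix_append_right hw')]
    exact K.swap.not_adj_next_f1 S hQ hw'

theorem Conf.miss_fst (K : Conf G A Cm) (S : Sys G H A Cm Λ) {O M : List V} {p q u w : V}
    (hO : XO K O p) (hw : [u, w] <:+: O ++ [K.f1])
    (h1 : ¬ G.Adj q u) (h2 : ¬ G.Adj p w) : Miss G (O ++ K.B1) M p q u :=
  (K.swap.miss_snd S (L := M) hO hw h1 h2).symm

theorem Conf.miss_f1 (K : Conf G A Cm) (S : Sys G H A Cm Λ) {O M : List V} {p q : V}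
    (hO : XO K O p) (h1 : ¬ G.Adj q K.f1) : Miss G (O ++ K.B1) M p q K.f1 :=
  (K.swap.miss_f2 S (L := M) hO h1).symm

/-- Skipping one vertex of the second interval. -/
theorem Conf.skip_snd (K : Conf G A Cm) (S : Sys G H A Cm Λ) {O Q : List V} {p q z y w : V}
    (hO : XO K O p) (hQ : XO K.swap Q q) (hzy : [z, y] <:+: Q ++ [K.f2])
    (hyw : [y, w] <:+: Q ++ [K.f2]) (a : G.Adj p z) : ¬ G.Adj q w := by
  intro b
  have hnd := K.nodup_snd S hQ
  obtain ⟨o, pQ, eQ, aQ⟩ := id hQ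
  have hnd' : (Q ++ [K.f2]).Nodup := by
    obtain ⟨t, ht⟩ := K.pB2.eq_cons
    rw [ht, show Q ++ K.f2 :: t = (Q ++ [K.f2]) ++ t by simp] at hnd
    exact (List.nodup_append.1 hnd).1
  obtain ⟨s, t, e⟩ := hyw
  have hys : y ≠ q := by
    rintro rfl
    obtain ⟨t', rfl⟩ := pQ.eq_cons
    have hn := List.nodup_cons.1 (show (y :: (t' ++ [K.f2])).Nodup from hnd')
    change [z, y] <:+: y :: (t' ++ [K.f2]) at hzy
    rw [List.infix_cons_iff] at hzy
    rcases hzy with h | h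
    · rw [List.cons_prefix_cons] at h
      exact hn.1 (h.2.subset (by simp))
    · exact hn.1 (snd_mem h)
  rcases List.eq_nil_or_concat s with rfl | ⟨U, z', rfl⟩
  · obtain ⟨t', rfl⟩ := pQ.eq_cons
    simp at e
    exact hys e.1
  have hzz : z' = z := prev_unique hnd' ⟨U, w :: t, by rw [← e]; simp⟩ hzy
  subst hzz
  have hy : ¬ Λ y := by
    rcases List.eq_nil_or_concat t with rfl | ⟨t', f, rfl⟩
    · have e1 : U ++ [z', y] ++ [w] = Q ++ [K.f2] := by rw [← e]; simp
      obtain ⟨e2, e3⟩ := List.append_inj' e1 rfl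
      simp only [List.cons.injEq, and_true] at e3
      subst e3
      rw [← e2] at pQ eQ
      refine S.NL K.swap (y :: z' :: U.reverse) y ⟨q, ?_, ?_, b⟩
      · have := pQ.reverse
        have h0 : Pth G (U ++ z' :: y :: []) q o := by simpa using pQ
        have h1 := h0.cut.1.reverse
        have := (pth_singleton y).append h1 h0.cut.2.2.symm
        simpa using this
      · rw [← eQ, ← Multiset.coe_reverse (U ++ [z', y])]; simp
    · have e1 : (U ++ z' :: y :: w :: t') ++ [f] = Q ++ [K.f2] := by rw [← e]; simp
      obtain ⟨e2, e3⟩ := List.append_inj' e1 rfl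
      rw [← e2] at pQ eQ
      have h1 := pQ.cut
      have h2 : Pth G ([] ++ y :: w :: t') y o := h1.2.1
      refine S.NL K.swap (y :: (U ++ [z']).reverse ++ w :: t') y ⟨o, ?_, ?_, aQ⟩
      · have := ((pth_singleton y).append h1.1.reverse h1.2.2.symm).append h2.cut.2.1 b
        simpa using this
      · rw [← eQ]
        simp only [← Multiset.coe_add, ← Multiset.cons_coe, Multiset.coe_reverse,
          ← Multiset.singleton_add, Multiset.coe_nil]
        abel
  exact (K.duo hO hQ).skip S (z := z') (y := y) (w := w)
    (K.ext_snd ⟨U, t, by rw [← e]; simp⟩) hy a b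

/-- The head of the first interval is not adjacent to the second vertex of the other one. -/
theorem Conf.not_adj_second (K : Conf G A Cm) (S : Sys G H A Cm Λ) {O Q : List V}
    {p q r : V} (hO : XO K O p) (hQ : XO K.swap Q q) (hr : [q, r] <:+: Q ++ [K.f2]) :
    ¬ G.Adj p r := by
  have D := K.duo hO hQ
  obtain ⟨t, ht⟩ := D.pM.eq_cons
  have hr' := K.ext_snd hr
  have hnd := K.nodup_snd S hQ
  rw [ht] at hr' hnd
  cases t with
  | nil =>
    have := hr'.length_le
    simp at this
  | cons r' t =>
    have : r = r' := next_unique hnd hr' ⟨[], t, rfl⟩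
    subst this
    exact D.skip_head S ht (S.NL K.swap Q q hQ)

theorem Conf.mem_ext_notH (K : Conf G A Cm) (S : Sys G H A Cm Λ) {Q : List V} {q u : V}
    (hQ : XO K.swap Q q) (hu : u ∈ Q ++ [K.f2]) : u ∉ H := by
  apply S.dj
  rw [K.mem_iff]
  rcases List.mem_append.1 hu with h | h
  · exact Or.inr (Or.inr (Or.inl (hQ.symm_mem.1 h)))
  · have : u = K.f2 := by simpa using h
    rw [this]
    exact Or.inr (Or.inr (Or.inr K.pB2.head_mem))

theorem Conf.nodup_ext (K : Conf G A Cm) (S : Sys G H A Cm Λ) {Q : List V} {q : V}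
    (hQ : XO K.swap Q q) : (Q ++ [K.f2]).Nodup := by
  have hnd := K.nodup_snd S hQ
  obtain ⟨t, ht⟩ := K.pB2.eq_cons
  rw [ht, show Q ++ K.f2 :: t = (Q ++ [K.f2]) ++ t by simp] at hnd
  exact (List.nodup_append.1 hnd).1

/-- A vertex following a neighbour of `p` in the second interval is missed unless `p` is
adjacent to it. -/
theorem Conf.miss_next (K : Conf G A Cm) (S : Sys G H A Cm Λ) {O Q : List V}
    {p p' q z y : V} (hO : XO K O p) (hQ : XO K.swap Q q)
    (hzy : [z, y] <:+: Q ++ [K.f2]) (a : G.Adj p z) (h : ¬ G.Adj p' y) {L : List V} :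
    Miss G L (Q ++ K.B2) p' q y := by
  have hm := snd_mem hzy
  rcases List.mem_append.1 hm with hy | hy
  · obtain ⟨w, hw⟩ := K.exists_next_snd hQ hy
    exact K.miss_snd S hQ hw h (K.skip_snd S hO hQ hzy hw a)
  · have : y = K.f2 := by simpa using hy
    subst this
    exact K.miss_f2 S hQ h

theorem Conf.both_ends (K : Conf G A Cm) (S : Sys G H A Cm Λ) {O : List V} {e e' z : V}
    (pO : Pth G O e e') (hO : (O : Multiset V) = K.Is) (h1 : G.Adj e K.f1)
    (h2 : G.Adj e' K.f1) (hz : z ∈ K.It) (a : G.Adj e z) : G.Adj e' z := by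
  by_contra hn
  have hx : XO K O e := ⟨e', pO, hO, h2⟩
  have hx' : XO K O.reverse e' := ⟨e, pO.reverse, by simpa using hO, h1⟩
  have hQ := K.swap.xo
  obtain ⟨y, hy⟩ := K.exists_next_snd hQ hz
  have D := K.duo hx hQ
  have hqy := D.symm.cross S.toBase (K.ext_snd hy) a
  have m1 := K.miss_snd S hQ hy (L := O.reverse ++ K.B1) hn hqy
  have m2 := K.miss_next S hx hQ hy a (K.reroute_It S pO hO hy a) (L := O.reverse ++ K.B1)
  exact K.two_miss S hx' hQ (infix_ne (K.nodup_ext S hQ) hy) m1 m2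
    (K.mem_ext_side hQ (fst_mem hy)) (K.mem_ext_side hQ (snd_mem hy))
    (K.mem_ext_notH S hQ (fst_mem hy)) (K.mem_ext_notH S hQ (snd_mem hy))

theorem Conf.kill (K : Conf G A Cm) (S : Sys G H A Cm Λ) {O R R' : List V} {e r : V}
    (pO : Pth G O e K.ys) (hO : (O : Multiset V) = K.Is) (he : G.Adj e K.yt)
    (pR : Pth G R r K.yt) (hR : (R : Multiset V) = K.It)
    (pR' : Pth G R' K.xt r) (hR' : (R' : Multiset V) = K.It) : False := by
  have hfg := K.ne_of_mem S K.pB1.head_mem K.pB2.head_mem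
  have hfg' := K.ne_of_mem S K.pB1.last_mem K.pB2.head_mem
  have n1 : ¬ G.Adj K.ys K.g2 := by
    intro a
    refine S.full (((K.pB2.hp.glue pO.hp.symm a.symm).glue K.pIt.hp.symm he).glue K.pB1.hp.symm
      K.e2.symm) (Eq.trans ?_ K.hC) K.f2A K.f1A hfg.symm
    rw [hO]; abel
  have n2 : ¬ G.Adj r K.g2 := by
    intro a
    refine S.full (((K.pB2.hp.glue pR.hp a.symm).glue pO.hp he.symm).glue K.pB1.hp
      K.e1) (Eq.trans ?_ K.hC) K.f2A K.g1A hfg'.symm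
    rw [hO, hR]; abel
  have xR : XO K.swap R r := ⟨K.yt, pR, hR, K.e3⟩
  have n3 := (K.duo K.xo xR).not_adj S.toBase
  have xR' : XO K.rev.swap R'.reverse r :=
    ⟨K.xt, pR'.reverse, by
      change _ = ((K.It.reverse : List V) : Multiset V)
      simpa using hR', K.e2.symm⟩
  have xI := K.rev.xo
  have hx : XO K.rev.swap.swap K.rev.Is K.rev.xs := xI
  obtain ⟨s, hs⟩ := K.pIs.reverse.eq_concat
  have hin : [K.xs, K.g2] <:+: K.Is.reverse ++ [K.g2] := ⟨s, [], by rw [hs]; simp⟩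
  have m1 := K.rev.miss_fst S xI (M := R'.reverse ++ K.rev.B2) hin (fun a => n3 a.symm) n1
  have m2 := K.rev.miss_f1 S xI (M := R'.reverse ++ K.rev.B2) n2
  have hne : K.xs ≠ K.rev.f1 := fun h => K.sA _ K.pIs.head_mem (h ▸ K.g2A)
  refine K.rev.two_miss S xI xR' hne m1 m2 (Or.inl ?_) (Or.inr (Or.inl rfl))
    (S.dj _ (K.mem_iff.2 (Or.inl K.pIs.head_mem)))
    (S.dj _ (K.mem_iff.2 (Or.inr (Or.inr (Or.inr K.pB2.last_mem)))))
  exact List.mem_reverse.2 K.pIs.head_mem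

end

section

variable {G : SimpleGraph V} {A H : Finset V} {Cm : Multiset V} {Λ : V → Prop}
variable [Fintype V]

theorem Conf.adj_next_of_not_miss (K : Conf G A Cm) (S : Sys G H A Cm Λ) {O Q : List V}
    {p q u w : V} (hQ : XO K.swap Q q) (hw : [u, w] <:+: Q ++ [K.f2])
    (hnm : ¬ Miss G (O ++ K.B1) (Q ++ K.B2) p q u) (h : ¬ G.Adj p u) : G.Adj q w := by
  by_contra hn
  exact hnm (K.miss_snd S hQ hw h hn)

/-- An end of the first interval adjacent to the end of the other one, without missed
vertices on the second interval. -/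
theorem Conf.no_long_link (K : Conf G A Cm) (S : Sys G H A Cm Λ) {O : List V} {e : V}
    (pO : Pth G O e K.ys) (hO : (O : Multiset V) = K.Is) (he : G.Adj e K.yt)
    (hnm : ∀ u ∈ K.It ++ [K.f2], ¬ Miss G (O ++ K.B1) (K.It ++ K.B2) e K.xt u) : False := by
  have hx : XO K O e := ⟨K.ys, pO, hO, K.e1⟩
  have hQ := K.swap.xo
  have hQ' : XO K.swap K.It K.xt := hQ
  have hnd : (K.It ++ [K.f2]).Nodup := K.nodup_ext S hQ
  have D := K.duo hx hQ
  have nextadj : ∀ u w, [u, w] <:+: K.It ++ [K.f2] → ¬ G.Adj e u → G.Adj K.xt w :=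
    fun u w hw h => K.adj_next_of_not_miss S hQ hw
      (hnm u (fst_mem hw)) h
  have eadj : ∀ z y, [z, y] <:+: K.It ++ [K.f2] → G.Adj e z → G.Adj e y := by
    intro z y hy a
    by_contra hn
    exact hnm y (snd_mem hy) (K.miss_next S hx hQ hy a hn)
  have pI := K.pIt
  have e1 : ¬ G.Adj e K.xt := D.not_adj S.toBase
  obtain ⟨t, ht⟩ := pI.eq_cons
  rcases t with _ | ⟨r, t⟩
  · rw [ht] at pI
    exact e1 (pI.eq_of_singleton.2 ▸ he)
  have e2 : ¬ G.Adj e r :=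
    K.not_adj_second S hx hQ ⟨[], t ++ [K.f2], by
      change _ = K.It ++ _; rw [ht]; simp; rfl⟩
  obtain ⟨U, z, W, hIt, hz, hU⟩ := exists_first (P := G.Adj e) K.pIt.last_mem he
  -- the part before `z` has at least two vertices
  obtain ⟨U', hU'⟩ : ∃ U', U = K.xt :: r :: U' := by
    rw [ht] at hIt
    rcases U with _ | ⟨a, _ | ⟨b, U'⟩⟩
    · simp at hIt
      exact absurd (hIt.1 ▸ hz) e1
    · simp at hIt
      exact absurd (hIt.2.1 ▸ hz) e2
    · simp at hIt
      exact ⟨U', by rw [hIt.1, hIt.2.1]⟩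
  obtain ⟨P0, c2, c1, hc⟩ : ∃ P0 c2 c1, U = P0 ++ [c2, c1] := by
    rcases List.eq_nil_or_concat U with h | ⟨U1, c1, h⟩
    · simp [h] at hU'
    · rcases List.eq_nil_or_concat U1 with h' | ⟨U2, c2, h'⟩
      · simp [h, h'] at hU'
      · exact ⟨U2, c2, c1, by simp [h, h']⟩
  have hItc : K.It = P0 ++ [c2, c1] ++ z :: W := by rw [hIt, hc]
  have i1 : [c2, c1] <:+: K.It ++ [K.f2] := ⟨P0, z :: W ++ [K.f2], by rw [hItc]; simp⟩
  have i2 : [c1, z] <:+: K.It ++ [K.f2] := ⟨P0 ++ [c2], W ++ [K.f2], by rw [hItc]; simp⟩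
  have a1 : G.Adj K.xt c1 := nextadj c2 c1 i1 (hU c2 (by simp [hc]))
  have a2 : G.Adj K.xt z := nextadj c1 z i2 (hU c1 (by simp [hc]))
  obtain ⟨z', hz'⟩ := K.exists_next_snd hQ' (u := z) (by rw [hIt]; simp)
  have a3 : G.Adj e z' := eadj z z' hz' hz
  have n1 : ¬ G.Adj K.ys z := fun a =>
    K.reroute_It S pO.reverse (by simpa using hO) hz' a a3
  have n2 : ¬ G.Adj K.ys c1 := fun a =>
    K.reroute_It S pO.reverse (by simpa using hO) i2 a hz
  -- the last vertex of the second interval reaches `c1` or `c2`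
  have hc12 : G.Adj K.yt c1 ∨ G.Adj K.yt c2 := by
    by_contra hn
    rw [not_or] at hn
    have xI := K.rev.xo
    have xJ := K.rev.swap.xo
    have hrev : K.rev.It = W.reverse ++ z :: c1 :: c2 :: P0.reverse := by
      change K.It.reverse = _
      rw [hItc]; simp
    have j1 : [z, c1] <:+: K.rev.It ++ [K.rev.f2] :=
      ⟨W.reverse, c2 :: P0.reverse ++ [K.rev.f2], by rw [hrev]; simp⟩
    have j2 : [c1, c2] <:+: K.rev.It ++ [K.rev.f2] :=
      ⟨W.reverse ++ [z], P0.reverse ++ [K.rev.f2], by rw [hrev]; simp⟩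
    have m1 := K.rev.miss_snd S xJ (L := K.rev.Is ++ K.rev.B1) j1 (p := K.rev.xs) n1 hn.1
    have m2 := K.rev.miss_snd S xJ (L := K.rev.Is ++ K.rev.B1) j2 (p := K.rev.xs) n2 hn.2
    exact K.rev.two_miss S xI xJ (infix_ne hnd i2).symm m1 m2
      (K.rev.mem_ext_side xJ (fst_mem j1)) (K.rev.mem_ext_side xJ (fst_mem j2))
      (K.rev.mem_ext_notH S xJ (fst_mem j1)) (K.rev.mem_ext_notH S xJ (fst_mem j2))
  -- cut the second interval accordingly
  obtain ⟨P, c, d, Q, hPQ, ac, ad⟩ : ∃ P c d Q, K.It = (P ++ [c]) ++ d :: Q ∧ G.Adj K.yt c ∧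
      G.Adj K.xt d := by
    rcases hc12 with h | h
    · exact ⟨P0 ++ [c2], c1, z, W, by rw [hItc]; simp, h, a2⟩
    · exact ⟨P0, c2, c1, z :: W, by rw [hItc]; simp, h, a1⟩
  have pI' : Pth G (P ++ c :: d :: Q) K.xt K.yt := by
    have := K.pIt
    rw [hPQ] at this
    simpa using this
  obtain ⟨q1, q2, -⟩ := pI'.cut
  -- the order starting at the second vertex
  obtain ⟨s, t', ht'⟩ : ∃ s t', t = s :: t' := by
    cases t with
    | nil =>
      rw [ht] at hIt
      rw [hU'] at hIt
      simp at hIt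
    | cons s t' => exact ⟨s, t', rfl⟩
  subst ht'
  have i3 : [r, s] <:+: K.It ++ [K.f2] := ⟨[K.xt], t' ++ [K.f2], by rw [ht]; simp⟩
  have a4 : G.Adj K.xt s := nextadj r s i3 e2
  have pJ : Pth G ([] ++ K.xt :: r :: s :: t') K.xt K.yt := by
    have := K.pIt
    rwa [ht] at this
  have pJ1 : Pth G ([] ++ r :: s :: t') r K.yt := pJ.cut.2.1
  have pR : Pth G ([r, K.xt] ++ (s :: t')) r K.yt :=
    ((pth_singleton r).append (pth_singleton K.xt) pJ.cut.2.2.symm).append pJ1.cut.2.1 a4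
  have hR : (([r, K.xt] ++ (s :: t') : List V) : Multiset V) = K.It := by
    rw [ht]
    exact Multiset.coe_eq_coe.2 (List.Perm.swap _ _ _)
  rcases P with _ | ⟨x, P⟩
  · -- the first part is a single vertex
    have hcx : c = K.xt ∧ d = r := by
      rw [ht] at hPQ
      simp at hPQ
      exact ⟨hPQ.1.symm, hPQ.2.1.symm⟩
    obtain ⟨hcx, rfl⟩ := hcx
    subst hcx
    refine K.kill S pO hO he pR hR (R' := K.xt :: (d :: Q).reverse) ?_ ?_
    · exact (pth_singleton K.xt).append q2.reverse ac.symm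
    · rw [hPQ]
      exact Multiset.coe_eq_coe.2 ((List.reverse_perm (d :: Q)).cons _)
  · have hx1 : x = K.xt := by
      rw [ht] at hPQ
      simp at hPQ
      exact hPQ.1.symm
    have hr : ∃ T, P ++ [c] = r :: T := by
      cases P with
      | nil =>
        rw [ht] at hPQ
        simp at hPQ
        exact ⟨[], by rw [hPQ.2.1]; rfl⟩
      | cons y P =>
        rw [ht] at hPQ
        simp at hPQ
        exact ⟨P ++ [c], by rw [hPQ.2.1]; rfl⟩
    obtain ⟨T, hT⟩ := hr
    subst hx1
    have q1' : Pth G ([] ++ K.xt :: r :: T) K.xt c := by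
      have h0 : Pth G (K.xt :: (P ++ [c])) K.xt c := q1
      rw [hT] at h0
      exact h0
    have q3 := q1'.cut.2.1
    refine K.kill S pO hO he pR hR (R' := [K.xt] ++ (d :: Q) ++ (r :: T).reverse) ?_ ?_
    · exact ((pth_singleton K.xt).append q2 ad).append q3.reverse ac
    · rw [hPQ, ← hT]
      simp only [← Multiset.coe_add, Multiset.coe_reverse, List.cons_append, ← Multiset.cons_coe,
        ← Multiset.singleton_add, Multiset.coe_nil]
      abel

/-- The initial end of an interval is not adjacent to the final end of another one. -/
theorem Conf.not_adj_opposite (K : Conf G A Cm) (S : Sys G H A Cm Λ) : ¬ G.Adj K.xs K.yt := by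
  intro a
  have hx := K.xo
  have hQ := K.swap.xo
  have hQ' : XO K.swap.swap K.swap.It K.swap.xt := hx
  have f1 : ¬ G.Adj K.xs K.f1 := by
    intro h
    exact (K.rev.duo K.rev.xo K.rev.swap.xo).not_adj S.toBase
      (K.both_ends S K.pIs rfl h K.e1 K.pIt.last_mem a)
  by_cases hm : ∃ w ∈ K.It ++ [K.f2], Miss G (K.Is ++ K.B1) (K.It ++ K.B2) K.xs K.xt w
  · obtain ⟨w, hw, mw⟩ := hm
    have sw := K.mem_ext_side hQ hw
    have wH := K.mem_ext_notH S hQ hw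
    have key : ∀ u ∈ K.Is ++ [K.f1],
        ¬ Miss G (K.Is ++ K.B1) (K.It ++ K.B2) K.xs K.xt u := by
      intro u hu mu
      have hu' : u ∈ K.Is ++ K.B1 := by
        rcases List.mem_append.1 hu with h | h
        · exact List.mem_append_left _ h
        · exact List.mem_append_right _ (by rw [List.mem_singleton.1 h]; exact K.pB1.head_mem)
      have hw' : w ∈ K.It ++ K.B2 := by
        rcases List.mem_append.1 hw with h | h
        · exact List.mem_append_left _ h
        · exact List.mem_append_right _ (by rw [List.mem_singleton.1 h]; exact K.pB2.head_mem)
      exact K.two_miss S hx hQ ((K.duo hx hQ).disj S.toBase hu' hw') mu mw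
        (K.swap.mem_ext_side hQ' hu).swap sw
        (K.swap.mem_ext_notH S hQ' hu) wH
    by_cases hb : G.Adj K.xt K.ys
    · exact K.swap.no_long_link S K.pIt rfl hb (fun u hu mu => key u hu mu.symm)
    · obtain ⟨s, hs⟩ := K.pIs.eq_concat
      exact key K.ys (List.mem_append_left _ K.pIs.last_mem)
        (K.miss_fst S hx (w := K.f1) ⟨s, [], by rw [hs]; simp⟩ hb f1)
  · push Not at hm
    exact K.no_long_link S K.pIs rfl a hm

/-- A linked end of the first interval closes it. -/
theorem Conf.closes (K : Conf G A Cm) (S : Sys G H A Cm Λ) {O : List V} {e z : V}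
    (pO : Pth G O e K.ys) (hO : (O : Multiset V) = K.Is) (hz : z ∈ K.It) (a : G.Adj e z) :
    G.Adj e K.f1 := by
  by_contra hn
  have hx : XO K O e := ⟨K.ys, pO, hO, K.e1⟩
  have hQ := K.swap.xo
  have hb : ¬ G.Adj K.xt K.ys := K.swap.not_adj_opposite S
  obtain ⟨s, hs⟩ := pO.eq_concat
  have mys := K.miss_fst S hx (M := K.It ++ K.B2) (w := K.f1) (u := K.ys) (q := K.xt)
    ⟨s, [], by rw [hs]; simp⟩ hb hn
  have key : ∀ u ∈ K.It ++ [K.f2], ¬ Miss G (O ++ K.B1) (K.It ++ K.B2) e K.xt u := by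
    intro u hu mu
    refine K.two_miss S hx hQ ?_ mys mu (Or.inl K.pIs.last_mem) (K.mem_ext_side hQ hu)
      (S.dj _ (K.mem_iff.2 (Or.inl K.pIs.last_mem))) (K.mem_ext_notH S hQ hu)
    refine (K.duo hx hQ).disj S.toBase (List.mem_append_left _ pO.last_mem) ?_
    rcases List.mem_append.1 hu with h | h
    · exact List.mem_append_left _ h
    · exact List.mem_append_right _ (by rw [List.mem_singleton.1 h]; exact K.pB2.head_mem)
  have eadj : ∀ z y, [z, y] <:+: K.It ++ [K.f2] → G.Adj e z → G.Adj e y := by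
    intro z y hy a
    by_contra hn
    exact key y (snd_mem hy) (K.miss_next S hx hQ hy a hn)
  have run : ∀ W U z, K.It = U ++ z :: W → G.Adj e z → G.Adj e K.yt := by
    intro W
    induction W with
    | nil =>
      intro U z h a
      have := K.pIt.2.2
      rw [h] at this
      simp at this
      exact this ▸ a
    | cons y W ih =>
      intro U z h a
      refine ih (U ++ [z]) y (by rw [h]; simp) (eadj z y ⟨U, W ++ [K.f2], by rw [h]; simp⟩ a)
  obtain ⟨U, W, h⟩ := List.append_of_mem hz
  exact K.no_long_link S pO hO (run W U z h a) key

end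

section

variable {G : SimpleGraph V} {A H : Finset V} {Cm : Multiset V} {Λ : V → Prop}
theorem Conf.side_of_It (K : Conf G A Cm) {u : V} (hu : u ∈ K.It) : Side K u :=
  Or.inr (Or.inr (Or.inl hu))

theorem eq_nil_or_append (l : List V) : l = [] ∨ ∃ t b, l = t ++ [b] := by
  simpa using List.eq_nil_or_concat l

theorem getLast?_inj {l : List V} {c y : V} (h : (l ++ [c]).getLast? = some y) : c = y := by
  simpa using h

variable [Fintype V]

theorem Conf.notH_of_It (K : Conf G A Cm) (S : Sys G H A Cm Λ) {u : V} (hu : u ∈ K.It) :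
    u ∉ H := S.dj _ (K.mem_iff.2 (Or.inr (Or.inr (Or.inl hu))))

theorem Conf.unique_link (K : Conf G A Cm) (S : Sys G H A Cm Λ) {O : List V} {e z y : V}
    (pO : Pth G O e K.ys) (hO : (O : Multiset V) = K.Is) (he : G.Adj e K.f1)
    (hz : z ∈ K.It) (a : G.Adj e z) (hy : y ∈ K.It) (b : G.Adj e y) : y = z := by
  by_contra hne
  have hx : XO K O e := ⟨K.ys, pO, hO, K.e1⟩
  have hQ : XO K.swap K.It K.xt := K.swap.xo
  have key : ∀ y ∈ K.It, G.Adj e y → ∃ w, [y, w] <:+: K.It ++ [K.f2] ∧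
      Miss G (O ++ K.B1) (K.It ++ K.B2) e K.xt w := by
    intro y hy b
    obtain ⟨w, hw⟩ := K.exists_next_snd hQ hy
    refine ⟨w, hw, K.miss_next S hx hQ hw b ?_⟩
    exact K.reroute_It S pO.reverse (by simpa using hO) hw (K.both_ends S pO hO he K.e1 hy b)
  obtain ⟨w, hw, mw⟩ := key y hy b
  obtain ⟨w', hw', mw'⟩ := key z hz a
  refine K.two_miss S hx hQ ?_ mw mw'
    (K.mem_ext_side hQ (snd_mem hw)) (K.mem_ext_side hQ (snd_mem hw'))
    (K.mem_ext_notH S hQ (snd_mem hw)) (K.mem_ext_notH S hQ (snd_mem hw'))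
  rintro rfl
  exact hne (prev_unique (K.nodup_ext S hQ) hw hw')

theorem Conf.exact_link (K : Conf G A Cm) (S : Sys G H A Cm Λ) {O Q : List V}
    {e z q v j w : V} (pO : Pth G O e K.ys) (hO : (O : Multiset V) = K.Is)
    (he : G.Adj e K.f1) (a : G.Adj e z) (hQ : XO K.swap Q q)
    (hv : [z, v] <:+: Q ++ [K.f2]) (hvI : v ∈ Q) (hz : z ∈ Q) (hj : j ∈ Q)
    (hw : [j, w] <:+: Q ++ [K.f2]) (hjz : j ≠ z) (hjv : j ≠ v) : G.Adj q w := by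
  have hx : XO K O e := ⟨K.ys, pO, hO, K.e1⟩
  have hnd := K.nodup_ext S hQ
  have uniq : ∀ y ∈ Q, G.Adj e y → y = z := fun y hy b =>
    K.unique_link S pO hO he (hQ.symm_mem.1 hz) a (hQ.symm_mem.1 hy) b
  have mv := K.miss_next S hx hQ hv a (p' := e) (L := O ++ K.B1)
    (fun b => infix_ne hnd hv (uniq v hvI b).symm)
  refine K.adj_next_of_not_miss S (O := O) (p := e) hQ hw ?_ (fun b => hjz (uniq j hj b))
  intro mj
  exact K.two_miss S hx hQ hjv mj mv
    (K.side_of_It (hQ.symm_mem.1 hj)) (K.side_of_It (hQ.symm_mem.1 hvI))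
    (K.notH_of_It S (hQ.symm_mem.1 hj)) (K.notH_of_It S (hQ.symm_mem.1 hvI))

theorem Conf.not_adj_after_link (K : Conf G A Cm) (S : Sys G H A Cm Λ) {O Q : List V}
    {e z q v : V} (hx : XO K O e) (a : G.Adj e z) (hQ : XO K.swap Q q)
    (hv : [z, v] <:+: Q ++ [K.f2]) : ¬ G.Adj q v :=
  (K.duo hx hQ).symm.cross S.toBase (K.ext_snd hv) a

/-- The shape of an interval linked to a closed one. -/
theorem Conf.five (K : Conf G A Cm) (S : Sys G H A Cm Λ) {O : List V} {e z : V}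
    (pO : Pth G O e K.ys) (hO : (O : Multiset V) = K.Is) (he : G.Adj e K.f1)
    (hz : z ∈ K.It) (a : G.Adj e z) :
    ∃ v1 v2 b c, K.It = [v1, v2, z, b, c] ∧ G.Adj v1 z ∧ G.Adj v1 K.f2 ∧ G.Adj c z ∧
      G.Adj c K.f2 ∧ ¬ G.Adj v1 b ∧ ¬ G.Adj v1 c ∧ ¬ G.Adj v2 b ∧ ¬ G.Adj v2 c := by
  have hx : XO K O e := ⟨K.ys, pO, hO, K.e1⟩
  have hQ : XO K.swap K.It K.xt := K.swap.xo
  have hb := K.both_ends S pO hO he K.e1 hz a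
  have n1 : ¬ G.Adj e K.xt := (K.duo hx hQ).not_adj S.toBase
  have n2 : ¬ G.Adj K.ys K.yt := (K.rev.duo K.rev.xo K.rev.swap.xo).not_adj S.toBase
  have hnd := K.nodup_ext S hQ
  have pI := K.pIt
  obtain ⟨U0, W0, hI⟩ := List.append_of_mem hz
  -- two vertices before `z`
  obtain ⟨v1, v2, U, rfl⟩ : ∃ v1 v2 U, U0 = v1 :: v2 :: U := by
    rcases U0 with _ | ⟨v1, _ | ⟨v2, U⟩⟩
    · have := pI.2.1
      rw [hI] at this
      simp at this
      exact absurd (this ▸ a) n1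
    · have := pI.2.1
      rw [hI] at this
      simp at this
      subst this
      exact absurd a (K.not_adj_second S hx hQ ⟨[], W0 ++ [K.f2], by rw [hI]; simp⟩)
    · exact ⟨v1, v2, U, rfl⟩
  have h1 : v1 = K.xt := by
    have := pI.2.1
    rw [hI] at this
    simpa using this
  -- two vertices after `z`
  obtain ⟨W, b, c, rfl⟩ : ∃ W b c, W0 = W ++ [b, c] := by
    rcases eq_nil_or_append W0 with rfl | ⟨W1, c, rfl⟩
    · have := pI.2.2
      rw [hI] at this
      have := getLast?_inj (l := v1 :: v2 :: U) this
      exact absurd (this ▸ hb) n2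
    · rcases eq_nil_or_append W1 with rfl | ⟨W2, b, rfl⟩
      · have := pI.2.2
        rw [hI] at this
        have := getLast?_inj (l := v1 :: v2 :: U ++ [z]) (by simpa using this)
        subst this
        refine absurd hb (K.rev.not_adj_second S K.rev.xo K.rev.swap.xo
          ⟨[], (v1 :: v2 :: U).reverse ++ [K.rev.f2], ?_⟩)
        change _ = K.It.reverse ++ _
        rw [hI]; simp; rfl
      · exact ⟨W2, b, c, by simp⟩
  have h2 : c = K.yt := by
    have := pI.2.2
    rw [hI] at this
    exact getLast?_inj (l := v1 :: v2 :: U ++ z :: (W ++ [b])) (by simpa using this)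
  subst h1 h2
  rw [hI] at hQ hnd pI
  -- successors in the given order
  obtain ⟨v, hv⟩ : ∃ v, ∃ T, W ++ [b, K.yt] = v :: T ∧ T ≠ [] := by
    cases W with
    | nil => exact ⟨b, [K.yt], rfl, by simp⟩
    | cons w W => exact ⟨w, W ++ [b, K.yt], rfl, by simp⟩
  obtain ⟨T, hT, hTne⟩ := hv
  have iv : [z, v] <:+: (K.xt :: v2 :: U ++ z :: (W ++ [b, K.yt])) ++ [K.f2] := by
    rw [hT]
    exact ⟨K.xt :: v2 :: U, T ++ [K.f2], by simp⟩
  have vI : v ∈ K.xt :: v2 :: U ++ z :: (W ++ [b, K.yt]) := by rw [hT]; simp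
  have pz : z ∈ K.xt :: v2 :: U ++ z :: (W ++ [b, K.yt]) := by simp
  have ytv : K.yt ≠ v := by
    rintro rfl
    have h3 : (K.yt :: T).Nodup := by
      rw [← hT]
      have : (W ++ [b, K.yt]).Sublist
          (K.xt :: v2 :: U ++ z :: (W ++ [b, K.yt]) ++ [K.f2]) := by
        refine List.Sublist.trans ?_ (List.sublist_append_left _ _)
        refine List.Sublist.trans ?_ (List.sublist_append_right _ _)
        exact List.sublist_cons_self _ _
      exact hnd.sublist this
    have h4 : (K.yt :: T).getLast? = some K.yt := by rw [← hT]; simp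
    obtain ⟨t, l, rfl⟩ : ∃ t l, T = t ++ [l] := by
      rcases eq_nil_or_append T with h | ⟨t, l, h⟩
      · exact absurd h hTne
      · exact ⟨t, l, h⟩
    have h5 : l = K.yt := getLast?_inj (l := K.yt :: t) h4
    simp [h5] at h3
  have af2 : G.Adj K.xt K.f2 := by
    refine K.exact_link S pO hO he a hQ iv vI pz (j := K.yt) (by simp) ?_ ?_ ytv
    · exact ⟨K.xt :: v2 :: U ++ z :: (W ++ [b]), [], by simp⟩
    · rintro h
      subst h
      exact n2 hb
  -- the reversed order
  have hR : XO K.swap (K.yt :: b :: (W.reverse ++ z :: (U.reverse ++ [v2, K.xt]))) K.yt := by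
    refine ⟨K.xt, ?_, ?_, af2⟩
    · have := pI.reverse
      simpa using this
    · change _ = (K.It : Multiset V)
      rw [hI, ← Multiset.coe_reverse (K.xt :: v2 :: U ++ z :: (W ++ [b, K.yt]))]
      simp
  have ndR := K.nodup_ext S hR
  have v2z : v2 ≠ z := by
    rintro rfl
    simp [List.nodup_append] at hnd
  rcases eq_nil_or_append U with rfl | ⟨U', u, rfl⟩
  · have iR : [z, v2] <:+: (K.yt :: b :: (W.reverse ++ z :: ([].reverse ++ [v2, K.xt])))
        ++ [K.f2] := ⟨K.yt :: b :: W.reverse, [K.xt, K.f2], by simp⟩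
    have jR : [v2, K.xt] <:+: (K.yt :: b :: (W.reverse ++ z :: ([].reverse ++ [v2, K.xt])))
        ++ [K.f2] := ⟨K.yt :: b :: W.reverse ++ [z], [K.f2], by simp⟩
    have nR : ¬ G.Adj K.yt K.xt := K.skip_snd S hx hR iR jR a
    cases W with
    | nil =>
      simp only [List.reverse_nil, List.nil_append, List.cons_append] at *
      have hzb : [z, b] <:+: [K.xt, v2, z, b, K.yt] ++ [K.f2] :=
        ⟨[K.xt, v2], [K.yt, K.f2], rfl⟩
      have hbc : [b, K.yt] <:+: [K.xt, v2, z, b, K.yt] ++ [K.f2] :=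
        ⟨[K.xt, v2, z], [K.f2], rfl⟩
      have cz : G.Adj K.yt z := by
        refine K.exact_link S pO hO he a hR iR (by simp) (by simp) (j := b) (by simp)
          ⟨[K.yt], [v2, K.xt, K.f2], rfl⟩ ?_ ?_
        · rintro rfl; simp at hnd
        · rintro rfl; simp at hnd
      have xz : G.Adj K.xt z := by
        refine K.exact_link S pO hO he a hQ hzb (by simp) (by simp) (j := v2) (by simp)
          ⟨[K.xt], [b, K.yt, K.f2], rfl⟩ v2z ?_
        rintro rfl; simp at hnd
      have h0 : Pth G ([K.xt, v2] ++ [z, b, K.yt]) K.xt K.yt := pI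
      have h1 : Pth G ([] ++ K.xt :: v2 :: [z, b, K.yt]) K.xt K.yt := pI
      have h2 : Pth G ([K.xt] ++ v2 :: z :: [b, K.yt]) K.xt K.yt := pI
      have hS : XO K.swap ([v2, K.xt] ++ [z, b, K.yt]) v2 := by
        refine ⟨K.yt, ?_, ?_, K.e3⟩
        · exact ((pth_singleton v2).append (pth_singleton K.xt) h1.cut.2.2.symm).append
            h2.cut.2.1 xz
        · change _ = (K.It : Multiset V)
          rw [hI]
          exact Multiset.coe_eq_coe.2 (List.Perm.swap _ _ _)
      refine ⟨K.xt, v2, b, K.yt, hI, xz, af2, cz, K.e3, ?_, ?_, ?_, ?_⟩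
      · exact K.not_adj_after_link S hx a hQ hzb
      · exact fun h => nR h.symm
      · exact K.not_adj_after_link S hx a hS ⟨[v2, K.xt], [K.yt, K.f2], rfl⟩
      · exact K.skip_snd S hx hS ⟨[v2, K.xt], [K.yt, K.f2], rfl⟩
          ⟨[v2, K.xt, z], [K.f2], rfl⟩ a
    | cons w W =>
      exfalso
      apply nR
      have hvw : v = w := by
        have := hT
        simp at this
        exact this.1.symm
      subst hvw
      refine (K.exact_link S pO hO he a hQ iv vI pz (j := b) (by simp) ?_ ?_ ?_).symm
      · exact ⟨[K.xt, v2] ++ z :: (v :: W), [K.f2], by simp⟩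
      · rintro rfl; simp [List.nodup_append] at hnd
      · rintro rfl; simp [List.nodup_append] at hnd
  · exfalso
    have iR : [z, u] <:+: (K.yt :: b :: (W.reverse ++ z :: ((U' ++ [u]).reverse ++ [v2, K.xt])))
        ++ [K.f2] := ⟨K.yt :: b :: W.reverse, U'.reverse ++ [v2, K.xt, K.f2], by simp⟩
    have v2u : v2 ≠ u := by
      rintro rfl
      simp [List.nodup_append] at hnd
    cases W with
    | nil =>
      have hzb : [z, b] <:+: (K.xt :: v2 :: (U' ++ [u]) ++ z :: ([] ++ [b, K.yt])) ++ [K.f2] :=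
        ⟨K.xt :: v2 :: (U' ++ [u]), [K.yt, K.f2], by simp⟩
      have hbc : [b, K.yt] <:+: (K.xt :: v2 :: (U' ++ [u]) ++ z :: ([] ++ [b, K.yt]))
          ++ [K.f2] := ⟨K.xt :: v2 :: (U' ++ [u]) ++ [z], [K.f2], by simp⟩
      refine K.skip_snd S hx hQ hzb hbc a ?_
      refine (K.exact_link S pO hO he a hR iR (by simp) (by simp) (j := v2) (by simp) ?_
        v2z v2u).symm
      exact ⟨K.yt :: b :: (z :: ((U' ++ [u]).reverse)), [K.f2], by simp⟩
    | cons w W =>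
      have hvw : v = w := by
        have := hT
        simp at this
        exact this.1.symm
      subst hvw
      have cz : G.Adj K.yt z := by
        refine K.exact_link S pO hO he a hR iR (by simp) (by simp) (j := v) (by simp) ?_ ?_ ?_
        · exact ⟨K.yt :: b :: W.reverse, (U' ++ [u]).reverse ++ [v2, K.xt, K.f2], by simp⟩
        · rintro rfl; simp [List.nodup_append] at hnd
        · rintro rfl; simp [List.nodup_append] at hnd
      have pI' : Pth G ((K.xt :: v2 :: (U' ++ [u])) ++ z :: v :: (W ++ [b, K.yt])) K.xt K.yt := by
        simpa using pI
      obtain ⟨c1, c2, c3⟩ := pI'.cut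
      have hS : XO K.swap ((v :: (W ++ [b, K.yt])) ++
          ((K.xt :: v2 :: (U' ++ [u])) ++ [z]).reverse) v := by
        refine ⟨K.xt, c2.append c1.reverse cz, ?_, af2⟩
        change _ = (K.It : Multiset V)
        rw [hI]
        refine Multiset.coe_eq_coe.2 (List.perm_append_comm.trans ?_)
        refine ((List.reverse_perm _).append_right _).trans ?_
        simp
      refine K.not_adj_after_link S hx a hQ iv (G.adj_symm ?_)
      refine K.exact_link S pO hO he a hS (v := u) (j := v2) ?_ (by simp) (by simp) (by simp)
        ?_ v2z v2u
      · exact ⟨v :: (W ++ [b, K.yt]), U'.reverse ++ [v2, K.xt, K.f2], by simp⟩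
      · exact ⟨v :: (W ++ [b, K.yt]) ++ z :: (U' ++ [u]).reverse, [K.f2], by simp⟩

end

section

variable {G : SimpleGraph V} {A H : Finset V} {Cm : Multiset V} {Λ : V → Prop}

/-- The shape of an interval linked to a closed one, with two adjacent halves around `z`. -/
structure Conf.Bowtie (K : Conf G A Cm) (v₁ v₂ z b c : V) : Prop where
  eq : K.It = [v₁, v₂, z, b, c]
  az : G.Adj v₁ z
  af : G.Adj v₁ K.f2
  cz : G.Adj c z
  cf : G.Adj c K.f2
  n₁ : ¬ G.Adj v₁ b
  n₂ : ¬ G.Adj v₁ c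
  n₃ : ¬ G.Adj v₂ b
  n₄ : ¬ G.Adj v₂ c

variable {K : Conf G A Cm} {v₁ v₂ z b c : V}

theorem Conf.Bowtie.chain (B : K.Bowtie v₁ v₂ z b c) :
    G.Adj v₁ v₂ ∧ G.Adj v₂ z ∧ G.Adj z b ∧ G.Adj b c := by
  have := K.pIt.1
  rw [B.eq] at this
  simpa using this

theorem Conf.Bowtie.xt_eq (B : K.Bowtie v₁ v₂ z b c) : K.xt = v₁ := by
  have := K.pIt.2.1
  rw [B.eq] at this
  simpa using this.symm

theorem Conf.Bowtie.xo_fst (B : K.Bowtie v₁ v₂ z b c) : XO K.swap [v₁, v₂, z, b, c] v₁ :=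
  ⟨c, ⟨by simpa using B.chain, by simp, by simp⟩, congrArg _ B.eq.symm, B.cf⟩

theorem Conf.Bowtie.xo_snd (B : K.Bowtie v₁ v₂ z b c) : XO K.swap [v₂, v₁, z, b, c] v₂ := by
  obtain ⟨h1, h2, h3, h4⟩ := B.chain
  refine ⟨c, ⟨by simpa using ⟨h1.symm, B.az, h3, h4⟩, by simp, by simp⟩, ?_, B.cf⟩
  change _ = (K.It : Multiset V)
  rw [B.eq]
  exact Multiset.coe_eq_coe.2 (List.Perm.swap _ _ _)

theorem Conf.Bowtie.xo_last (B : K.Bowtie v₁ v₂ z b c) : XO K.swap [c, b, z, v₂, v₁] c := by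
  obtain ⟨h1, h2, h3, h4⟩ := B.chain
  refine ⟨v₁, ⟨by simpa using ⟨h4.symm, h3.symm, h2.symm, h1.symm⟩, by simp, by simp⟩, ?_, B.af⟩
  change _ = (K.It : Multiset V)
  rw [B.eq]
  exact Multiset.coe_eq_coe.2 (List.reverse_perm [v₁, v₂, z, b, c])

theorem Conf.Bowtie.xo_fourth (B : K.Bowtie v₁ v₂ z b c) :
    XO K.swap [b, c, z, v₂, v₁] b := by
  obtain ⟨h1, h2, h3, h4⟩ := B.chain
  refine ⟨v₁, ⟨by simpa using ⟨h4, B.cz, h2.symm, h1.symm⟩, by simp, by simp⟩, ?_, B.af⟩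
  rw [← B.xo_last.choose_spec.2.1]
  exact Multiset.coe_eq_coe.2 (List.Perm.swap _ _ _)

theorem Conf.Bowtie.mem (B : K.Bowtie v₁ v₂ z b c) {u : V} :
    u ∈ K.It ↔ u = v₁ ∨ u = v₂ ∨ u = z ∨ u = b ∨ u = c := by
  rw [B.eq]; simp

theorem Conf.Bowtie.fourth_mem (B : K.Bowtie v₁ v₂ z b c) : b ∈ K.It := by
  rw [B.eq]; simp

variable [Fintype V]

theorem Conf.Bowtie.not_adj (B : K.Bowtie v₁ v₂ z b c) (S : Sys G H A Cm Λ) {O : List V}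
    {p q : V} (hO : XO K O p) (hq : q = v₁ ∨ q = v₂ ∨ q = b ∨ q = c) : ¬ G.Adj p q := by
  rcases hq with rfl | rfl | rfl | rfl
  · exact (K.duo hO B.xo_fst).not_adj S.toBase
  · exact (K.duo hO B.xo_snd).not_adj S.toBase
  · exact (K.duo hO B.xo_fourth).not_adj S.toBase
  · exact (K.duo hO B.xo_last).not_adj S.toBase

theorem Conf.Bowtie.miss_fst (B : K.Bowtie v₁ v₂ z b c) (S : Sys G H A Cm Λ) {O L : List V}
    {p : V} (hO : XO K O p) : Miss G L ([v₁, v₂, z, b, c] ++ K.B2) p v₁ b :=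
  K.miss_snd S B.xo_fst ⟨[v₁, v₂, z], [K.f2], rfl⟩ (B.not_adj S hO (by simp)) B.n₂

theorem Conf.Bowtie.miss_snd (B : K.Bowtie v₁ v₂ z b c) (S : Sys G H A Cm Λ) {O L : List V}
    {p : V} (hO : XO K O p) : Miss G L ([v₂, v₁, z, b, c] ++ K.B2) p v₂ b :=
  K.miss_snd S B.xo_snd ⟨[v₂, v₁, z], [K.f2], rfl⟩ (B.not_adj S hO (by simp)) B.n₄

theorem Conf.disjoint (K : Conf G A Cm) (S : Sys G H A Cm Λ) {u : V} (hu : u ∈ K.Is)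
    (hu' : u ∈ K.It) : False :=
  (K.duo K.xo K.swap.xo).disj S.toBase (List.mem_append_left _ hu)
    (List.mem_append_left _ hu') rfl

theorem Conf.Bowtie.not_adj_fst (B : K.Bowtie v₁ v₂ z b c) (S : Sys G H A Cm Λ) {j : V}
    (hj : j ∈ K.Is) : ¬ G.Adj v₁ j := by
  intro a
  have p1 : Pth G K.It v₁ K.swap.ys := by
    have := K.pIt
    rwa [B.xt_eq] at this
  have af : G.Adj v₁ K.swap.f1 := B.af
  have a' := K.swap.both_ends S p1 rfl af K.swap.e1 hj a
  obtain ⟨w, hw⟩ := K.swap.exists_next_snd (Q := K.Is) K.xo hj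
  have nw := K.swap.reroute_It S p1.reverse (by simp; rfl) hw a'
  have mw : Miss G (K.It ++ K.B2) (K.Is ++ K.B1) v₁ K.xs w :=
    K.swap.miss_next S (p := v₁) (O := K.It) (B.eq ▸ B.xo_fst) K.xo hw a nw
  have mb := (B.miss_fst S K.xo (L := K.Is ++ K.B1)).symm
  rw [← B.eq] at mb
  have sd : w ∈ K.Is ++ [K.f1] := snd_mem hw
  refine K.swap.two_miss S (O := K.It) (Q := K.Is) (B.eq ▸ B.xo_fst) K.xo ?_ mw mb
    (K.swap.mem_ext_side K.xo sd) (Or.inl B.fourth_mem) (K.swap.mem_ext_notH S K.xo sd)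
    (K.notH_of_It S B.fourth_mem)
  rintro rfl
  rcases List.mem_append.1 sd with h | h
  · exact K.disjoint S h B.fourth_mem
  · rw [List.mem_singleton] at h
    exact K.tA _ B.fourth_mem (h ▸ K.f1A)

theorem Conf.Bowtie.adj_next (B : K.Bowtie v₁ v₂ z b c) (S : Sys G H A Cm Λ) {j w : V}
    (hw : [j, w] <:+: K.Is ++ [K.f1]) (hj : j ∈ K.Is) : G.Adj K.xs w := by
  refine K.swap.adj_next_of_not_miss S (O := [v₁, v₂, z, b, c]) K.xo hw (p := v₁) ?_
    (B.not_adj_fst S hj)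
  intro m
  have mb := (B.miss_fst S K.xo (L := K.Is ++ K.B1)).symm
  refine K.swap.two_miss S B.xo_fst K.xo ?_ m mb (K.swap.side_of_It hj) (Or.inl B.fourth_mem)
    (K.swap.notH_of_It S hj) (K.notH_of_It S B.fourth_mem)
  rintro rfl
  exact K.disjoint S hj B.fourth_mem

theorem Conf.Bowtie.head (B : K.Bowtie v₁ v₂ z b c) (S : Sys G H A Cm Λ) {j : V}
    (hj : j ∈ K.Is) : ∃ O, XO K O j := by
  obtain ⟨P, R, hI⟩ := List.append_of_mem hj
  have pI := K.pIs
  rw [hI] at pI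
  cases R with
  | nil =>
    have h := pI.eq_concat
    obtain ⟨t, ht⟩ := h
    have hjy : j = K.ys := (List.append_inj' ht rfl).2 |> List.singleton_inj.1
    refine ⟨K.Is.reverse, K.xs, hjy ▸ K.pIs.reverse, by simp, ?_⟩
    exact B.adj_next S ⟨P, [], by rw [hI]; simp⟩ hj
  | cons w R =>
    have hw : G.Adj K.xs w := B.adj_next S (j := j) ⟨P, R ++ [K.f1], by rw [hI]; simp⟩ hj
    obtain ⟨h1, h2, h3⟩ := pI.cut
    refine ⟨(P ++ [j]).reverse ++ w :: R, K.ys, h1.reverse.append h2 hw, ?_, K.e1⟩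
    rw [hI]
    refine Multiset.coe_eq_coe.2 (((List.reverse_perm _).append_right _).trans ?_)
    simp

end

section

variable {G : SimpleGraph V} {A H : Finset V} {Cm : Multiset V} {Λ : V → Prop}
variable {K : Conf G A Cm} {v₁ v₂ z b c : V}

theorem Conf.path_all (K : Conf G A Cm) : Pth G (K.Is ++ (K.B1 ++ K.It ++ K.B2)) K.xs K.g2 :=
  K.pIs.append ((K.pB1.append K.pIt K.e2).append K.pB2 K.e3) K.e1

theorem Base.insert_false (S : Base G H A Cm) (K : Conf G A Cm) {u v w : V}
    (h : [u, v] <:+: K.Is) (hw : w ∉ Cm) (hwH : w ∉ H) (hu : G.Adj w u) (hv : G.Adj w v) :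
    False := by
  obtain ⟨m, m', h1, h2, hm⟩ := K.path_all.cut_infix (infix_append_left h)
  have hC : {w} + (m' + m) = w ::ₘ Cm := by
    rw [Multiset.singleton_add, add_comm m', hm]
    congr 1
    refine Eq.trans ?_ K.hC
    simp only [← Multiset.coe_add]
    abel
  have hc : 2 ≤ Cm.card :=
    S.A2.trans (Multiset.card_le_card ((Multiset.le_iff_subset A.nodup).2 S.AC))
  have := S.L1 w u _ ((hp_singleton w).glue (h2.glue h1 K.e4) hv) hu.symm
    (hC ▸ Multiset.nodup_cons.2 ⟨hw, S.nd⟩)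
    (by
      rw [hC]
      intro v hv
      rcases Multiset.mem_cons.1 hv with rfl | hv
      · exact hwH
      · exact S.dj v hv)
    (by rw [hC, Multiset.card_cons]; omega)
  rw [hC, Multiset.card_cons] at this
  omega

theorem Base.exists_other (S : Base G H A Cm) (a : V) : ∃ b ∈ A, b ≠ a := by
  obtain ⟨b, hb, hne⟩ := Finset.exists_mem_ne (lt_of_lt_of_le one_lt_two S.A2) a
  exact ⟨b, hb, hne⟩

variable [Fintype V]

theorem Conf.exists_second (K : Conf G A Cm) (S : Sys G H A Cm Λ) :
    ∃ x, [K.xs, x] <:+: K.Is := by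
  obtain ⟨t, ht⟩ := K.pIs.eq_cons
  cases t with
  | cons x t => exact ⟨x, [], t, by rw [ht]; rfl⟩
  | nil =>
    exfalso
    refine S.NL K _ _ K.xo (S.SK _ K.f1A _ K.g2A ?_ _ K.xs
      ((K.pB1.append K.pIt K.e2).append K.pB2 K.e3).hp ?_)
    · exact K.ne_of_mem S K.pB1.head_mem K.pB2.last_mem
    · refine Eq.trans ?_ K.hC
      rw [ht]
      simp only [← Multiset.coe_add]
      rw [Multiset.coe_singleton, ← Multiset.singleton_add]
      abel

theorem Conf.Bowtie.no_off (B : K.Bowtie v₁ v₂ z b c) (S : Sys G H A Cm Λ) {w : V}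
    (hw : w ∉ Cm) (hwH : w ∉ H) : False := by
  have bC : b ∈ Cm := K.mem_iff.2 (Or.inr (Or.inr (Or.inl B.fourth_mem)))
  have bw : b ≠ w := by
    rintro rfl
    exact hw bC
  have key : ∀ {O Q : List V} {p q : V}, XO K O p → XO K.swap Q q →
      Miss G (O ++ K.B1) (Q ++ K.B2) p q b → G.Adj p w ∨ G.Adj q w := by
    intro O Q p q hO hQ mb
    by_contra! hn
    refine K.two_miss S hO hQ bw mb ?_ (K.side_of_It B.fourth_mem)
      (Or.inr (Or.inr (Or.inr (Or.inr hw)))) (K.notH_of_It S B.fourth_mem) hwH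
    have hd := (K.duo hO hQ).hC
    refine Or.inr (Or.inr ⟨?_, ?_, hn.1, hn.2⟩) <;> intro h <;> apply hw <;> rw [← hd]
    · exact Multiset.mem_add.2 (Or.inl h)
    · exact Multiset.mem_add.2 (Or.inr h)
  have n1 : ¬ G.Adj v₁ w := by
    intro a
    rcases key K.xo B.xo_snd (B.miss_snd S K.xo) with h | h
    · exact (K.duo K.xo B.xo_fst).off S.toBase hw hwH a h
    · exact S.insert_false K.swap (u := v₁) (v := v₂) ⟨[], [z, b, c], B.eq.symm⟩ hw hwH
        a.symm h.symm
  have hx : ∀ j ∈ K.Is, G.Adj w j := by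
    intro j hj
    obtain ⟨O, hO⟩ := B.head S hj
    rcases key hO B.xo_fst (B.miss_fst S hO) with h | h
    · exact h.symm
    · exact absurd h n1
  obtain ⟨x, hx2⟩ := K.exists_second S
  exact S.insert_false K hx2 hw hwH (hx _ (fst_mem hx2)) (hx _ (snd_mem hx2))

/-- The intervals of `Cm` cut out by `A`, indexed by `A`, with the neighbours of their ends. -/
structure Dec (G : SimpleGraph V) (A : Finset V) (Cm : Multiset V) where
  I : V → List V
  f : V → V
  g : V → V
  conf : ∀ a ∈ A, ∀ b ∈ A, a ≠ b → ∃ K : Conf G A Cm, K.Is = I a ∧ K.It = I b ∧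
    K.f1 = f a ∧ K.f2 = f b ∧ K.g2 = g a ∧ K.g1 = g b
  cover : ∀ v ∈ Cm, v ∉ A → ∃ a ∈ A, v ∈ I a

/-- 1-toughness through colourings that are constant on components. -/
def Tough (G : SimpleGraph V) : Prop :=
  ∀ (S : Finset V) (f : V → V ⊕ Bool), S.Nonempty →
    (∀ u v, u ∉ S → v ∉ S → G.Adj u v → f u = f v) → (Sᶜ.image f).card ≤ S.card

theorem Dec.unique (D : Dec G A Cm) (S : Sys G H A Cm Λ) {a a' u : V} (ha : a ∈ A)
    (ha' : a' ∈ A) (h : u ∈ D.I a) (h' : u ∈ D.I a') : a = a' := by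
  by_contra hne
  obtain ⟨K, h1, h2, -⟩ := D.conf a ha a' ha' hne
  exact K.disjoint S (h1 ▸ h) (h2 ▸ h')

theorem Dec.mem_props (D : Dec G A Cm) (S : Sys G H A Cm Λ) {a u : V} (ha : a ∈ A)
    (h : u ∈ D.I a) : u ∈ Cm ∧ u ∉ A ∧ u ∉ H := by
  obtain ⟨b, hb, hne⟩ := S.exists_other a
  obtain ⟨K, h1, -⟩ := D.conf a ha b hb hne.symm
  rw [← h1] at h
  have : u ∈ Cm := K.mem_iff.2 (Or.inl h)
  exact ⟨this, K.sA _ h, S.dj _ this⟩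

theorem Dec.exists_mem (D : Dec G A Cm) (S : Sys G H A Cm Λ) {a : V} (ha : a ∈ A) :
    ∃ u, u ∈ D.I a := by
  obtain ⟨b, hb, hne⟩ := S.exists_other a
  obtain ⟨K, h1, -⟩ := D.conf a ha b hb hne.symm
  exact ⟨K.xs, h1 ▸ K.pIs.head_mem⟩

/-- Too many colours. -/
theorem Tough.false_of_colours (hT : Tough G) (S : Finset V) (hS : S.Nonempty)
    (f : V → V ⊕ Bool) (hf : ∀ u v, u ∉ S → v ∉ S → G.Adj u v → f u = f v)
    (T : Finset (V ⊕ Bool)) (hT1 : ∀ t ∈ T, ∃ u, u ∉ S ∧ f u = t) (hT2 : S.card < T.card) :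
    False := by
  have h1 := hT S f hS hf
  have h2 : T ⊆ Sᶜ.image f := fun t ht => by
    obtain ⟨u, hu, rfl⟩ := hT1 t ht
    exact Finset.mem_image_of_mem f (by simpa using hu)
  have := Finset.card_le_card h2
  omega

theorem Dec.no_link_of_path (D : Dec G A Cm) (S : Sys G H A Cm Λ) (hT : Tough G)
    {b₀ : V} (hb₀ : b₀ ∈ A) (K : Conf G A Cm) (hIt : K.It = D.I b₀) (hf2 : K.f2 = D.f b₀) {O : List V} {e z : V}
    (pO : Pth G O e K.ys) (hO : (O : Multiset V) = K.Is) (hz : z ∈ K.It) : ¬ G.Adj e z := by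
  intro adj
  obtain ⟨v₁, v₂, b, c, B0⟩ := K.five S pO hO (K.closes S pO hO hz adj) hz adj
  have B : K.Bowtie v₁ v₂ z b c := by
    obtain ⟨h1, h2, h3, h4, h5, h6, h7, h8, h9⟩ := B0
    exact ⟨h1, h2, h3, h4, h5, h6, h7, h8, h9⟩
  -- transfer to the other intervals
  have tr : ∀ a ∈ A, a ≠ b₀ → ∃ K' : Conf G A Cm, K'.Is = D.I a ∧ K'.f1 = D.f a ∧
      K'.Bowtie v₁ v₂ z b c := by
    intro a ha hne
    obtain ⟨K', h1, h2, h3, h4, -⟩ := D.conf a ha b₀ hb₀ hne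
    refine ⟨K', h1, h3, ?_, B.az, ?_, B.cz, ?_, B.n₁, B.n₂, B.n₃, B.n₄⟩
    · rw [h2, ← hIt, B.eq]
    · rw [h4, ← hf2]; exact B.af
    · rw [h4, ← hf2]; exact B.cf
  have hd : ∀ a ∈ A, a ≠ b₀ → ∀ j ∈ D.I a, ∃ O e, Pth G O j e ∧ (O : Multiset V) = D.I a ∧
      G.Adj e (D.f a) := by
    intro a ha hne j hj
    obtain ⟨K', h1, h2, B'⟩ := tr a ha hne
    obtain ⟨O, e, h3, h4, h5⟩ := B'.head S (h1 ▸ hj)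
    exact ⟨O, e, h3, h1 ▸ h4, h2 ▸ h5⟩
  have n1 : ∀ a ∈ A, a ≠ b₀ → ∀ j ∈ D.I a, ∀ q, (q = v₁ ∨ q = v₂ ∨ q = b ∨ q = c) →
      ¬ G.Adj j q := by
    intro a ha hne j hj q hq
    obtain ⟨K', h1, h2, B'⟩ := tr a ha hne
    obtain ⟨O, hO⟩ := B'.head S (h1 ▸ hj)
    exact B'.not_adj S hO hq
  have n2 : ∀ a ∈ A, a ≠ b₀ → ∀ a' ∈ A, a' ≠ b₀ → a ≠ a' → ∀ j ∈ D.I a, ∀ j' ∈ D.I a',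
      ¬ G.Adj j j' := by
    intro a ha hne a' ha' hne' haa j hj j' hj'
    obtain ⟨O, e, h1, h2, h3⟩ := hd a ha hne j hj
    obtain ⟨O', e', h1', h2', h3'⟩ := hd a' ha' hne' j' hj'
    obtain ⟨K', k1, k2, k3, k4, -⟩ := D.conf a ha a' ha' haa
    have x1 : XO K' O j := ⟨e, h1, by rw [h2, k1], by rw [k3]; exact h3⟩
    have x2 : XO K'.swap O' j' := ⟨e', h1', by rw [h2', ← k2]; rfl, by
      change G.Adj e' K'.f2
      rw [k4]; exact h3'⟩
    exact (K'.duo x1 x2).not_adj S.toBase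
  have hall : ∀ w, w ∈ Cm ∨ w ∈ H := by
    intro w
    by_contra! h
    exact B.no_off S h.1 h.2
  have mI : ∀ {u}, u ∈ D.I b₀ ↔ u = v₁ ∨ u = v₂ ∨ u = z ∨ u = b ∨ u = c := by
    intro u
    rw [← hIt]; exact B.mem
  have ndI : [v₁, v₂, z, b, c].Nodup := by
    rw [← B.eq]
    exact (List.nodup_append.1 (K.nodup_snd S K.swap.xo)).1
  have zA : z ∉ A := K.tA z hz
  obtain ⟨h₀, hh₀⟩ := S.Hne
  -- the colouring
  obtain ⟨col, colH, colV, colI⟩ : ∃ col : V → V ⊕ Bool, (∀ u ∈ H, col u = Sum.inr true) ∧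
      (∀ u, u = v₁ ∨ u = v₂ → col u = Sum.inr false) ∧
      (∀ a ∈ A, ∀ u ∈ D.I a, u ≠ v₁ → u ≠ v₂ → col u = Sum.inl a) := by
    refine ⟨fun u => if u ∈ H then Sum.inr true else
      if u = v₁ ∨ u = v₂ then Sum.inr false else
      if h : ∃ a ∈ A, u ∈ D.I a then Sum.inl h.choose else Sum.inr true, ?_, ?_, ?_⟩
    · exact fun u hu => if_pos hu
    · intro u hu
      have hu' := D.mem_props S hb₀ (mI.2 (by rcases hu with h | h <;> simp [h]) : u ∈ D.I b₀)
      exact (if_neg hu'.2.2).trans (if_pos hu)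
    · intro a ha u hu h1 h2
      have hu' := D.mem_props S ha hu
      have hex : ∃ a ∈ A, u ∈ D.I a := ⟨a, ha, hu⟩
      have : hex.choose = a := D.unique S hex.choose_spec.1 ha hex.choose_spec.2 hu
      refine (if_neg hu'.2.2).trans ((if_neg (not_or.2 ⟨h1, h2⟩)).trans ?_)
      rw [dif_pos hex, this]
  have nb : ∀ u w, (u = v₁ ∨ u = v₂) → (w = b ∨ w = c) → ¬ G.Adj u w := by
    rintro u w (rfl | rfl) (rfl | rfl)
    exacts [B.n₁, B.n₂, B.n₃, B.n₄]
  have vb : ∀ w, (w = b ∨ w = c) → w ≠ v₁ ∧ w ≠ v₂ := by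
    rintro w (rfl | rfl) <;> constructor <;> rintro rfl <;> simp at ndI
  have nz : ∀ u, u ∉ insert z A → u ∉ H → ∃ a ∈ A, u ∈ D.I a ∧
      (a = b₀ → ((u = v₁ ∨ u = v₂) ∨ (u = b ∨ u = c))) := by
    intro u hu huH
    rw [Finset.mem_insert, not_or] at hu
    obtain ⟨a, ha, hua⟩ := D.cover u ((hall u).resolve_right huH) hu.2
    refine ⟨a, ha, hua, ?_⟩
    rintro rfl
    rcases mI.1 hua with h | h | h | h
    exacts [Or.inl (Or.inl h), Or.inl (Or.inr h), absurd h hu.1, Or.inr h]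
  have four : ∀ u, ((u = v₁ ∨ u = v₂) ∨ (u = b ∨ u = c)) →
      (u = v₁ ∨ u = v₂ ∨ u = b ∨ u = c) := fun u h => or_assoc.1 h
  have hnot : ∀ u v, u ∉ insert z A → v ∉ insert z A → u ∉ H → v ∉ H → G.Adj u v →
      col u = col v := by
    intro u v hu hv huH hvH a
    obtain ⟨i, hi, hui, hub⟩ := nz u hu huH
    obtain ⟨i', hi', hvi, hvb⟩ := nz v hv hvH
    have bI : ∀ w, w = b ∨ w = c → col w = Sum.inl b₀ := by
      intro w hw
      exact colI b₀ hb₀ w (mI.2 (Or.inr (Or.inr (Or.inr hw)))) (vb w hw).1 (vb w hw).2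
    have far : ∀ i ∈ A, i ≠ b₀ → ∀ w ∈ D.I i, col w = Sum.inl i := by
      intro i hi hne w hw
      refine colI i hi w hw ?_ ?_
      · rintro rfl; exact hne (D.unique S hi hb₀ hw (mI.2 (by simp)))
      · rintro rfl; exact hne (D.unique S hi hb₀ hw (mI.2 (by simp)))
    by_cases e1 : i = b₀ <;> by_cases e2 : i' = b₀
    · rcases hub e1 with h | h <;> rcases hvb e2 with h' | h'
      · rw [colV u h, colV v h']
      · exact absurd a (nb u v h h')
      · exact absurd a.symm (nb v u h' h)
      · rw [bI u h, bI v h']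
    · exact absurd a.symm (n1 i' hi' e2 v hvi u (four u (hub e1)))
    · exact absurd a (n1 i hi e1 u hui v (four v (hvb e2)))
    · by_cases e3 : i = i'
      · subst e3
        rw [far i hi e1 u hui, far i hi e1 v hvi]
      · exact absurd a (n2 i hi e1 i' hi' e2 e3 u hui v hvi)
  refine hT.false_of_colours (insert z A) (Finset.insert_nonempty _ _) col ?_
    (insert (Sum.inr true) (insert (Sum.inr false) (A.image Sum.inl))) ?_ ?_
  · intro u v hu hv a
    by_cases huH : u ∈ H
    · have hvH : v ∈ H := (S.HE u huH v a).resolve_right fun h => hv (by simp [h])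
      rw [colH u huH, colH v hvH]
    · by_cases hvH : v ∈ H
      · exact absurd ((S.HE v hvH u a.symm).resolve_right fun h => hu (by simp [h])) huH
      · exact hnot u v hu hv huH hvH a
  · intro t ht
    simp only [Finset.mem_insert, Finset.mem_image] at ht
    have nin : ∀ u ∈ Cm, u ∉ A → u ≠ z → u ∉ insert z A := by
      intro u _ h1 h2 h3
      rcases Finset.mem_insert.1 h3 with h | h <;> contradiction
    rcases ht with rfl | rfl | ⟨a, ha, rfl⟩
    · refine ⟨h₀, ?_, colH h₀ hh₀⟩
      intro h
      rcases Finset.mem_insert.1 h with h | h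
      · exact K.notH_of_It S hz (h ▸ hh₀)
      · exact S.dj _ (S.AC _ h) hh₀
    · have h1 := D.mem_props S hb₀ (mI.2 (by simp) : v₁ ∈ D.I b₀)
      refine ⟨v₁, nin _ h1.1 h1.2.1 ?_, colV v₁ (Or.inl rfl)⟩
      rintro rfl; simp at ndI
    · by_cases e1 : a = b₀
      · subst e1
        have hb := mI.2 (by simp : b = v₁ ∨ b = v₂ ∨ b = z ∨ b = b ∨ b = c)
        have h1 := D.mem_props S ha hb
        refine ⟨b, nin _ h1.1 h1.2.1 ?_, colI a ha b hb (vb b (Or.inl rfl)).1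
          (vb b (Or.inl rfl)).2⟩
        rintro rfl; simp at ndI
      · obtain ⟨u, hu⟩ := D.exists_mem S ha
        have h1 := D.mem_props S ha hu
        refine ⟨u, nin _ h1.1 h1.2.1 ?_, colI a ha u hu ?_ ?_⟩
        · rintro rfl; exact e1 (D.unique S ha hb₀ hu (mI.2 (by simp)))
        · rintro rfl; exact e1 (D.unique S ha hb₀ hu (mI.2 (by simp)))
        · rintro rfl; exact e1 (D.unique S ha hb₀ hu (mI.2 (by simp)))
  · rw [Finset.card_insert_of_notMem zA, Finset.card_insert_of_notMem (by simp),
      Finset.card_insert_of_notMem (by simp), Finset.card_image_of_injective _ Sum.inl_injective]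
    omega

end

section

variable {G : SimpleGraph V} {A H : Finset V} {Cm : Multiset V} {Λ : V → Prop}
variable {K : Conf G A Cm} {a b : V}

/-- Reversing the orientation. -/
def Dec.rev (D : Dec G A Cm) : Dec G A Cm where
  I := fun a => (D.I a).reverse
  f := D.g
  g := D.f
  conf := by
    intro a ha b hb hne
    obtain ⟨K, h1, h2, h3, h4, h5, h6⟩ := D.conf a ha b hb hne
    exact ⟨K.rev, congrArg List.reverse h1, congrArg List.reverse h2, h5, h6, h3, h4⟩
  cover := fun v hv hA => by
    obtain ⟨a, ha, h⟩ := D.cover v hv hA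
    exact ⟨a, ha, List.mem_reverse.2 h⟩

/-- `K` singles out the intervals of index `a` and `b`. -/
structure Dec.At (D : Dec G A Cm) (K : Conf G A Cm) (a b : V) : Prop where
  ha : a ∈ A
  hb : b ∈ A
  hs : K.Is = D.I a
  ht : K.It = D.I b
  h1 : K.f1 = D.f a
  h2 : K.f2 = D.f b
  h3 : K.g2 = D.g a
  h4 : K.g1 = D.g b

variable {D : Dec G A Cm}

theorem Dec.At.swap (h : D.At K a b) : D.At K.swap b a :=
  ⟨h.hb, h.ha, h.ht, h.hs, h.h2, h.h1, h.h4, h.h3⟩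

theorem Dec.At.rev (h : D.At K a b) : D.rev.At K.rev a b :=
  ⟨h.ha, h.hb, congrArg List.reverse h.hs, congrArg List.reverse h.ht, h.h3, h.h4, h.h1, h.h2⟩

variable [Fintype V]

theorem Dec.At.not_adj_of_path (h : D.At K a b) (S : Sys G H A Cm Λ) (hT : Tough G)
    {O : List V} {e z : V} (pO : Pth G O e K.ys) (hO : (O : Multiset V) = K.Is)
    (hz : z ∈ K.It) : ¬ G.Adj e z :=
  D.no_link_of_path S hT h.hb K h.ht h.h2 pO hO hz

theorem Dec.At.not_adj_fst (h : D.At K a b) (S : Sys G H A Cm Λ) (hT : Tough G)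
    {z : V} (hz : z ∈ K.It) : ¬ G.Adj K.xs z :=
  h.not_adj_of_path S hT K.pIs rfl hz

theorem Dec.At.not_adj_last (h : D.At K a b) (S : Sys G H A Cm Λ) (hT : Tough G)
    {z : V} (hz : z ∈ K.It) : ¬ G.Adj K.ys z :=
  h.rev.not_adj_fst S hT (List.mem_reverse.2 hz)

/-- Being a missed vertex for the two given intervals. -/
def Conf.Missed (K : Conf G A Cm) (u : V) : Prop :=
  Miss G (K.Is ++ K.B1) (K.It ++ K.B2) K.xs K.xt u

theorem Dec.At.adj_next (h : D.At K a b) (S : Sys G H A Cm Λ) (hT : Tough G) {j w : V}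
    (hw : [j, w] <:+: K.Is ++ [K.f1]) (hj : j ∈ K.Is) (hm : ¬ K.Missed j) :
    G.Adj K.xs w :=
  K.swap.adj_next_of_not_miss S (O := K.It) (Q := K.Is) (p := K.xt) K.xo hw
    (fun m => hm m.symm) (h.swap.not_adj_fst S hT hj)

theorem Dec.At.head (h : D.At K a b) (S : Sys G H A Cm Λ) (hT : Tough G) {j : V}
    (hj : j ∈ K.Is) (hm : ¬ K.Missed j) :
    (∃ O, XO K O j) ∧ (j = K.ys ∨ ∃ O, Pth G O j K.ys ∧ (O : Multiset V) = K.Is) := by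
  obtain ⟨P, R, hI⟩ := List.append_of_mem hj
  have pI := K.pIs
  rw [hI] at pI
  cases R with
  | nil =>
    obtain ⟨t, ht⟩ := pI.eq_concat
    have hjy : j = K.ys := (List.append_inj' ht rfl).2 |> List.singleton_inj.1
    refine ⟨⟨K.Is.reverse, K.xs, hjy ▸ K.pIs.reverse, by simp, ?_⟩, Or.inl hjy⟩
    exact h.adj_next S hT ⟨P, [], by rw [hI]; simp⟩ hj hm
  | cons w R =>
    have hw : G.Adj K.xs w := h.adj_next S hT (j := j) ⟨P, R ++ [K.f1], by rw [hI]; simp⟩ hj hm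
    obtain ⟨h1, h2, h3⟩ := pI.cut
    have p := h1.reverse.append h2 hw
    have e : (((P ++ [j]).reverse ++ w :: R : List V) : Multiset V) = K.Is := by
      rw [hI]
      refine Multiset.coe_eq_coe.2 (((List.reverse_perm _).append_right _).trans ?_)
      simp
    exact ⟨⟨_, K.ys, p, e, K.e1⟩, Or.inr ⟨_, p, e⟩⟩

theorem Conf.one_missed (K : Conf G A Cm) (S : Sys G H A Cm Λ) {u w : V} (hu : u ∈ K.Is)
    (hw : w ∈ K.It) (mu : K.Missed u) (mw : K.Missed w) : False := by
  refine K.two_miss S K.xo K.swap.xo ?_ mu mw (Or.inl hu) (K.side_of_It hw)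
    (K.swap.notH_of_It S hu) (K.notH_of_It S hw)
  rintro rfl
  exact K.disjoint S hu hw

theorem Dec.At.not_adj (h : D.At K a b) (S : Sys G H A Cm Λ) (hT : Tough G) {p q : V}
    (hp : p ∈ K.Is) (hq : q ∈ K.It) : ¬ G.Adj p q := by
  have key : ∀ {K : Conf G A Cm} {a b p q : V}, D.At K a b → p ∈ K.Is → q ∈ K.It →
      ¬ K.Missed p → ¬ G.Adj p q := by
    intro K a b p q h hp hq hm
    rcases (h.head S hT hp hm).2 with rfl | ⟨O, pO, hO⟩
    · exact h.not_adj_last S hT hq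
    · exact h.not_adj_of_path S hT pO hO hq
  by_cases m : K.Missed p
  · have m' : ¬ K.Missed q := fun m' => K.one_missed S hp hq m m'
    exact fun adj => key h.swap hq hp (fun m => m' (Miss.symm m)) adj.symm
  · exact key h hp hq m

theorem Dec.At.not_linked_of_not_missed (h : D.At K a b) (S : Sys G H A Cm Λ) (hT : Tough G)
    {p q d e : V} {l : List V} (hp : p ∈ K.Is) (hq : q ∈ K.It) (hm : ¬ K.Missed p)
    (pl : Pth G l d e) (nd : l.Nodup) (hl : ∀ v ∈ l, v ∉ Cm ∧ v ∉ H) (hpd : G.Adj p d)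
    (heq : G.Adj e q) : False := by
  obtain ⟨⟨O, hO⟩, -⟩ := h.head S hT hp hm
  have lpos : 0 < l.length := List.length_pos_of_ne_nil pl.ne_nil
  have hne : K.g1 ≠ K.g2 := K.g_ne S.toBase
  have pOB : HP G K.g1 p ((O : Multiset V) + K.B1) := by
    have := hO.path.hp.symm
    simpa using this
  have hOc : (O : Multiset V) = K.Is := Multiset.coe_eq_coe.2 hO.perm
  -- a walk through `l` avoiding at most one vertex
  have long : ∀ m : Multiset V, HP G q K.g2 m → m ≤ (K.It : Multiset V) + (K.B2 : Multiset V) →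
      Multiset.card ((K.It : Multiset V) + (K.B2 : Multiset V)) ≤ m.card + 1 → False := by
    intro m hm hle hc
    have hC := K.hC
    have hle' : (K.Is : Multiset V) + K.B1 + m ≤ Cm := by
      refine le_of_le_of_eq ?_ hC
      rw [add_assoc _ (K.It : Multiset V)]
      exact add_le_add_right hle _
    have hcc := congrArg Multiset.card hC
    have := S.AA _ K.g1A _ K.g2A hne _ ((pOB.glue pl.hp hpd).glue hm heq) ?_ ?_
    · simp only [Multiset.card_add, Multiset.coe_card, hOc] at this hc hcc
      omega
    · have e : (O : Multiset V) + (K.B1 : Multiset V) + (l : Multiset V) + m =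
          (l : Multiset V) + ((K.Is : Multiset V) + (K.B1 : Multiset V) + m) := by
        rw [hOc]; abel
      rw [e, Multiset.nodup_add]
      refine ⟨Multiset.coe_nodup.2 nd, Multiset.nodup_of_le hle' S.nd, ?_⟩
      rw [Multiset.disjoint_left]
      intro v hv hv'
      exact (hl v hv).1 (Multiset.mem_of_le hle' hv')
    · intro v hv
      have hv' : v ∈ (K.Is : Multiset V) + K.B1 + m ∨ v ∈ l := by
        rw [← hOc]
        simp only [Multiset.mem_add, Multiset.mem_coe] at hv ⊢
        tauto
      rcases hv' with h | h
      · exact S.dj v (Multiset.mem_of_le hle' h)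
      · exact (hl v h).2
  by_cases hQ : ∃ Q, XO K.swap Q q
  · obtain ⟨Q, hQ⟩ := hQ
    have hQc : (Q : Multiset V) = K.It := Multiset.coe_eq_coe.2 hQ.perm
    refine long ((Q : Multiset V) + K.B2) ?_ (by rw [hQc]) (by rw [hQc]; simp)
    exact hQ.path.hp
  · have hmq : K.Missed q := by
      by_contra hmq
      exact hQ (h.swap.head S hT hq (fun m => hmq (Miss.symm m))).1
    have notMissed : ∀ {u}, Side K u → u ∉ H → u ≠ q → ¬ K.Missed u := fun su uH une mu =>
      K.two_miss S K.xo K.swap.xo une mu hmq su (K.side_of_It hq) uH (K.notH_of_It S hq)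
    obtain ⟨s, t, hI⟩ := List.append_of_mem hq
    cases t with
    | cons q' t =>
      have hq' : q' ∈ K.It := by rw [hI]; simp
      have hqq : q' ≠ q := by
        have : K.It.Nodup := (List.nodup_append.1 (K.nodup_snd S K.swap.xo)).1
        rw [hI] at this
        rintro rfl
        simp [List.nodup_append] at this
      obtain ⟨w, t', ht'⟩ : ∃ w t', t ++ [K.f2] = w :: t' := by
        cases t with
        | nil => exact ⟨_, _, rfl⟩
        | cons x t => exact ⟨_, _, rfl⟩
      have i3 : [q, q', w] <:+: K.It ++ [K.f2] := ⟨s, t', by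
        rw [hI, List.append_assoc, List.append_assoc]
        simp [ht']⟩
      have hw : G.Adj K.xt w := h.swap.adj_next S hT (j := q')
        (List.IsInfix.trans ⟨[q], [], rfl⟩ i3) hq'
        (fun m => notMissed (K.side_of_It hq') (K.notH_of_It S hq') hqq (Miss.symm m))
      obtain ⟨m, m', h1, h2, hmm⟩ := (K.swap.xo.path : Pth G (K.It ++ K.B2) K.xt K.g2).cut_infix_skip
        (K.ext_snd i3)
      replace hmm : q' ::ₘ (m + m') = (K.It : Multiset V) + (K.B2 : Multiset V) := by
        rw [hmm, Multiset.coe_add]; rfl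
      refine long (m + m') (h1.symm.glue h2 hw) ?_ ?_
      · rw [← hmm]; exact Multiset.le_cons_self _ _
      · rw [← hmm, Multiset.card_cons]
    | nil =>
      have hqy : q = K.yt := by
        have := K.pIt
        rw [hI] at this
        obtain ⟨t, ht⟩ := this.eq_concat
        exact (List.append_inj' ht rfl).2 |> List.singleton_inj.1
      have nf : ¬ G.Adj K.xt K.f2 := by
        intro a
        exact hQ ⟨K.It.reverse, K.xt, hqy ▸ K.pIt.reverse, by simp; rfl, a⟩
      have hd := hl d pl.head_mem
      have nx : ¬ G.Adj K.xt d := fun a => (K.duo hO K.swap.xo).off S.toBase hd.1 hd.2 a hpd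
      have key : ∀ {O : List V} {r : V}, XO K O r → r ∈ K.Is → G.Adj d r := by
        intro O r hr hrI
        by_contra hn
        have mq : Miss G (O ++ K.B1) (K.It ++ K.B2) r K.xt q :=
          K.miss_snd S K.swap.xo ⟨s, [], by rw [hI]; simp⟩ (h.not_adj S hT hrI hq) nf
        refine K.two_miss S hr K.swap.xo (u := d) ?_ (Or.inr (Or.inr ⟨?_, ?_,
          fun a => hn a.symm, nx⟩)) mq (Or.inr (Or.inr (Or.inr (Or.inr hd.1))))
          (K.side_of_It hq) hd.2 (K.notH_of_It S hq)
        · rintro rfl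
          exact hd.1 (K.mem_iff.2 (Or.inr (Or.inr (Or.inl hq))))
        · intro hm
          apply hd.1
          rw [← (K.duo hr K.swap.xo).hC]
          exact Multiset.mem_add.2 (Or.inl hm)
        · intro hm
          apply hd.1
          rw [← (K.duo hr K.swap.xo).hC]
          exact Multiset.mem_add.2 (Or.inr hm)
      obtain ⟨x, hx⟩ := K.exists_second S
      have hxI := snd_mem hx
      obtain ⟨⟨O', hO'⟩, -⟩ := h.head S hT hxI (notMissed (Or.inl hxI)
        (K.swap.notH_of_It S hxI) (fun e => K.disjoint S (e ▸ hxI) hq))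
      exact S.insert_false K hx hd.1 hd.2 (key K.xo (fst_mem hx)) (key hO' hxI)

theorem Dec.At.not_linked (h : D.At K a b) (S : Sys G H A Cm Λ) (hT : Tough G)
    {p q d e : V} {l : List V} (hp : p ∈ K.Is) (hq : q ∈ K.It)
    (pl : Pth G l d e) (nd : l.Nodup) (hl : ∀ v ∈ l, v ∉ Cm ∧ v ∉ H) (hpd : G.Adj p d)
    (heq : G.Adj e q) : False := by
  by_cases m : K.Missed p
  · exact h.swap.not_linked_of_not_missed S hT hq hp
      (fun m' => K.one_missed S hp hq m (Miss.symm m')) pl.reverse (List.nodup_reverse.2 nd)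
      (fun v hv => hl v (List.mem_reverse.1 hv)) heq.symm hpd.symm
  · exact h.not_linked_of_not_missed S hT hp hq m pl nd hl hpd heq

/-- Joined by a path all of whose vertices satisfy `P`. -/
def PathIn (G : SimpleGraph V) (P : V → Prop) (x y : V) : Prop :=
  ∃ l, Pth G l x y ∧ l.Nodup ∧ ∀ v ∈ l, P v

end

section

variable {G : SimpleGraph V} {A H : Finset V} {Cm : Multiset V} {Λ : V → Prop}
variable {P : V → Prop}

theorem PathIn.cons {u x y : V} (hu : P u) (adj : G.Adj u x) (h : PathIn G P x y) :
    PathIn G P u y := by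
  obtain ⟨l, pl, nd, hl⟩ := h
  by_cases hul : u ∈ l
  · obtain ⟨s, t, rfl⟩ := List.append_of_mem hul
    refine ⟨u :: t, pl.suffix_from, (List.nodup_append.1 nd).2.1, fun v hv => hl v ?_⟩
    exact List.mem_append_right _ hv
  · refine ⟨u :: l, ?_, List.nodup_cons.2 ⟨hul, nd⟩, ?_⟩
    · exact (pth_singleton u).append pl adj
    · intro v hv
      rcases List.mem_cons.1 hv with rfl | hv
      · exact hu
      · exact hl v hv

theorem PathIn.singleton {u : V} (hu : P u) : PathIn G P u u :=
  ⟨[u], pth_singleton u, List.nodup_singleton u, fun v hv => by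
    rw [List.mem_singleton.1 hv]; exact hu⟩

theorem PathIn.symm {x y : V} (h : PathIn G P x y) : PathIn G P y x := by
  obtain ⟨l, pl, nd, hl⟩ := h
  exact ⟨l.reverse, pl.reverse, List.nodup_reverse.2 nd,
    fun v hv => hl v (List.mem_reverse.1 hv)⟩

theorem PathIn.trans {x y z : V} (h : PathIn G P x y) (h' : PathIn G P y z) :
    PathIn G P x z := by
  obtain ⟨l, pl, -, hl⟩ := h
  induction l generalizing x with
  | nil => exact absurd rfl pl.ne_nil
  | cons u t ih =>
    obtain ⟨t', ht'⟩ := pl.eq_cons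
    obtain ⟨rfl, rfl⟩ := List.cons.inj ht'
    cases t with
    | nil =>
      have : y = u := by
        have := pl.last_mem
        simpa using this
      exact this ▸ h'
    | cons w t =>
      obtain ⟨-, h2, h3⟩ := Pth.cut (l := []) pl
      exact (ih h2 (fun v hv => hl v (List.mem_cons_of_mem _ hv))).cons (hl u (by simp)) h3

theorem PathIn.left {x y : V} (h : PathIn G P x y) : P x := by
  obtain ⟨l, pl, -, hl⟩ := h
  exact hl _ pl.head_mem

theorem PathIn.right {x y : V} (h : PathIn G P x y) : P y := h.symm.left

/-- `u` lies in the interval of index `a` or is joined to it outside `Cm` and `H`. -/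
def Dec.Linked (D : Dec G A Cm) (H : Finset V) (a u : V) : Prop :=
  u ∈ D.I a ∨ ∃ y p, PathIn G (fun v => v ∉ Cm ∧ v ∉ H) u y ∧ p ∈ D.I a ∧ G.Adj y p

variable {D : Dec G A Cm} {a a' u v : V}

theorem Dec.exists_at (D : Dec G A Cm) (ha : a ∈ A) (ha' : a' ∈ A) (hne : a ≠ a') :
    ∃ K, D.At K a a' := by
  obtain ⟨K, h1, h2, h3, h4, h5, h6⟩ := D.conf a ha a' ha' hne
  exact ⟨K, ha, ha', h1, h2, h3, h4, h5, h6⟩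

variable [Fintype V]

theorem Dec.Linked.unique (S : Sys G H A Cm Λ) (hT : Tough G) (ha : a ∈ A) (ha' : a' ∈ A)
    (h : D.Linked H a u) (h' : D.Linked H a' u) : a = a' := by
  by_contra hne
  obtain ⟨K, hK⟩ := D.exists_at ha ha' hne
  rcases h with h | ⟨y, p, py, hp, adj⟩
  · rcases h' with h' | ⟨y', p', py', hp', adj'⟩
    · exact hne (D.unique S ha ha' h h')
    · exact py'.left.1 (D.mem_props S ha h).1
  · rcases h' with h' | ⟨y', p', py', hp', adj'⟩
    · exact py.left.1 (D.mem_props S ha' h').1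
    · obtain ⟨l, pl, nd, hl⟩ := py.symm.trans py'
      exact hK.not_linked S hT (hK.hs ▸ hp) (hK.ht ▸ hp') pl nd hl adj.symm adj'

theorem Dec.Linked.of_adj (S : Sys G H A Cm Λ) (hT : Tough G) (ha : a ∈ A)
    (h : D.Linked H a u) (adj : G.Adj u v) (hv : v ∉ A) (hvH : v ∉ H) : D.Linked H a v := by
  by_cases hvC : v ∈ Cm
  · obtain ⟨a', ha', hva⟩ := D.cover v hvC hv
    by_cases hne : a = a'
    · exact Or.inl (hne ▸ hva)
    · obtain ⟨K, hK⟩ := D.exists_at ha ha' hne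
      rcases h with h | ⟨y, p, ⟨l, pl, nd, hl⟩, hp, adj'⟩
      · exact absurd adj (hK.not_adj S hT (hK.hs ▸ h) (hK.ht ▸ hva))
      · exact (hK.not_linked S hT (hK.hs ▸ hp) (hK.ht ▸ hva) pl.reverse
          (List.nodup_reverse.2 nd) (fun v hv => hl v (List.mem_reverse.1 hv))
          adj'.symm adj).elim
  · rcases h with h | ⟨y, p, py, hp, adj'⟩
    · exact Or.inr ⟨v, u, PathIn.singleton ⟨hvC, hvH⟩, h, adj.symm⟩
    · exact Or.inr ⟨y, p, py.cons ⟨hvC, hvH⟩ adj.symm, hp, adj'⟩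

theorem Dec.Linked.not_mem (S : Sys G H A Cm Λ) (ha : a ∈ A) (h : D.Linked H a u) : u ∉ H := by
  rcases h with h | ⟨y, p, py, hp, adj⟩
  · exact (D.mem_props S ha h).2.2
  · exact py.left.2

/-- The main lemma: the attachments of `H` leave too many components. -/
theorem Dec.contradiction (D : Dec G A Cm) (S : Sys G H A Cm Λ) (hT : Tough G) : False := by
  have hAH : ∀ u ∈ H, u ∉ A := fun u hu hA => S.dj u (S.AC u hA) hu
  let f : V → V ⊕ Bool := fun u =>
    if u ∈ H then Sum.inr true
    else if h : ∃ a ∈ A, D.Linked H a u then Sum.inl h.choose else Sum.inr false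
  have fH : ∀ u ∈ H, f u = Sum.inr true := fun u hu => if_pos hu
  have fL : ∀ a ∈ A, ∀ u, D.Linked H a u → f u = Sum.inl a := by
    intro a ha u h
    have hE : ∃ a ∈ A, D.Linked H a u := ⟨a, ha, h⟩
    have : f u = Sum.inl hE.choose := by
      simp only [f]
      rw [if_neg (h.not_mem S ha), dif_pos hE]
    rw [this, hE.choose_spec.2.unique S hT hE.choose_spec.1 ha h]
  have fN : ∀ u, u ∉ H → (¬ ∃ a ∈ A, D.Linked H a u) → f u = Sum.inr false := by
    intro u hu h
    simp only [f]
    rw [if_neg hu, dif_neg h]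
  have hA : A.Nonempty := Finset.card_pos.1 (by have := S.A2; omega)
  refine hT.false_of_colours A hA f ?_ (insert (Sum.inr true) (A.image Sum.inl)) ?_ ?_
  · intro u v hu hv adj
    by_cases huH : u ∈ H
    · rw [fH u huH, fH v ((S.HE u huH v adj).resolve_right hv)]
    · have hvH : v ∉ H := fun hvH => huH ((S.HE v hvH u adj.symm).resolve_right hu)
      by_cases h : ∃ a ∈ A, D.Linked H a u
      · obtain ⟨a, ha, h⟩ := h
        rw [fL a ha u h, fL a ha v (h.of_adj S hT ha adj hv hvH)]
      · rw [fN u huH h, fN v hvH]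
        rintro ⟨a, ha, h'⟩
        exact h ⟨a, ha, h'.of_adj S hT ha adj.symm hu huH⟩
  · intro t ht
    rcases Finset.mem_insert.1 ht with rfl | ht
    · obtain ⟨u, hu⟩ := S.Hne
      exact ⟨u, hAH u hu, fH u hu⟩
    · obtain ⟨a, ha, rfl⟩ := Finset.mem_image.1 ht
      obtain ⟨u, hu⟩ := D.exists_mem S ha
      exact ⟨u, (D.mem_props S ha hu).2.1, fL a ha u (Or.inl hu)⟩
  · rw [Finset.card_insert_of_notMem (by simp), Finset.card_image_of_injective _ Sum.inl_injective]
    omega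

end

section

variable {G : SimpleGraph V} {A H : Finset V} {Cm : Multiset V} {Λ : V → Prop}

/-- A closed walk without repetition, given by the list of its vertices. -/
def Cyc (G : SimpleGraph V) (C : List V) : Prop :=
  C.Nodup ∧ ∃ x y, Pth G C x y ∧ G.Adj y x

theorem Cyc.rotated {C C' : List V} (h : Cyc G C) (hr : C ~r C') : Cyc G C' := by
  obtain ⟨n, rfl⟩ := hr
  refine ⟨List.nodup_rotate.2 h.1, ?_⟩
  rw [List.rotate_eq_drop_append_take_mod]
  set k := n % C.length
  obtain ⟨x, y, p, adj⟩ := h.2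
  rw [← List.take_append_drop k C] at p
  by_cases h1 : C.take k = []
  · rw [h1] at p ⊢
    exact ⟨x, y, by simpa using p, adj⟩
  by_cases h2 : C.drop k = []
  · rw [h2] at p ⊢
    exact ⟨x, y, by simpa using p, adj⟩
  obtain ⟨z, w, p1, p2, a⟩ := p.split h1 h2
  exact ⟨w, z, p2.append p1 adj, a⟩

theorem Cyc.closed {a : V} {L : List V} (h : Cyc G (a :: L)) : Pth G (a :: (L ++ [a])) a a := by
  obtain ⟨-, x, y, p, adj⟩ := h
  obtain ⟨t, ht⟩ := p.eq_cons
  obtain ⟨rfl, rfl⟩ := List.cons.inj ht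
  exact p.append (pth_singleton a) adj

theorem isRotated_append (s t : List V) : (s ++ t) ~r (t ++ s) :=
  List.isRotated_append

theorem exists_isRotated_cons {C : List V} {a : V} (h : a ∈ C) : ∃ L, C ~r a :: L := by
  obtain ⟨s, t, rfl⟩ := List.append_of_mem h
  exact ⟨t ++ s, isRotated_append s (a :: t)⟩

theorem isRotated_cons_inj {C L L' : List V} {a : V} (nd : C.Nodup) (h : C ~r a :: L)
    (h' : C ~r a :: L') : L = L' := by
  have nd' : (a :: L).Nodup := h.nodup_iff.1 nd
  obtain ⟨n, hn, e⟩ := List.isRotated_iff_mod.1 (h.symm.trans h')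
  by_cases hl : n = (a :: L).length
  · rw [hl, List.rotate_length] at e
    exact (List.cons.inj e).2
  have hlt : n < (a :: L).length := lt_of_le_of_ne hn hl
  have h0 := List.head?_rotate hlt
  rw [e, List.head?_cons] at h0
  have hget : (a :: L)[n]'hlt = (a :: L)[0]'(by simp) := by
    rw [List.getElem?_eq_getElem hlt] at h0
    simpa using h0.symm
  have := (List.Nodup.getElem_inj_iff nd').1 hget
  rw [this, List.rotate_zero] at e
  exact (List.cons.inj e).2

/-- The cycle `C` read from the successor of `a` on. -/
def after (C : List V) (a : V) : List V :=
  if h : ∃ L, C ~r a :: L then h.choose else []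

theorem after_eq {C L : List V} {a : V} (nd : C.Nodup) (h : C ~r a :: L) : after C a = L := by
  have hE : ∃ L, C ~r a :: L := ⟨L, h⟩
  rw [after, dif_pos hE]
  exact isRotated_cons_inj nd hE.choose_spec h

/-- The interval of `C` after `a`. -/
def interval (A : Finset V) (C : List V) (a : V) : List V :=
  (after C a).takeWhile (fun v => decide (v ∉ A))

/-- The first element of `A` on `C` after `a`. -/
def nextA (A : Finset V) (C : List V) (a : V) : V :=
  ((after C a).dropWhile (fun v => decide (v ∉ A))).headD a

theorem interval_eq {C p r : List V} {a q : V} (nd : C.Nodup) (h : C ~r a :: (p ++ q :: r))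
    (hp : ∀ v ∈ p, v ∉ A) (hq : q ∈ A) : interval A C a = p := by
  rw [interval, after_eq nd h, List.takeWhile_append_of_pos (by simpa using hp),
    List.takeWhile_cons_of_neg (by simpa using hq), List.append_nil]

theorem nextA_eq {C p r : List V} {a q : V} (nd : C.Nodup) (h : C ~r a :: (p ++ q :: r))
    (hp : ∀ v ∈ p, v ∉ A) (hq : q ∈ A) : nextA A C a = q := by
  rw [nextA, after_eq nd h, List.dropWhile_append_of_pos (by simpa using hp),
    List.dropWhile_cons_of_neg (by simpa using hq)]
  rfl

/-- No two consecutive vertices of `C` are in `A`. -/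
def Sparse (A : Finset V) (C : List V) : Prop :=
  ∀ a ∈ A, ∀ b ∈ A, ∀ L, ¬ C ~r a :: b :: L

theorem exists_conf {C : List V} (hC : Cyc G C) (hA : ∀ a ∈ A, a ∈ C) (hs : Sparse A C)
    {a b : V} (ha : a ∈ A) (hb : b ∈ A) (hne : a ≠ b) :
    ∃ K : Conf G A (C : Multiset V), K.Is = interval A C a ∧ K.It = interval A C b ∧
      K.f1 = nextA A C a ∧ K.f2 = nextA A C b ∧ K.g2 = a ∧ K.g1 = b ∧
      C ~r K.Is ++ K.B1 ++ K.It ++ K.B2 := by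
  obtain ⟨L, hL⟩ := exists_isRotated_cons (hA a ha)
  have hbL : b ∈ L := by
    have := hL.mem_iff.1 (hA b hb)
    exact (List.mem_cons.1 this).resolve_left hne.symm
  obtain ⟨p, q, r, rfl, hq, hp⟩ := exists_first (P := (· ∈ A)) hbL hb
  have hbr : b ∈ q :: r := (List.mem_append.1 hbL).resolve_left fun h => hp b h hb
  obtain ⟨B, t, hB⟩ := List.append_of_mem hbr
  obtain ⟨p', q', r', ht, hq', hp'⟩ := exists_first (P := (· ∈ A)) (L := t ++ [a])
    (y := a) (by simp) ha
  have hLb : C ~r b :: (p' ++ q' :: (r' ++ p ++ B)) := by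
    have e : b :: (p' ++ q' :: (r' ++ p ++ B)) = (b :: t) ++ (a :: (p ++ B)) := by
      have : (p' ++ q' :: r') ++ (p ++ B) = (t ++ [a]) ++ (p ++ B) := by rw [ht]
      simpa using this
    rw [e]
    refine hL.trans ?_
    rw [hB]
    have := isRotated_append (a :: (p ++ B)) (b :: t)
    simpa using this
  have hpne : p ≠ [] := by
    rintro rfl
    exact hs a ha q hq _ hL
  have hpne' : p' ≠ [] := by
    rintro rfl
    exact hs b hb q' hq' _ hLb
  have path := (hC.rotated hL).closed
  have hB1 : B ++ [b] ≠ [] := by simp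
  have e : p ++ q :: r ++ [a] = p ++ ((B ++ [b]) ++ (p' ++ q' :: r')) := by
    rw [hB, ← ht]; simp
  rw [e] at path
  obtain ⟨z0, xs, p0, path, e4⟩ := Pth.split (l := [a]) path (by simp) (by simp)
  obtain ⟨ys, f1, pIs, path, e1⟩ := path.split hpne (by simp)
  obtain ⟨g1, xt, pB1, path, e2⟩ := path.split hB1 (by simp)
  obtain ⟨yt, f2, pIt, pB2, e3⟩ := path.split hpne' (by simp)
  obtain ⟨-, rfl⟩ := p0.eq_of_singleton
  obtain rfl : g1 = b := by
    have := pB1.2.2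
    simpa using this.symm
  obtain rfl : f2 = q' := by
    have := pB2.2.1
    simpa using this.symm
  have hf1 : f1 = q := by
    have h1 := pB1.2.1
    have h2 : ((q :: r).head?) = ((B ++ [g1]) ++ t).head? := by rw [hB]; simp
    rw [List.head?_append_of_ne_nil _ hB1, h1] at h2
    simpa using h2.symm
  subst hf1
  have hrot : C ~r p ++ (B ++ [g1]) ++ p' ++ f2 :: r' := by
    have e2 : p ++ (B ++ [g1]) ++ p' ++ f2 :: r' = (p ++ f1 :: r) ++ [z0] := by
      rw [e]; simp
    rw [e2]
    exact hL.trans (isRotated_append [z0] _)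
  refine ⟨⟨p, B ++ [g1], p', f2 :: r', xs, ys, f1, g1, xt, yt, f2, z0, pIs, pB1, pIt, pB2,
    e1, e2, e3, e4, ?_, hq, hb, hq', ha, hp, hp'⟩, (interval_eq hC.1 hL hp hq).symm,
    (interval_eq hC.1 hLb hp' hq').symm, (nextA_eq hC.1 hL hp hq).symm,
    (nextA_eq hC.1 hLb hp' hq').symm, rfl, rfl, hrot⟩
  rw [Multiset.coe_add, Multiset.coe_add, Multiset.coe_add, Multiset.coe_eq_coe]
  exact hrot.perm.symm

/-- The intervals of `C` cut out by `A`. -/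
def Cyc.dec {C : List V} (hC : Cyc G C) (hA : ∀ a ∈ A, a ∈ C) (hs : Sparse A C)
    (h2 : 2 ≤ A.card) : Dec G A (C : Multiset V) where
  I := interval A C
  f := nextA A C
  g := id
  conf := fun _ ha _ hb hne => by
    obtain ⟨K, h1, h2, h3, h4, h5, h6, -⟩ := exists_conf hC hA hs ha hb hne
    exact ⟨K, h1, h2, h3, h4, h5, h6⟩
  cover := by
    intro v hv hvA
    obtain ⟨L, hL⟩ := exists_isRotated_cons (Multiset.mem_coe.1 hv)
    have hAL : ∀ a ∈ A, a ∈ L := fun a ha =>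
      (List.mem_cons.1 (hL.mem_iff.1 (hA a ha))).resolve_left (fun h => hvA (h ▸ ha))
    obtain ⟨a₀, ha₀⟩ := Finset.card_pos.1 (by omega : 0 < A.card)
    obtain ⟨r, a, s, e, ha, hr⟩ := exists_first (P := (· ∈ A))
      (List.mem_reverse.2 (hAL a₀ ha₀)) ha₀
    obtain rfl : L = s.reverse ++ a :: r.reverse := by
      rw [← List.reverse_reverse L, e]; simp
    obtain ⟨b, hb, hne⟩ := Finset.exists_mem_ne (lt_of_lt_of_le one_lt_two h2) a
    have hbs : b ∈ s.reverse := by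
      have := hAL b hb
      rw [List.mem_append, List.mem_cons] at this
      rcases this with h | h | h
      · exact h
      · exact absurd h hne
      · exact absurd hb (hr b (List.mem_reverse.1 h))
    obtain ⟨s₁, q, s₂, e, hq, hs₁⟩ := exists_first (P := (· ∈ A)) hbs hb
    refine ⟨a, ha, ?_⟩
    have hr2 : C ~r a :: ((r.reverse ++ v :: s₁) ++ q :: s₂) := by
      refine hL.trans ?_
      have := isRotated_append (v :: s.reverse) (a :: r.reverse)
      rw [e] at this ⊢
      simpa using this
    rw [interval_eq hC.1 hr2 ?_ hq]
    · simp
    · intro w hw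
      rcases List.mem_append.1 hw with h | h
      · exact hr w (List.mem_reverse.1 h)
      · rcases List.mem_cons.1 h with rfl | h
        · exact hvA
        · exact hs₁ w h

end

section

variable {G : SimpleGraph V} {A H : Finset V} {Cm : Multiset V} {Λ : V → Prop}
variable {C : List V} {v : V}

/-- `C` is a longest cycle. -/
structure Longest (G : SimpleGraph V) (C : List V) : Prop where
  cyc : Cyc G C
  three : 3 ≤ C.length
  le : ∀ C', Cyc G C' → 3 ≤ C'.length → C'.length ≤ C.length

theorem Longest.card_le (hC : Longest G C) {x y : V} {m : Multiset V} (h : HP G x y m)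
    (adj : G.Adj y x) (nd : m.Nodup) (h3 : 3 ≤ m.card) : m.card ≤ C.length := by
  obtain ⟨l, pl, rfl⟩ := h
  exact hC.le l ⟨nd, x, y, pl, adj⟩ h3

theorem Longest.of_card (hC : Longest G C) {x y : V} {l : List V} (h : Pth G l x y)
    (adj : G.Adj y x) (nd : l.Nodup) (h3 : l.length = C.length) : Longest G l :=
  ⟨⟨nd, x, y, h, adj⟩, h3 ▸ hC.three, h3 ▸ hC.le⟩

theorem Base.sparse (S : Base G H A (C : Multiset V)) (hC : Cyc G C) : Sparse A C := by
  intro a ha b hb L hL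
  have hr : C ~r b :: (L ++ [a]) := hL.trans (isRotated_append [a] (b :: L))
  obtain ⟨nd, x, y, p, adj⟩ := hC.rotated hr
  obtain ⟨t, ht⟩ := p.eq_cons
  obtain ⟨rfl, -⟩ := List.cons.inj ht
  have hy : y = a := by
    have h := p.2.2
    rw [← List.cons_append, List.getLast?_concat] at h
    simpa using h.symm
  subst hy
  refine S.full p.hp (Multiset.coe_eq_coe.2 hr.perm.symm) hb ha ?_
  rintro rfl
  simp at nd

variable [Fintype V]

/-- The component of `v` outside `C`. -/
def comp (G : SimpleGraph V) (C : List V) (v : V) : Finset V :=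
  Finset.univ.filter fun u => PathIn G (· ∉ C) v u

/-- The vertices of `C` with a neighbour in the component of `v`. -/
def att (G : SimpleGraph V) (C : List V) (v : V) : Finset V :=
  Finset.univ.filter fun a => a ∈ C ∧ ∃ u ∈ comp G C v, G.Adj u a

theorem mem_comp {u : V} : u ∈ comp G C v ↔ PathIn G (· ∉ C) v u := by
  simp [comp]

theorem mem_att {a : V} : a ∈ att G C v ↔ a ∈ C ∧ ∃ u ∈ comp G C v, G.Adj u a := by
  simp [att]

theorem self_mem_comp (hv : v ∉ C) : v ∈ comp G C v := mem_comp.2 (PathIn.singleton hv)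

theorem not_mem_of_mem_comp {u : V} (h : u ∈ comp G C v) : u ∉ C := (mem_comp.1 h).right

theorem comp_or_att {u w : V} (hu : u ∈ comp G C v) (adj : G.Adj u w) :
    w ∈ comp G C v ∨ w ∈ att G C v := by
  by_cases hw : w ∈ C
  · exact Or.inr (mem_att.2 ⟨hw, u, hu, adj⟩)
  · exact Or.inl (mem_comp.2 (PathIn.cons (P := (· ∉ C)) hw adj.symm (mem_comp.1 hu).symm).symm)

/-- Two vertices of a component are joined inside it. -/
theorem comp_path {u w : V} (hu : u ∈ comp G C v) (hw : w ∈ comp G C v) :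
    ∃ m, HP G u w m ∧ m.Nodup ∧ (∀ x ∈ m, x ∈ comp G C v) ∧ u ∈ m ∧ w ∈ m := by
  obtain ⟨l, pl, nd, hl⟩ := (mem_comp.1 hu).symm.trans (mem_comp.1 hw)
  refine ⟨l, pl.hp, nd, fun x hx => ?_, pl.head_mem, pl.last_mem⟩
  obtain ⟨s, t, rfl⟩ := List.append_of_mem hx
  have h1 : PathIn G (· ∉ C) u x := ⟨s ++ [x], pl.prefix_to, by
      refine List.Nodup.sublist ?_ nd
      simp, fun y hy => hl y (by
      simp only [List.mem_append, List.mem_cons, List.not_mem_nil, or_false] at hy ⊢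
      tauto)⟩
  exact mem_comp.2 ((mem_comp.1 hu).trans h1)

theorem two_le_att (hT : Tough G) (h3 : 3 ≤ C.length) (nd : C.Nodup) (hv : v ∉ C) :
    2 ≤ (att G C v).card := by
  by_contra! hlt
  have hCF : 3 ≤ C.toFinset.card := by rwa [List.toFinset_card_of_nodup nd]
  obtain ⟨x, hxC, hx⟩ : ∃ x ∈ C, att G C v ⊆ {x} := by
    rcases Nat.lt_or_ge 0 (att G C v).card with h | h
    · obtain ⟨x, hx⟩ := Finset.card_eq_one.1 (by omega : (att G C v).card = 1)
      exact ⟨x, (mem_att.1 (hx ▸ Finset.mem_singleton_self x)).1, hx.subset⟩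
    · obtain ⟨x, hx⟩ := Finset.card_pos.1 (by omega : 0 < C.toFinset.card)
      exact ⟨x, List.mem_toFinset.1 hx, by
        rw [Finset.card_eq_zero.1 (by omega : (att G C v).card = 0)]; simp⟩
  obtain ⟨y, hy, hyx⟩ := Finset.exists_mem_ne (by omega : 1 < C.toFinset.card) x
  have hyC := List.mem_toFinset.1 hy
  have step : ∀ u w, w ∉ ({x} : Finset V) → G.Adj u w → u ∈ comp G C v → w ∈ comp G C v :=
    fun u w hw adj hu => (comp_or_att hu adj).resolve_right fun h => hw (hx h)
  refine hT.false_of_colours {x} ⟨x, by simp⟩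
    (fun u => if u ∈ comp G C v then Sum.inr true else Sum.inr false) ?_
    {Sum.inr true, Sum.inr false} ?_ (by simp)
  · intro u w hu hw adj
    have : u ∈ comp G C v ↔ w ∈ comp G C v := ⟨step u w hw adj, step w u hu adj.symm⟩
    simp only [this]
  · intro t ht
    rcases Finset.mem_insert.1 ht with rfl | ht
    · exact ⟨v, by
        rw [Finset.mem_singleton]
        rintro rfl
        exact hv hxC, if_pos (self_mem_comp hv)⟩
    · rw [Finset.mem_singleton.1 ht]
      exact ⟨y, by simpa using hyx, if_neg fun h => not_mem_of_mem_comp h hyC⟩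

theorem disjoint_of_comp {m m' : Multiset V} (nd : m.Nodup) (nd' : m'.Nodup)
    (hm : ∀ x ∈ m, x ∉ comp G C v) (hm' : ∀ x ∈ m', x ∈ comp G C v) : (m + m').Nodup := by
  rw [Multiset.nodup_add]
  refine ⟨nd, nd', ?_⟩
  rw [Multiset.disjoint_left]
  exact fun {x} hx hx' => hm x hx (hm' x hx')

theorem Longest.base (hC : Longest G C) (hT : Tough G) (hv : v ∉ C) :
    Base G (comp G C v) (att G C v) (C : Multiset V) where
  nd := hC.cyc.1
  dj := fun u hu h => not_mem_of_mem_comp h hu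
  AC := fun a ha => (mem_att.1 ha).1
  A2 := two_le_att hT hC.three hC.cyc.1 hv
  Hne := ⟨v, self_mem_comp hv⟩
  HE := fun u hu w adj => comp_or_att hu adj
  L1 := fun x y m h adj nd _ h3 => hC.card_le h adj nd h3
  AA := by
    intro a ha b hb hne m h nd hm
    obtain ⟨-, u, hu, hua⟩ := mem_att.1 ha
    obtain ⟨-, w, hw, hwb⟩ := mem_att.1 hb
    obtain ⟨m', h', nd', hm', hum, -⟩ := comp_path hu hw
    have hc : 0 < m'.card := Multiset.card_pos_iff_exists_mem.2 ⟨u, hum⟩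
    have hc2 : 2 ≤ m.card := by
      obtain ⟨l, pl, rfl⟩ := h
      have h1 : ({a, b} : Finset V).card ≤ l.toFinset.card := by
        apply Finset.card_le_card
        intro x hx
        rw [Finset.mem_insert, Finset.mem_singleton] at hx
        rw [List.mem_toFinset]
        rcases hx with rfl | rfl
        · exact pl.head_mem
        · exact pl.last_mem
      rw [Finset.card_pair hne] at h1
      exact h1.trans (List.toFinset_card_le l)
    have := hC.card_le (h.glue h'.symm hwb.symm) hua (disjoint_of_comp nd nd' hm hm')
      (by rw [Multiset.card_add]; omega)
    rw [Multiset.card_add] at this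
    rw [Multiset.coe_card]
    omega

end

section

variable {G : SimpleGraph V} {A H : Finset V} {Cm : Multiset V} {Λ : V → Prop}
variable {C : List V} {v : V} [Fintype V]

/-- The degree condition on independent triples. -/
def Heavy (G : SimpleGraph V) : Prop :=
  ∀ p q r, p ≠ q → p ≠ r → q ≠ r → ¬ G.Adj p q → ¬ G.Adj p r → ¬ G.Adj q r →
    Fintype.card V ≤ (Finset.univ.filter (G.Adj p)).card
      + (Finset.univ.filter (G.Adj q)).card + (Finset.univ.filter (G.Adj r)).card

theorem Longest.skip_false (hC : Longest G C) {a b u w y : V} {m : Multiset V}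
    (hu : u ∈ comp G C v) (hw : w ∈ comp G C v) (hne : u ≠ w) (hua : G.Adj u a)
    (hwb : G.Adj w b) (h : HP G a b m) (hm : y ::ₘ m = C) : False := by
  obtain ⟨m', h', nd', hm', hum, hwm⟩ := comp_path hu hw
  have h2 : 2 ≤ m'.card := by
    rw [← Finset.card_pair hne, ← Multiset.toFinset_card_of_nodup nd']
    apply Finset.card_le_card
    intro x hx
    rw [Finset.mem_insert, Finset.mem_singleton] at hx
    rw [Multiset.mem_toFinset]
    rcases hx with rfl | rfl <;> assumption
  have nd : (m : Multiset V).Nodup := (Multiset.nodup_cons.1 (hm ▸ hC.cyc.1 :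
    (y ::ₘ m).Nodup)).2
  have hcard : m.card + 1 = C.length := by
    rw [← Multiset.card_cons, hm, Multiset.coe_card]
  have h3 := hC.three
  have := hC.card_le (h.glue h'.symm hwb.symm) hua (disjoint_of_comp nd nd' (fun x hx hxc =>
    not_mem_of_mem_comp hxc (by
      rw [← Multiset.mem_coe, ← hm]; exact Multiset.mem_cons_of_mem hx)) hm')
    (by rw [Multiset.card_add]; omega)
  rw [Multiset.card_add] at this
  omega

theorem not_adj_of_comp {u x : V} (hu : u ∈ comp G C v) (hx : x ∈ C) (hxA : x ∉ att G C v) :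
    ¬ G.Adj u x := fun adj =>
  (comp_or_att hu adj).elim (fun h => not_mem_of_mem_comp h hx) hxA

/-- The components outside a longest cycle are single vertices. -/
theorem Longest.comp_card (hC : Longest G C) (hT : Tough G) (hσ : Heavy G) (hv : v ∉ C) :
    (comp G C v).card ≤ 1 := by
  by_contra! h2
  have S := hC.base hT hv
  have hs := S.sparse hC.cyc
  have hAC : ∀ a ∈ att G C v, a ∈ C := fun a ha => (mem_att.1 ha).1
  by_cases hgood : ∀ a ∈ att G C v, ∀ b ∈ att G C v, a ≠ b → ∃ u ∈ comp G C v,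
      ∃ w ∈ comp G C v, u ≠ w ∧ G.Adj u a ∧ G.Adj w b
  · refine (hC.cyc.dec hAC hs S.A2).contradiction
      (Λ := fun _ => False) (H := comp G C v) ⟨S, ?_, fun _ _ _ _ h => h, ?_⟩ hT
    · intro a ha b hb hne m y hm e
      obtain ⟨u, hu, w, hw, huw, hua, hwb⟩ := hgood a ha b hb hne
      exact hC.skip_false hu hw huw hua hwb hm e
    · intro p q hp hq hpH hqH hpq hadj
      have hup : ∀ x, x ∉ att G C v → x ∉ comp G C v → v ≠ x ∧ ¬ G.Adj v x := by
        intro x hxA hxH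
        refine ⟨?_, fun adj => ?_⟩
        · rintro rfl
          exact hxH (self_mem_comp hv)
        · exact (comp_or_att (self_mem_comp hv) adj).elim hxH hxA
      have h1 := hσ v p q (hup p hp hpH).1 (hup q hq hqH).1 hpq (hup p hp hpH).2
        (hup q hq hqH).2 hadj
      have hd : (Finset.univ.filter (G.Adj v)).card + 1 ≤
          (att G C v).card + (comp G C v).card := by
        have : Finset.univ.filter (G.Adj v) ⊆ att G C v ∪ (comp G C v).erase v := by
          intro x hx
          have hx := (Finset.mem_filter.1 hx).2
          rcases comp_or_att (self_mem_comp hv) hx with h | h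
          · exact Finset.mem_union_right _ (Finset.mem_erase.2 ⟨hx.ne', h⟩)
          · exact Finset.mem_union_left _ h
        have := (Finset.card_le_card this).trans (Finset.card_union_le _ _)
        rw [Finset.card_erase_of_mem (self_mem_comp hv)] at this
        omega
      omega
  · push Not at hgood
    obtain ⟨a, ha, b, hb, hne, hab⟩ := hgood
    obtain ⟨-, w, hw, hwa⟩ := mem_att.1 ha
    obtain ⟨-, w', hw', hwb⟩ := mem_att.1 hb
    set W := (att G C v).filter fun a => ∀ u ∈ comp G C v, G.Adj u a → u = w with hW
    have haW : a ∈ W := by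
      refine Finset.mem_filter.2 ⟨ha, fun u hu hua => ?_⟩
      by_contra h
      have h1 : w = w' := by
        by_contra h'
        exact hab w hw w' hw' h' hwa hwb
      exact hab u hu w' hw' (h1 ▸ h) hua hwb
    have hbW : b ∈ W := by
      refine Finset.mem_filter.2 ⟨hb, fun u hu hua => ?_⟩
      by_contra h
      exact hab w hw u hu (Ne.symm h) hwa hua
    have hbw : G.Adj w b := (Finset.mem_filter.1 hbW).2 w' hw' hwb ▸ hwb
    obtain ⟨K, -, -, -, -, hg2, hg1, -⟩ := exists_conf hC.cyc hAC hs ha hb hne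
    have hnx : ∀ l ∈ att G C v \ W, ∃ x, [l, x] <:+: K.B1 ∨ [l, x] <:+: K.B2 := by
      intro l hl
      obtain ⟨hlA, hlW⟩ := Finset.mem_sdiff.1 hl
      rcases K.mem_iff.1 (Multiset.mem_coe.2 (hAC l hlA)) with h | h | h | h
      · exact absurd hlA (K.sA l h)
      · obtain ⟨x, hx⟩ := exists_next K.pB1 h (by rintro rfl; exact hlW (hg1 ▸ hbW))
        exact ⟨x, Or.inl hx⟩
      · exact absurd hlA (K.tA l h)
      · obtain ⟨x, hx⟩ := exists_next K.pB2 h (by rintro rfl; exact hlW (hg2 ▸ haW))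
        exact ⟨x, Or.inr hx⟩
    choose! nx hnx using hnx
    have hinj : Set.InjOn nx (att G C v \ W : Finset V) := by
      intro l hl l' hl' e
      have key : ∀ l ∈ att G C v \ W, [l, nx l] <:+: K.Is ++ K.B1 ++ K.It ++ K.B2 := by
        intro l hl
        rcases hnx l hl with h | h
        · exact infix_append_left (infix_append_left (infix_append_right h))
        · exact infix_append_right h
      have h1 := key l hl
      rw [e] at h1
      exact prev_unique (K.nodup S) h1 (key l' hl')
    have hcount := (K.duo K.xo K.swap.xo).card_add S (K.sA _ K.pIs.head_mem)
      (K.tA _ K.pIt.head_mem) ((att G C v \ W).image nx) (by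
        intro x hx
        obtain ⟨l, hl, rfl⟩ := Finset.mem_image.1 hx
        obtain ⟨hlA, hlW⟩ := Finset.mem_sdiff.1 hl
        obtain ⟨u, hu, hul, huw⟩ : ∃ u ∈ comp G C v, G.Adj u l ∧ u ≠ w := by
          by_contra! h
          exact hlW (Finset.mem_filter.2 ⟨hlA, h⟩)
        rcases hnx l hl with h | h
        · refine ⟨S.dj _ (K.mem_iff.2 (Or.inr (Or.inl (snd_mem h)))), ?_⟩
          exact K.miss_of_skip S K.xo K.swap.xo hlA h fun m hm e =>
            hC.skip_false hu hw huw hul (hg2 ▸ hwa) hm e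
        · refine ⟨S.dj _ (K.mem_iff.2 (Or.inr (Or.inr (Or.inr (snd_mem h))))), ?_⟩
          exact (K.swap.miss_of_skip S K.swap.xo K.xo hlA h fun m hm e =>
            hC.skip_false hu hw huw hul (hg1.symm ▸ hbw : G.Adj w K.g1) hm e).symm)
    rw [Finset.card_image_of_injOn hinj] at hcount
    change _ + (Finset.univ.filter (G.Adj K.xt)).card + _ + _ ≤ _ at hcount
    obtain ⟨u, hu, huw⟩ := Finset.exists_mem_ne h2 w
    have hxsC : K.xs ∈ C := Multiset.mem_coe.1 (K.mem_iff.2 (Or.inl K.pIs.head_mem))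
    have hxtC : K.xt ∈ C :=
      Multiset.mem_coe.1 (K.mem_iff.2 (Or.inr (Or.inr (Or.inl K.pIt.head_mem))))
    have huC := not_mem_of_mem_comp hu
    have hst : K.xs ≠ K.xt := (K.duo K.xo K.swap.xo).disj S
      (List.mem_append_left _ K.pIs.head_mem) (List.mem_append_left _ K.pIt.head_mem)
    have h1 := hσ u K.xs K.xt (fun e => huC (e ▸ hxsC)) (fun e => huC (e ▸ hxtC)) hst
      (not_adj_of_comp hu hxsC (K.sA _ K.pIs.head_mem))
      (not_adj_of_comp hu hxtC (K.tA _ K.pIt.head_mem)) ((K.duo K.xo K.swap.xo).not_adj S)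
    have hd : Finset.univ.filter (G.Adj u) ⊆ (att G C v \ W) ∪ (comp G C v).erase u := by
      intro x hx
      have hx := (Finset.mem_filter.1 hx).2
      rcases comp_or_att hu hx with h | h
      · exact Finset.mem_union_right _ (Finset.mem_erase.2 ⟨hx.ne', h⟩)
      · refine Finset.mem_union_left _ (Finset.mem_sdiff.2 ⟨h, fun hxW => ?_⟩)
        exact huw ((Finset.mem_filter.1 hxW).2 u hu hx)
    have := (Finset.card_le_card hd).trans (Finset.card_union_le _ _)
    rw [Finset.card_erase_of_mem hu] at this
    omega

end

section

variable {G : SimpleGraph V} {A H : Finset V} {Cm : Multiset V} {Λ : V → Prop}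
variable {C : List V} {v : V}

theorem rotated_of_infix {a : V} {L m : List V} (h : m <:+: a :: (L ++ [a]))
    (hlen : m.length ≤ L.length + 1) : ∃ r, (a :: L) ~r m ++ r := by
  obtain ⟨s, t, e⟩ := h
  rcases List.eq_nil_or_concat t with rfl | ⟨t', z, rfl⟩
  · rw [List.append_nil] at e
    cases s with
    | nil =>
      have := congrArg List.length e
      simp at this
      omega
    | cons b s =>
      obtain ⟨rfl, e⟩ := List.cons.inj e
      refine ⟨s, List.IsRotated.trans (isRotated_append [b] L) ?_⟩
      rw [← e]
      exact isRotated_append _ _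
  · rw [List.concat_eq_append, ← List.append_assoc, ← List.cons_append] at e
    obtain ⟨e, -⟩ := List.append_inj' e rfl
    refine ⟨t' ++ s, ?_⟩
    rw [← e, List.append_assoc, ← List.append_assoc m]
    exact isRotated_append _ _

theorem two_mul_countP_le (P : V → Prop) (L : List V)
    (h : ∀ z w, [z, w] <:+: L → P z → ¬ P w) : 2 * L.countP P ≤ L.length + 1 := by
  have h1 := countP_tail_add_le P P (fun _ => False) L h (fun _ _ h => h.elim)
    (fun _ _ _ h => h.elim)
  cases L with
  | nil => simp
  | cons a L =>
    have : (a :: L).countP P ≤ L.countP P + 1 := by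
      rw [List.countP_cons]
      split <;> omega
    rw [List.tail_cons] at h1
    omega

theorem three_mul_countP_le (P : V → Prop) : ∀ L : List V,
    (∀ z w, [z, w] <:+: L → P z → ¬ P w) → (∀ z y w, [z, y, w] <:+: L → P z → ¬ P w) →
    3 * L.countP P ≤ L.length + 2
  | [], _, _ => by simp
  | [a], _, _ => by
    rw [List.countP_cons]
    split <;> simp
  | [a, b], h, _ => by
    have := h a b (List.infix_refl _)
    by_cases ha : P a <;> by_cases hb : P b <;> simp_all
  | a :: b :: c :: L, h, h' => by
    by_cases ha : P a
    · have hb : ¬ P b := h a b ⟨[], c :: L, rfl⟩ ha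
      have hc : ¬ P c := h' a b c ⟨[], L, rfl⟩ ha
      have := three_mul_countP_le P L (fun z w hz => h z w (hz.trans ⟨[a, b, c], [], by simp⟩))
        (fun z y w hz => h' z y w (hz.trans ⟨[a, b, c], [], by simp⟩))
      simp only [List.countP_cons, ha, hb, hc, decide_true, decide_false, if_true,
        List.length_cons, Bool.false_eq_true, if_false]
      omega
    · have := three_mul_countP_le P (b :: c :: L)
        (fun z w hz => h z w (hz.trans ⟨[a], [], by simp⟩))
        (fun z y w hz => h' z y w (hz.trans ⟨[a], [], by simp⟩))
      rw [List.countP_cons_of_neg (by simpa using ha)]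
      simp only [List.length_cons] at this ⊢
      omega

theorem Longest.rotated {C' : List V} (hC : Longest G C) (h : C ~r C') : Longest G C' :=
  ⟨hC.cyc.rotated h, h.perm.length_eq ▸ hC.three, h.perm.length_eq ▸ hC.le⟩

theorem Longest.replace (hC : Longest G C) {a x b : V} {L : List V} (hL : C = a :: x :: b :: L)
    (hv : v ∉ C) (ha : G.Adj v a) (hb : G.Adj v b) : Longest G (a :: v :: b :: L) := by
  subst hL
  obtain ⟨nd, p, q, hp, adj⟩ := hC.cyc
  obtain ⟨t, ht⟩ := hp.eq_cons
  obtain ⟨rfl, rfl⟩ := List.cons.inj ht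
  have hb' : Pth G (b :: L) b q := (hp.cut (l := [a])).2.1
  refine hC.of_card ((pth_singleton a).append ((pth_singleton v).append hb' hb) ha.symm) adj
    ?_ (by simp)
  simp only [List.nodup_cons, List.mem_cons, not_or] at nd hv ⊢
  exact ⟨⟨fun h => hv.1 h.symm, nd.1.2⟩, hv.2.2, nd.2.2⟩

theorem Longest.cross_false (hC : Longest G C) {a x b : V} {L : List V}
    (hL : C = a :: x :: b :: L) (hv : v ∉ C) {p q : V} (hpa : G.Adj p a) (hqb : G.Adj q b)
    (hpq : [p, q].Perm [v, x]) {z w : V} (hz : [z, w] <:+: b :: (L ++ [a])) (hzp : G.Adj z p)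
    (hwq : G.Adj w q) : False := by
  subst hL
  obtain ⟨nd, y, y', hp, adj⟩ := hC.cyc
  obtain ⟨t, ht⟩ := hp.eq_cons
  obtain ⟨rfl, rfl⟩ := List.cons.inj ht
  have hb' : Pth G (b :: L) b y' := (hp.cut (l := [a])).2.1
  have hM : Pth G (b :: (L ++ [a])) b a := hb'.append (pth_singleton a) adj
  obtain ⟨m, m', h1, h2, hm⟩ := hM.cut_infix hz
  have hperm : ({p, q} : Multiset V) = {v, x} := Multiset.coe_eq_coe.2 hpq
  have e : m + {p} + m' + {q} = v ::ₘ ((a :: x :: b :: L : List V) : Multiset V) := by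
    have h3 : m + {p} + m' + {q} = (m + m') + {p, q} := by
      rw [Multiset.insert_eq_cons, ← Multiset.singleton_add]; abel
    rw [h3, hm, hperm]
    have : ((b :: (L ++ [a]) : List V) : Multiset V) = ↑(a :: b :: L) :=
      Multiset.coe_eq_coe.2 (isRotated_append (b :: L) [a]).perm
    rw [this]
    simp only [← Multiset.cons_coe, Multiset.insert_eq_cons, ← Multiset.singleton_add]
    abel
  have := hC.card_le (((h1.glue (hp_singleton p) hzp).glue h2.symm hpa).glue
    (hp_singleton q) hwq) hqb (e ▸ Multiset.nodup_cons.2 ⟨by simpa using hv, by simpa using nd⟩)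
    (by rw [e]; simp)
  rw [e] at this
  simp at this

variable [Fintype V]

/-- The neighbours of a vertex. -/
abbrev nb (G : SimpleGraph V) (v : V) : Finset V := Finset.univ.filter (G.Adj v)

theorem mem_nb {v u : V} : u ∈ nb G v ↔ G.Adj v u := by simp

/-- A counterexample to the bound `min (card V) (2 * t)` on the circumference. -/
structure Counter (G : SimpleGraph V) (t : ℕ) : Prop where
  tough : Tough G
  heavy : Heavy G
  spare : ∀ C, Longest G C → C.length < Fintype.card V
  small : ∀ C, Longest G C → C.length < 2 * t
  nc : ∀ x y, x ≠ y → ¬ G.Adj x y → (∃ z, G.Adj x z ∧ G.Adj y z) →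
    t ≤ (Finset.univ.filter fun u => G.Adj x u ∨ G.Adj y u).card

variable {t : ℕ}

theorem Counter.base (X : Counter G t) (hC : Longest G C) (hv : v ∉ C) :
    Base G {v} (nb G v) (C : Multiset V) := by
  have S := hC.base X.tough hv
  have hcomp : comp G C v = {v} := by
    have h := hC.comp_card X.tough X.heavy hv
    exact (Finset.eq_of_subset_of_card_le (Finset.singleton_subset_iff.2 (self_mem_comp hv))
      (by simpa using h)).symm
  have hatt : att G C v = nb G v := by
    ext a
    rw [mem_att, mem_nb, hcomp]
    constructor
    · rintro ⟨-, u, hu, hua⟩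
      rwa [Finset.mem_singleton.1 hu] at hua
    · intro h
      refine ⟨?_, v, by simp, h⟩
      rcases comp_or_att (self_mem_comp hv) h with h' | h'
      · rw [hcomp, Finset.mem_singleton] at h'
        exact absurd h' h.ne'
      · exact (mem_att.1 h').1
  rwa [hcomp, hatt] at S

theorem Counter.nb_mem (X : Counter G t) (hC : Longest G C) (hv : v ∉ C) {a : V}
    (h : G.Adj v a) : a ∈ C :=
  Multiset.mem_coe.1 ((X.base hC hv).AC a (mem_nb.2 h))

theorem Counter.sparse (X : Counter G t) (hC : Longest G C) (hv : v ∉ C) {a b : V}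
    {L : List V} (h : C ~r a :: b :: L) (ha : G.Adj v a) : ¬ G.Adj v b := fun hb =>
  (X.base hC hv).sparse hC.cyc a (mem_nb.2 ha) b (mem_nb.2 hb) L h

/-- Neighbours of `v` are at distance at least three on the cycle. -/
theorem Counter.no_gap_two (X : Counter G t) (hC : Longest G C) (hv : v ∉ C) {a x b : V}
    {L : List V} (hL : C ~r a :: x :: b :: L) (ha : G.Adj v a) : ¬ G.Adj v b := by
  intro hb
  set D := a :: x :: b :: L with hD
  have hCD := hC.rotated hL
  have hvD : v ∉ D := fun h => hv (hL.mem_iff.2 h)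
  have hD' := hCD.replace hD hvD ha hb
  have nd := hCD.cyc.1
  have hxa : G.Adj x a := by
    obtain ⟨-, y, y', hp, -⟩ := hCD.cyc
    exact (hp.cut (l := [])).2.2.symm
  have hxb : G.Adj x b := by
    obtain ⟨-, y, y', hp, -⟩ := hCD.cyc
    exact (hp.cut (l := [a])).2.2
  have hvx : v ≠ x := by rintro rfl; exact hvD (by simp [hD])
  have hxD' : x ∉ a :: v :: b :: L := by
    simp only [hD, List.nodup_cons, List.mem_cons, not_or] at nd ⊢
    exact ⟨fun h => nd.1.1 h.symm, hvx.symm, nd.2.1.1, nd.2.1.2⟩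
  have hadj : ¬ G.Adj v x := X.sparse hCD hvD (List.IsRotated.refl _) ha
  have ht := X.nc v x hvx hadj ⟨a, ha, hxa⟩
  have hrot : ∀ y : V, a :: y :: b :: L ~r y :: (b :: (L ++ [a])) := fun y =>
    isRotated_append [a] (y :: b :: L)
  have hrot' : ∀ y z w : V, [z, w] <:+: b :: (L ++ [a]) → ∃ r, a :: y :: b :: L ~r z :: w :: r := by
    rintro y z w ⟨s, r, e⟩
    refine ⟨r ++ (y :: s), (hrot y).trans ?_⟩
    rw [← e]
    have := isRotated_append (y :: s) (z :: w :: r)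
    simpa using this
  have hcount := two_mul_countP_le (fun u => G.Adj v u ∨ G.Adj x u) (b :: (L ++ [a])) (by
    intro z w hz h1 h2
    obtain ⟨r, hr⟩ := hrot' x z w hz
    obtain ⟨r', hr'⟩ := hrot' v z w hz
    rcases h1 with h1 | h1 <;> rcases h2 with h2 | h2
    · exact X.sparse hCD hvD hr h1 h2
    · exact hCD.cross_false hD hvD ha hxb (List.Perm.refl _) hz h1.symm h2.symm
    · exact hCD.cross_false hD hvD hxa hb (List.Perm.swap _ _ _) hz h1.symm h2.symm
    · exact X.sparse hD' hxD' hr' h1 h2)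
  have hsub : (Finset.univ.filter fun u => G.Adj v u ∨ G.Adj x u) ⊆
      ((b :: (L ++ [a])).filter fun u => G.Adj v u ∨ G.Adj x u).toFinset := by
    intro u hu
    have hu := (Finset.mem_filter.1 hu).2
    rw [List.mem_toFinset, List.mem_filter, decide_eq_true_eq]
    refine ⟨?_, hu⟩
    rcases hu with h | h
    · have h1 := (hrot x).mem_iff.1 (X.nb_mem hCD hvD h)
      rcases List.mem_cons.1 h1 with rfl | h1
      · exact absurd h hadj
      · exact h1
    · have h1 := (hrot v).mem_iff.1 (X.nb_mem hD' hxD' h)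
      rcases List.mem_cons.1 h1 with rfl | h1
      · exact absurd h.symm hadj
      · exact h1
  have h4 := (Finset.card_le_card hsub).trans (List.toFinset_card_le _)
  rw [← List.countP_eq_length_filter] at h4
  have hcount' : 2 * (b :: (L ++ [a])).countP (fun u => G.Adj v u ∨ G.Adj x u) ≤
      (b :: (L ++ [a])).length + 1 := by convert hcount
  have h5 := X.small D hCD
  simp only [hD, List.length_cons, List.length_append, List.length_nil] at h5 hcount'
  omega

/-- A vertex missed by some longest cycle. -/
def Light (G : SimpleGraph V) (z : V) : Prop := ∃ C, Longest G C ∧ z ∉ C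

theorem Counter.light_card (X : Counter G t) (hC : Longest G C) {C' : List V}
    (hC' : Longest G C') (hv : v ∉ C') : 3 * (nb G v).card ≤ C.length := by
  have hle : C'.length ≤ C.length := hC.le _ hC'.cyc hC'.three
  have S := X.base hC' hv
  obtain ⟨a, ha⟩ := Finset.card_pos.1 (by have := S.A2; omega : 0 < (nb G v).card)
  have hav := mem_nb.1 ha
  obtain ⟨L, hL⟩ := exists_isRotated_cons (X.nb_mem hC' hv hav)
  have hlen : C'.length = L.length + 1 := by rw [hL.perm.length_eq, List.length_cons]
  have h3 := hC'.three
  have hcount := three_mul_countP_le (G.Adj v) (a :: (L ++ [a])) (by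
    intro z w hz h1
    obtain ⟨r, hr⟩ := rotated_of_infix hz (by simp; omega)
    exact X.sparse hC' hv (hL.trans hr) h1) (by
    intro z y w hz h1
    obtain ⟨r, hr⟩ := rotated_of_infix hz (by simp; omega)
    exact X.no_gap_two hC' hv (hL.trans hr) h1)
  have hsub : nb G v ⊆ ((a :: L).filter (G.Adj v)).toFinset := by
    intro u hu
    rw [List.mem_toFinset, List.mem_filter, decide_eq_true_eq]
    exact ⟨hL.mem_iff.1 (X.nb_mem hC' hv (mem_nb.1 hu)), mem_nb.1 hu⟩
  have h4 := (Finset.card_le_card hsub).trans (List.toFinset_card_le _)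
  rw [← List.countP_eq_length_filter] at h4
  rw [← List.cons_append, List.countP_append, List.countP_singleton] at hcount
  simp only [hav, decide_true, if_true, List.length_append, List.length_cons,
    List.length_nil] at hcount
  omega

/-- There are no three independent light vertices. -/
theorem Counter.light_false (X : Counter G t) {p q r : V} (hp : Light G p) (hq : Light G q)
    (hr : Light G r) (hpq : p ≠ q) (hpr : p ≠ r) (hqr : q ≠ r) (npq : ¬ G.Adj p q)
    (npr : ¬ G.Adj p r) (nqr : ¬ G.Adj q r) : False := by
  obtain ⟨C, hC, hpC⟩ := hp
  obtain ⟨C', hC', hqC'⟩ := hq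
  obtain ⟨C'', hC'', hrC''⟩ := hr
  have h1 := X.light_card hC hC hpC
  have h2 := X.light_card hC hC' hqC'
  have h3 := X.light_card hC hC'' hrC''
  have h4 : Fintype.card V ≤ (nb G p).card + (nb G q).card + (nb G r).card :=
    X.heavy p q r hpq hpr hqr npq npr nqr
  have h5 := X.spare C hC
  omega

end

section

variable {G : SimpleGraph V} {A H : Finset V} {Cm : Multiset V} {Λ : V → Prop}
variable {C : List V} {v : V}

theorem isRotated_of_infix {L m : List V} (h : m <:+: L) : ∃ r, L ~r m ++ r := by
  obtain ⟨s, r, rfl⟩ := h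
  exact ⟨r ++ s, by rw [List.append_assoc, ← List.append_assoc m]; exact isRotated_append _ _⟩

theorem Longest.light_of_skip (hC : Longest G C) (hv : v ∉ C) {a b y : V}
    {m : Multiset V} (ha : G.Adj v a) (hb : G.Adj v b) (h : HP G a b m) (hm : y ::ₘ m = C) :
    Light G y := by
  have nd := Multiset.coe_nodup.2 hC.cyc.1
  rw [← hm] at nd
  obtain ⟨hy, ndm⟩ := Multiset.nodup_cons.1 nd
  have hvm : v ∉ m := fun h => hv (Multiset.mem_coe.1 (hm ▸ Multiset.mem_cons_of_mem h))
  have hcard : m.card + 1 = C.length := by rw [← Multiset.card_cons, hm, Multiset.coe_card]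
  obtain ⟨l, hl, rfl⟩ := h
  refine ⟨v :: l, hC.of_card ((pth_singleton v).append hl ha) hb.symm ?_ ?_, ?_⟩
  · exact List.nodup_cons.2 ⟨by simpa using hvm, by simpa using ndm⟩
  · simpa using hcard
  · rw [List.mem_cons, not_or]
    refine ⟨?_, by simpa using hy⟩
    rintro rfl
    exact hv (Multiset.mem_coe.1 (hm ▸ Multiset.mem_cons_self _ _))

variable [Fintype V] {t : ℕ}

theorem Counter.exists_light (X : Counter G t) (hC : Longest G C) (hv : v ∉ C) :
    ∃ (K : Conf G (nb G v) (C : Multiset V)) (O : List V) (p : V), XO K O p ∧ Light G p := by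
  by_contra! hno
  have S := X.base hC hv
  refine (hC.cyc.dec (fun a ha => X.nb_mem hC hv (mem_nb.1 ha)) (S.sparse hC.cyc)
    S.A2).contradiction (Λ := Light G) (H := {v}) ⟨S, ?_, hno, ?_⟩ X.tough
  · intro a ha b hb _ m y h hm
    exact hC.light_of_skip hv (mem_nb.1 ha) (mem_nb.1 hb) h hm
  · intro p q hp hq hpv hqv hpq hadj
    rw [mem_nb] at hp hq
    rw [Finset.mem_singleton] at hpv hqv
    have : _ ≤ (nb G v).card + (nb G p).card + (nb G q).card := X.heavy v p q (Ne.symm hpv) (Ne.symm hqv) hpq hp hq hadj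
    rw [Finset.card_singleton]
    change _ ≤ (nb G p).card + (nb G q).card + (nb G v).card + 1
    omega

/-- The partner of a light exchange vertex. -/
theorem Counter.partner (X : Counter G t) (hC : Longest G C) (hv : v ∉ C)
    {K : Conf G (nb G v) (C : Multiset V)} {O Q : List V} {y q : V} (hO : XO K O y)
    (hQ : XO K.swap Q q) (hy : Light G y) : ¬ Light G q ∧
    Fintype.card V ≤ (nb G v).card + (nb G y).card + (nb G q).card := by
  have S := X.base hC hv
  have hyI := hO.head_mem
  have hqI : q ∈ K.It := hQ.head_mem
  have hvC : ∀ u, u ∈ (C : Multiset V) → v ≠ u := by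
    rintro u hu rfl
    exact hv (Multiset.mem_coe.1 hu)
  have h1 : v ≠ y := hvC _ (K.mem_iff.2 (Or.inl hyI))
  have h2 : v ≠ q := hvC _ (K.mem_iff.2 (Or.inr (Or.inr (Or.inl hqI))))
  have h3 : y ≠ q := (K.duo hO hQ).disj S (List.mem_append_left _ (hO.mem.2 hyI))
    (List.mem_append_left _ (hQ.mem.2 hqI))
  have n1 : ¬ G.Adj v y := fun h => K.sA _ hyI (mem_nb.2 h)
  have n2 : ¬ G.Adj v q := fun h => K.tA _ hqI (mem_nb.2 h)
  have n3 := (K.duo hO hQ).not_adj S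
  exact ⟨fun hq => X.light_false ⟨C, hC, hv⟩ hy hq h1 h2 h3 n1 n2 n3,
    X.heavy v y q h1 h2 h3 n1 n2 n3⟩

/-- The case of two attachments. -/
theorem Counter.two_false (X : Counter G t) (hC : Longest G C) (hv : v ∉ C)
    (hmax : ∀ z, Light G z → (nb G z).card ≤ (nb G v).card) (h2 : (nb G v).card = 2)
    {K : Conf G (nb G v) (C : Multiset V)} {O : List V} {y : V} (hO : XO K O y)
    (hy : Light G y) : False := by
  have S := X.base hC hv
  have D := K.duo K.xo K.swap.xo
  have hyI := hO.head_mem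
  have hvC : ∀ u, u ∈ (C : Multiset V) → v ≠ u := by
    rintro u hu rfl
    exact hv (Multiset.mem_coe.1 hu)
  have hdisj : ∀ {u w}, (u ∈ K.Is ∨ u ∈ K.B1) → (w ∈ K.It ∨ w ∈ K.B2) → u ≠ w := fun hu hw =>
    D.disj S (List.mem_append.2 hu) (List.mem_append.2 hw)
  have hsC : ∀ {u}, u ∈ K.Is → v ≠ u := fun hu => hvC _ (K.mem_iff.2 (Or.inl hu))
  have htC : ∀ {u}, u ∈ K.It → v ≠ u := fun hu =>
    hvC _ (K.mem_iff.2 (Or.inr (Or.inr (Or.inl hu))))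
  have hg : K.g1 ≠ K.g2 := K.g_ne S
  have hA : ∀ u ∈ nb G v, u = K.g1 ∨ u = K.g2 := by
    have h : {K.g1, K.g2} = nb G v := by
      refine Finset.eq_of_subset_of_card_le ?_ (by rw [Finset.card_pair hg, h2])
      intro u hu
      rw [Finset.mem_insert, Finset.mem_singleton] at hu
      rcases hu with rfl | rfl
      · exact K.g1A
      · exact K.g2A
    intro u hu
    rwa [← h, Finset.mem_insert, Finset.mem_singleton] at hu
  have hf1 : K.f1 = K.g1 := by
    exact (hA _ K.f1A).resolve_right (hdisj (Or.inr K.pB1.head_mem) (Or.inr K.pB2.last_mem))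
  have hf2 : K.f2 = K.g2 := by
    exact (hA _ K.f2A).resolve_left (hdisj (Or.inr K.pB1.last_mem) (Or.inr K.pB2.head_mem)).symm
  have hc := X.light_card hC hC hv
  have ht := X.small C hC
  have hdy := hmax y hy
  have hcom : ∀ z, G.Adj v z → ¬ G.Adj y z := by
    intro z hvz hyz
    have h := X.nc v y (hsC hyI) (fun h => K.sA _ hyI (mem_nb.2 h)) ⟨z, hvz, hyz⟩
    rw [Finset.filter_or] at h
    have h' := Finset.card_union_add_card_inter (nb G v) (nb G y)
    have : 0 < (nb G v ∩ nb G y).card :=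
      Finset.card_pos.2 ⟨z, Finset.mem_inter.2 ⟨mem_nb.2 hvz, mem_nb.2 hyz⟩⟩
    change t ≤ (nb G v ∪ nb G y).card at h
    omega
  have hAv : ∀ {u}, u ∈ nb G v → G.Adj v u := fun h => mem_nb.1 h
  have hyx : y ≠ K.xs := by
    rintro e
    exact hcom _ (hAv K.g2A) (e ▸ K.e4.symm)
  have hxI : K.xs ∈ K.Is := K.pIs.head_mem
  have key : ∀ Q q, XO K.swap Q q → ∀ u, u ≠ q → u ≠ v → u ≠ y → u ≠ K.xs → G.Adj q u := by
    intro Q q hQ u huq huv huy hux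
    have hqI : q ∈ K.It := hQ.head_mem
    have hd := (X.partner hC hv hO hQ hy).2
    by_contra hadj
    have hsub : nb G q ⊆ Finset.univ \ {u, q, v, y, K.xs} := by
      intro z hz
      have hz := mem_nb.1 hz
      rw [Finset.mem_sdiff]
      refine ⟨Finset.mem_univ _, ?_⟩
      simp only [Finset.mem_insert, Finset.mem_singleton, not_or]
      refine ⟨?_, hz.ne', ?_, ?_, ?_⟩
      · rintro rfl
        exact hadj hz
      · rintro rfl
        exact K.tA _ hqI (mem_nb.2 hz.symm)
      · rintro rfl
        exact (K.duo hO hQ).not_adj S hz.symm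
      · rintro rfl
        exact (K.duo K.xo hQ).not_adj S hz.symm
    have h5 := Finset.card_le_card hsub
    have hq : ∀ w ∈ K.Is, q ≠ w := fun w hw => (hdisj (Or.inl hw) (Or.inl hqI)).symm
    rw [Finset.card_sdiff_of_subset (Finset.subset_univ _), Finset.card_univ,
      Finset.card_insert_of_notMem, Finset.card_insert_of_notMem, Finset.card_insert_of_notMem,
      Finset.card_pair hyx] at h5
    · have : 0 < (nb G q).card := by
        obtain ⟨z, hz⟩ : ∃ z, G.Adj q z := by
          by_contra! hno
          obtain ⟨e, p, -, h⟩ := hQ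
          obtain ⟨s, hs⟩ := p.eq_cons
          rcases s with _ | ⟨w, s⟩
          · rw [hs] at p
            have : e = q := by simpa using p.2.2.symm
            exact hno _ (this ▸ h)
          · rw [hs] at p
            exact hno w (p.cut (l := [])).2.2
        exact Finset.card_pos.2 ⟨z, mem_nb.2 hz⟩
      omega
    · simp only [Finset.mem_insert, Finset.mem_singleton, not_or]
      exact ⟨hsC hyI, hsC hxI⟩
    · simp only [Finset.mem_insert, Finset.mem_singleton, not_or]
      exact ⟨(htC hqI).symm, hq _ hyI, hq _ hxI⟩
    · simp only [Finset.mem_insert, Finset.mem_singleton, not_or]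
      exact ⟨huq, huv, huy, hux⟩
  have hAs : ∀ {u w}, u ∈ nb G v → w ∈ K.Is → u ≠ w := by
    rintro u w hu hw rfl
    exact K.sA _ hw hu
  have hAt : ∀ {u w}, u ∈ nb G v → w ∈ K.It → u ≠ w := by
    rintro u w hu hw rfl
    exact K.tA _ hw hu
  have hxf : G.Adj K.xt K.f2 := key _ _ K.swap.xo _ (hAt K.f2A K.pIt.head_mem)
    (hAv K.f2A).ne' (hAs K.f2A hyI) (hAs K.f2A hxI)
  have hQ : XO K.swap K.It.reverse K.yt :=
    ⟨K.xt, K.pIt.reverse, Multiset.coe_reverse _, hxf⟩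
  have hyf : G.Adj K.yt K.f1 := key _ _ hQ _ (hAt K.f1A K.pIt.last_mem)
    (hAv K.f1A).ne' (hAs K.f1A hyI) (hAs K.f1A hxI)
  have hxy : G.Adj K.xt K.ys := by
    refine key _ _ K.swap.xo _ (hdisj (Or.inl K.pIs.last_mem) (Or.inl K.pIt.head_mem))
      (hsC K.pIs.last_mem).symm ?_ ?_
    · intro e
      exact hcom _ (hAv K.f1A) (e ▸ K.e1)
    · intro e
      have nd : K.Is.Nodup := by
        have := K.nodup S
        rw [List.append_assoc, List.append_assoc] at this
        exact this.of_append_left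
      obtain ⟨s, hs⟩ := K.pIs.eq_cons
      rcases List.eq_nil_or_concat s with rfl | ⟨s', z, rfl⟩
      · rw [hs] at hyI
        exact hyx (by simpa using hyI)
      · have h3 := K.pIs.2.2
        rw [hs] at h3 nd
        have : z = K.ys := by simpa [List.getLast?_cons] using h3
        rw [this, e] at nd
        simp at nd
  refine S.full (((K.pB2.hp.glue K.pIs.hp K.e4).glue K.pIt.hp hxy.symm).glue K.pB1.hp hyf)
    (Eq.trans (by abel) K.hC) K.f2A K.g1A ?_
  exact (hdisj (Or.inr K.pB1.last_mem) (Or.inr K.pB2.head_mem)).symm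

end

section

variable {G : SimpleGraph V} {A H : Finset V} {Cm : Multiset V} {Λ : V → Prop}
variable {C : List V} {v : V}

theorem Conf.not_mem_swap (K : Conf G A Cm) (nd : Cm.Nodup) {u w : V}
    (hu : u ∈ K.Is ∨ u ∈ K.B1) (hw : w ∈ K.It ∨ w ∈ K.B2) : u ≠ w := by
  rintro rfl
  rw [← K.hC, add_assoc, Multiset.nodup_add] at nd
  exact Multiset.disjoint_left.1 nd.2.2 (by simpa using hu) (by simpa using hw)

variable [Fintype V] {t : ℕ}

/-- Two intervals with two vertices each. -/
theorem Counter.not_adj_of_short (X : Counter G t) (hC : Longest G C) (hv : v ∉ C)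
    {K : Conf G (nb G v) (C : Multiset V)} (hs : K.Is = [K.xs, K.ys])
    (ht : K.It = [K.xt, K.yt]) : ¬ G.Adj K.xs K.yt := by
  intro hxy
  have S := X.base hC hv
  have hne : ∀ {u w}, (u ∈ K.Is ∨ u ∈ K.B1) → (w ∈ K.It ∨ w ∈ K.B2) → u ≠ w := fun hu hw =>
    K.not_mem_swap S.nd hu hw
  have hvC : ∀ u, u ∈ (C : Multiset V) → v ≠ u := by
    rintro u hu rfl
    exact hv (Multiset.mem_coe.1 hu)
  have hxt : G.Adj K.xt K.yt := by
    have := K.pIt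
    rw [ht] at this
    exact (this.cut (l := [])).2.2
  have hxs : G.Adj K.xs K.ys := by
    have := K.pIs
    rw [hs] at this
    exact (this.cut (l := [])).2.2
  have hC' : ({K.xs} : Multiset V) + {K.ys} + K.B1 + ({K.xt} + {K.yt}) + K.B2 = C := by
    refine Eq.trans ?_ K.hC
    have h1 : (K.Is : Multiset V) = {K.xs} + {K.ys} := by rw [hs]; rfl
    have h2 : (K.It : Multiset V) = {K.xt} + {K.yt} := by rw [ht]; rfl
    rw [h1, h2]
  have hy : Light G K.ys := by
    refine hC.light_of_skip hv (mem_nb.1 K.f1A) (mem_nb.1 K.f2A)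
      (((((K.pB1.hp.glue (hp_singleton K.xt) K.e2).glue (hp_singleton K.yt) hxt).glue
        (hp_singleton K.xs) hxy.symm).glue K.pB2.hp.symm K.e4.symm)) ?_
    refine Eq.trans ?_ hC'
    rw [← Multiset.singleton_add]
    abel
  have hx : Light G K.xt := by
    refine hC.light_of_skip hv (mem_nb.1 K.g1A) (mem_nb.1 K.g2A)
      (((((K.pB1.hp.symm.glue (hp_singleton K.ys) K.e1.symm).glue (hp_singleton K.xs)
        hxs.symm).glue (hp_singleton K.yt) hxy).glue K.pB2.hp K.e3)) ?_
    refine Eq.trans ?_ hC'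
    rw [← Multiset.singleton_add]
    abel
  have hsI := K.pIs.last_mem
  have htI := K.pIt.head_mem
  refine X.light_false ⟨C, hC, hv⟩ hy hx (hvC _ (K.mem_iff.2 (Or.inl hsI)))
    (hvC _ (K.mem_iff.2 (Or.inr (Or.inr (Or.inl htI))))) (hne (Or.inl hsI) (Or.inl htI))
    (fun h => K.sA _ hsI (mem_nb.2 h)) (fun h => K.tA _ htI (mem_nb.2 h)) fun h => ?_
  refine S.full (((((K.pB1.hp.glue (hp_singleton K.xt) K.e2).glue (hp_singleton K.ys)
    h.symm).glue (hp_singleton K.xs) hxs.symm).glue (hp_singleton K.yt) hxy).glue K.pB2.hp K.e3)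
    ?_ K.f1A K.g2A (hne (Or.inr K.pB1.head_mem) (Or.inr K.pB2.last_mem))
  exact Eq.trans (by abel) hC'

theorem Counter.conf (X : Counter G t) (hC : Longest G C) (hv : v ∉ C) {a b : V}
    (ha : a ∈ nb G v) (hb : b ∈ nb G v) (hne : a ≠ b) :
    ∃ K : Conf G (nb G v) (C : Multiset V), K.Is = interval (nb G v) C a ∧
      K.It = interval (nb G v) C b ∧ K.f1 = nextA (nb G v) C a ∧
      K.f2 = nextA (nb G v) C b ∧ K.g2 = a ∧ K.g1 = b ∧
      C ~r K.Is ++ K.B1 ++ K.It ++ K.B2 :=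
  exists_conf hC.cyc (fun _ ha => X.nb_mem hC hv (mem_nb.1 ha))
    ((X.base hC hv).sparse hC.cyc) ha hb hne

theorem Counter.interval_inj (X : Counter G t) (hC : Longest G C) (hv : v ∉ C) {a b u : V}
    (ha : a ∈ nb G v) (hb : b ∈ nb G v) (hu : u ∈ interval (nb G v) C a)
    (hu' : u ∈ interval (nb G v) C b) : a = b := by
  by_contra hne
  obtain ⟨K, h1, h2, -⟩ := X.conf hC hv ha hb hne
  rw [← h1] at hu
  rw [← h2] at hu'
  exact K.not_mem_swap (X.base hC hv).nd (Or.inl hu) (Or.inl hu') rfl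

/-- The interval after a neighbour of `v`. -/
theorem Counter.interval_spec (X : Counter G t) (hC : Longest G C) (hv : v ∉ C) {a : V}
    (ha : a ∈ nb G v) : ∃ x y L, interval (nb G v) C a = x :: y :: L ∧ G.Adj a x ∧
      (∃ r, C ~r a :: x :: y :: (L ++ r)) ∧
      ∀ u ∈ interval (nb G v) C a, u ∈ C ∧ ¬ G.Adj v u := by
  have S := X.base hC hv
  obtain ⟨b, hb, hne⟩ := S.exists_other a
  obtain ⟨K, h1, h2, h3, h4, h5, h6, hr⟩ := X.conf hC hv ha hb hne.symm
  obtain ⟨L, hL⟩ := K.pIs.eq_cons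
  obtain ⟨B, hB⟩ := K.pB1.eq_cons
  obtain ⟨B', hB'⟩ := K.pB2.eq_concat
  have hrot : C ~r a :: (K.Is ++ (K.B1 ++ K.It ++ B')) := by
    refine hr.trans ?_
    rw [hB', h5]
    have := isRotated_append (K.Is ++ K.B1 ++ K.It ++ B') [a]
    simpa using this
  have hax : G.Adj a K.xs := h5 ▸ K.e4
  cases L with
  | nil =>
    exfalso
    rw [hL, hB] at hrot
    exact X.no_gap_two hC hv hrot (mem_nb.1 ha) (mem_nb.1 K.f1A)
  | cons y L =>
    refine ⟨K.xs, y, L, by rw [← h1, hL], hax, ⟨K.B1 ++ K.It ++ B', ?_⟩, ?_⟩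
    · rw [hL] at hrot
      simpa using hrot
    · intro u hu
      rw [← h1] at hu
      exact ⟨Multiset.mem_coe.1 (K.mem_iff.2 (Or.inl hu)), fun h => K.sA _ hu (mem_nb.2 h)⟩

/-- All intervals but one have two vertices. -/
theorem Counter.exists_long (X : Counter G t) (hC : Longest G C) (hv : v ∉ C)
    (hn : C.length ≤ 3 * (nb G v).card + 1) :
    ∃ g ∈ nb G v, (interval (nb G v) C g).length + 3 * (nb G v).card ≤ C.length + 2 ∧
      ∀ a ∈ nb G v, a ≠ g → (interval (nb G v) C a).length = 2 := by
  have S := X.base hC hv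
  set A := nb G v with hA
  set I := interval A C with hI
  have h2 : ∀ a ∈ A, 2 ≤ (I a).length := by
    intro a ha
    obtain ⟨x, y, L, h, -⟩ := X.interval_spec hC hv ha
    rw [hI, h]
    simp
  have hsum : ∑ a ∈ A, (I a).length + A.card ≤ C.length := by
    have hnd : ∀ a ∈ A, (I a).toFinset.card = (I a).length := by
      intro a ha
      obtain ⟨b, hb, hne⟩ := S.exists_other a
      obtain ⟨K, h1, -⟩ := X.conf hC hv ha hb hne.symm
      refine List.toFinset_card_of_nodup ?_
      rw [hI, ← h1]
      have := K.nodup S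
      rw [List.append_assoc, List.append_assoc] at this
      exact this.of_append_left
    have hU : (A.biUnion fun a => (I a).toFinset).card = ∑ a ∈ A, (I a).length := by
      rw [Finset.card_biUnion, Finset.sum_congr rfl hnd]
      intro a ha b hb hne
      exact Finset.disjoint_left.2 fun u hu hu' => hne
        (X.interval_inj hC hv ha hb (List.mem_toFinset.1 hu) (List.mem_toFinset.1 hu'))
    rw [← hU, ← Finset.card_union_of_disjoint, ← List.toFinset_card_of_nodup hC.cyc.1]
    · refine Finset.card_le_card (Finset.union_subset ?_ ?_)
      · intro u hu
        obtain ⟨a, ha, hu⟩ := Finset.mem_biUnion.1 hu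
        obtain ⟨-, -, -, -, -, -, h⟩ := X.interval_spec hC hv ha
        exact List.mem_toFinset.2 (h u (List.mem_toFinset.1 hu)).1
      · intro u hu
        exact List.mem_toFinset.2 (X.nb_mem hC hv (mem_nb.1 hu))
    · rw [Finset.disjoint_left]
      intro u hu huA
      obtain ⟨a, ha, hu⟩ := Finset.mem_biUnion.1 hu
      obtain ⟨-, -, -, -, -, -, h⟩ := X.interval_spec hC hv ha
      exact (h u (List.mem_toFinset.1 hu)).2 (mem_nb.1 huA)
  have hne : A.Nonempty := Finset.card_pos.1 (by have := S.A2; omega)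
  obtain ⟨g, hg, hmax⟩ := Finset.exists_max_image A (fun a => (I a).length) hne
  have hsplit := Finset.add_sum_erase A (fun a => (I a).length) hg
  have hcard := Finset.card_erase_of_mem hg
  have hlow : (A.erase g).card * 2 ≤ ∑ a ∈ A.erase g, (I a).length :=
    Finset.card_nsmul_le_sum _ _ _ fun a ha => h2 a (Finset.mem_of_mem_erase ha)
  have hA2 := S.A2
  refine ⟨g, hg, by omega, fun a ha hag => ?_⟩
  have ha' : a ∈ A.erase g := Finset.mem_erase.2 ⟨hag, ha⟩
  have hsplit' := Finset.add_sum_erase (A.erase g) (fun a => (I a).length) ha'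
  have hcard' := Finset.card_erase_of_mem ha'
  have hlow' : ((A.erase g).erase a).card * 2 ≤ ∑ a ∈ (A.erase g).erase a, (I a).length :=
    Finset.card_nsmul_le_sum _ _ _ fun a ha =>
      h2 a (Finset.mem_of_mem_erase (Finset.mem_of_mem_erase ha))
  have h3 := hmax a ha
  have h4 := h2 a ha
  omega

end

section

variable {G : SimpleGraph V} {A H : Finset V} {Cm : Multiset V} {Λ : V → Prop}
variable {C : List V} {v : V} {t : ℕ}

theorem Conf.xs_eq {K : Conf G A Cm} {x : V} {L : List V} (h : K.Is = x :: L) : K.xs = x := by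
  have := K.pIs.2.1
  rw [h] at this
  simpa using this.symm

theorem Conf.xt_eq {K : Conf G A Cm} {x : V} {L : List V} (h : K.It = x :: L) : K.xt = x :=
  K.swap.xs_eq h

/-- Successors on the cycle are visible in the blocks of a configuration. -/
theorem Longest.infix_of_succ (hC : Longest G C) {K : Conf G A (C : Multiset V)} (hr : C ~r K.Is ++ K.B1 ++ K.It ++ K.B2)
    {l x : V} {L : List V} (hl : C ~r l :: x :: L) (h1 : l ∉ K.Is) (h2 : l ∉ K.It)
    (h3 : l ≠ K.g1) (h4 : l ≠ K.g2) : [l, x] <:+: K.B1 ∨ [l, x] <:+: K.B2 := by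
  have key : ∀ w, [l, w] <:+: K.Is ++ K.B1 ++ K.It ++ K.B2 → w = x := by
    intro w hw
    obtain ⟨r, hr'⟩ := isRotated_of_infix hw
    exact (List.cons.inj (isRotated_cons_inj hC.cyc.1 (hr.trans hr') hl)).1
  have hmem : l ∈ (C : Multiset V) := Multiset.mem_coe.2 (hl.mem_iff.2 (by simp))
  rcases K.mem_iff.1 hmem with h | h | h | h
  · exact absurd h h1
  · obtain ⟨w, hw⟩ := exists_next K.pB1 h h3
    have := key w (infix_append_left (infix_append_left (infix_append_right hw)))
    exact Or.inl (this ▸ hw)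
  · exact absurd h h2
  · obtain ⟨w, hw⟩ := exists_next K.pB2 h h4
    have := key w (infix_append_right hw)
    exact Or.inr (this ▸ hw)

variable [Fintype V]

/-- The number of vertices off a longest cycle is at most two. -/
theorem Counter.card_le (X : Counter G t) (hC : Longest G C) (hv : v ∉ C)
    (hmax : ∀ z, Light G z → (nb G z).card ≤ (nb G v).card) (h3 : 3 ≤ (nb G v).card)
    {K : Conf G (nb G v) (C : Multiset V)} (hr : C ~r K.Is ++ K.B1 ++ K.It ++ K.B2)
    {O : List V} {y : V} (hO : XO K O y) (hy : Light G y) :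
    Fintype.card V ≤ 3 * (nb G v).card + 2 := by
  have S := X.base hC hv
  obtain ⟨B, hB⟩ := K.pB1.eq_cons
  obtain ⟨B', hB'⟩ := K.pB2.eq_concat
  have hrot : C ~r K.g2 :: (K.Is ++ K.f1 :: (B ++ K.It ++ B')) := by
    refine hr.trans ?_
    have := isRotated_append (K.Is ++ K.B1 ++ K.It ++ B') [K.g2]
    rw [hB'] at ⊢
    rw [hB] at this ⊢
    simpa using this
  have hIs := interval_eq hC.cyc.1 hrot K.sA K.f1A
  have hf1 := nextA_eq hC.cyc.1 hrot K.sA K.f1A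
  have hP : ∀ b ∈ nb G v, b ≠ K.g2 → ∀ x L, interval (nb G v) C b = x :: L → ¬ Light G x ∧
      Fintype.card V ≤ (nb G v).card + (nb G y).card + (nb G x).card := by
    intro b hb hne x L hx
    obtain ⟨K', k1, k2, k3, -⟩ := X.conf hC hv K.g2A hb hne.symm
    have hO' : XO K' O y := by
      obtain ⟨e, p, hp, h⟩ := hO
      exact ⟨e, p, by rw [hp, k1, hIs], by rw [k3, hf1]; exact h⟩
    have := X.partner hC hv hO' K'.swap.xo hy
    change ¬ Light G K'.xt ∧ _ ≤ _ + _ + (nb G K'.xt).card at this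
    rwa [Conf.xt_eq (k2.trans hx)] at this
  obtain ⟨b, hb, b', hb', hbb⟩ := Finset.one_lt_card.1
    (by rw [Finset.card_erase_of_mem K.g2A]; omega : 1 < ((nb G v).erase K.g2).card)
  obtain ⟨hb0, hb⟩ := Finset.mem_erase.1 hb
  obtain ⟨hb0', hb'⟩ := Finset.mem_erase.1 hb'
  obtain ⟨K', k1, k2, -, -, k5, k6, hr'⟩ := X.conf hC hv hb hb' hbb
  have hspec := fun a (ha : a ∈ nb G v) => X.interval_spec hC hv ha
  choose! x y' L hx using hspec
  have hs := Conf.xs_eq (k1.trans (hx b hb).1)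
  have ht := Conf.xt_eq (k2.trans (hx b' hb').1)
  have hin : ∀ a ∈ nb G v, a ∉ interval (nb G v) C b ∧ a ∉ interval (nb G v) C b' := by
    intro a ha
    rw [← k1, ← k2]
    exact ⟨fun h => K'.sA _ h ha, fun h => K'.tA _ h ha⟩
  have hcount := (K'.duo K'.xo K'.swap.xo).card_add S (K'.sA _ K'.pIs.head_mem)
    (K'.tA _ K'.pIt.head_mem) ((nb G v \ {b, b', K.g2}).image x) (by
      intro u hu
      obtain ⟨l, hl, rfl⟩ := Finset.mem_image.1 hu
      obtain ⟨hlA, hl⟩ := Finset.mem_sdiff.1 hl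
      simp only [Finset.mem_insert, Finset.mem_singleton, not_or] at hl
      obtain ⟨e, -, ⟨r, hlr⟩, hlv⟩ := hx l hlA
      have hxl : x l ∈ C := hlr.mem_iff.2 (by simp)
      refine ⟨fun h => hv ((Finset.mem_singleton.1 h) ▸ hxl), ?_⟩
      have hnl := (hP l hlA hl.2.2 _ _ e).1
      rcases hC.infix_of_succ hr' hlr (k1 ▸ (hin l hlA).1) (k2 ▸ (hin l hlA).2)
        (k6 ▸ hl.2.1) (k5 ▸ hl.1) with h | h
      · exact K'.miss_of_skip S K'.xo K'.swap.xo hlA h fun m hm e => hnl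
          (hC.light_of_skip hv (mem_nb.1 hlA) (mem_nb.1 K'.g2A) hm e)
      · exact (K'.swap.miss_of_skip S K'.swap.xo K'.xo hlA h fun m hm e => hnl
          (hC.light_of_skip hv (mem_nb.1 hlA) (mem_nb.1 K'.g1A) hm e)).symm)
  rw [Finset.card_image_of_injOn (by
    intro l hl l' hl' e
    have hlA := (Finset.mem_sdiff.1 hl).1
    have hlA' := (Finset.mem_sdiff.1 hl').1
    exact X.interval_inj (u := x l) hC hv hlA hlA' (by rw [(hx l hlA).1]; simp)
      (by rw [(hx l' hlA').1, e]; simp))] at hcount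
  change (nb G K'.xs).card + (nb G K'.xt).card + _ + _ ≤ _ at hcount
  rw [hs, ht, Finset.card_singleton] at hcount
  have h4 := (hP b hb hb0 _ _ (hx b hb).1).2
  have h5 := (hP b' hb' hb0' _ _ (hx b' hb').1).2
  have h6 := hmax y hy
  have h7 := Finset.le_card_sdiff {b, b', K.g2} (nb G v)
  have h8 : ({b, b', K.g2} : Finset V).card ≤ 3 := Finset.card_le_three
  omega

/-- A neighbour off `v` of the first vertex of a short interval. -/
theorem Counter.short_nb (X : Counter G t) (hC : Longest G C) (hv : v ∉ C)
    {g xg yg : V} {Lg : List V} (hg : interval (nb G v) C g = xg :: yg :: Lg)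
    (hshort : ∀ a ∈ nb G v, a ≠ g → (interval (nb G v) C a).length = 2) {b x y u : V}
    (hb : b ∈ nb G v) (hbg : b ≠ g) (hx : interval (nb G v) C b = [x, y])
    (hu : u ∈ nb G x \ nb G v) :
    u = y ∨ (u ∉ C ∧ u ≠ v) ∨ (Lg ≠ [] ∧ u ∈ yg :: Lg) := by
  have S := X.base hC hv
  obtain ⟨hux, huv⟩ := Finset.mem_sdiff.1 hu
  rw [mem_nb] at hux
  by_cases huC : u ∈ C
  · obtain ⟨a, ha, hua⟩ := (hC.cyc.dec (fun a ha => X.nb_mem hC hv (mem_nb.1 ha))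
      (S.sparse hC.cyc) S.A2).cover u (Multiset.mem_coe.2 huC) huv
    change u ∈ interval (nb G v) C a at hua
    by_cases hab : b = a
    · subst hab
      rw [hx] at hua
      rcases List.mem_cons.1 hua with rfl | h
      · exact absurd rfl hux.ne
      · exact Or.inl (List.mem_singleton.1 h)
    · obtain ⟨K, k1, k2, -⟩ := X.conf hC hv hb ha hab
      have hxs := Conf.xs_eq (k1.trans hx)
      have hys : K.ys = y := by
        have := K.pIs.2.2
        rw [k1, hx] at this
        simpa using this.symm
      obtain ⟨x', y', L', h', -⟩ := X.interval_spec hC hv ha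
      have hxt := Conf.xt_eq (k2.trans h')
      have hn : ¬ G.Adj K.xs K.xt := (K.duo K.xo K.swap.xo).not_adj S
      have hux' : u ≠ x' := by
        rintro rfl
        rw [hxs, hxt] at hn
        exact hn hux
      rw [h'] at hua
      have hua' := (List.mem_cons.1 hua).resolve_left hux'
      have hL : L' ≠ [] := by
        rintro rfl
        obtain rfl := List.mem_singleton.1 hua'
        have hyt : K.yt = u := by
          have := K.pIt.2.2
          rw [k2, h'] at this
          simpa using this.symm
        refine X.not_adj_of_short hC hv (K := K) (by rw [k1, hx, hxs, hys])
          (by rw [k2, h', hxt, hyt]) ?_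
        rw [hxs, hyt]
        exact hux
      have hag : a = g := by
        by_contra hag
        have := hshort a ha hag
        rw [h'] at this
        simp only [List.length_cons] at this
        exact hL (List.length_eq_zero_iff.1 (by omega))
      subst hag
      rw [h'] at hg
      obtain ⟨-, hg'⟩ := List.cons.inj hg
      rw [hg'] at hua'
      refine Or.inr (Or.inr ⟨?_, hua'⟩)
      rw [← (List.cons.inj hg').2]
      exact hL
  · refine Or.inr (Or.inl ⟨huC, ?_⟩)
    rintro rfl
    obtain ⟨-, -, -, -, -, -, h⟩ := X.interval_spec hC hv hb
    exact (h x (by rw [hx]; simp)).2 hux.symm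

/-- The case of at least three attachments. -/
theorem Counter.three_false (X : Counter G t) (hC : Longest G C) (hv : v ∉ C)
    (h3 : 3 ≤ (nb G v).card) (hn : Fintype.card V ≤ 3 * (nb G v).card + 2) : False := by
  have S := X.base hC hv
  have hcn := X.spare C hC
  have hck := X.light_card hC hC hv
  have hct := X.small C hC
  obtain ⟨g, hg, hglen, hshort⟩ := X.exists_long hC hv (by omega)
  obtain ⟨xg, yg, Lg, hgI, -, ⟨rg, hgr⟩, hgv⟩ := X.interval_spec hC hv hg
  have hx : ∀ a, a ∈ (nb G v).erase g → ∃ x y, interval (nb G v) C a = [x, y] ∧ G.Adj a x ∧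
      ¬ G.Adj v x ∧ x ∈ C := by
    intro a ha
    obtain ⟨hag, ha⟩ := Finset.mem_erase.1 ha
    obtain ⟨x, y, L, h, hax, -, hv'⟩ := X.interval_spec hC hv ha
    have := hshort a ha hag
    rw [h] at this
    simp only [List.length_cons] at this
    obtain rfl := List.length_eq_zero_iff.1 (by omega : L.length = 0)
    have := hv' x (by rw [h]; simp)
    exact ⟨x, y, h, hax, this.2, this.1⟩
  choose! x y hx using hx
  have hlow : ∀ a ∈ (nb G v).erase g, t ≤ (nb G v).card + (nb G (x a) \ nb G v).card := by
    intro a ha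
    obtain ⟨-, h1, h2, h3⟩ := hx a ha
    have := X.nc v (x a) (fun h => hv (h ▸ h3)) h2
      ⟨a, mem_nb.1 (Finset.mem_of_mem_erase ha), h1.symm⟩
    refine this.trans (le_trans (Finset.card_le_card ?_) (Finset.card_union_le _ _))
    intro u hu
    rw [Finset.mem_union, Finset.mem_sdiff]
    rcases (Finset.mem_filter.1 hu).2 with h | h
    · exact Or.inl (mem_nb.2 h)
    · by_cases huv : u ∈ nb G v
      · exact Or.inl huv
      · exact Or.inr ⟨mem_nb.2 h, huv⟩
  set F : Finset V := Finset.univ.filter fun u => u ∉ C ∧ u ≠ v with hF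
  have hFcard : F.card + C.length + 1 ≤ Fintype.card V := by
    have h : F ⊆ Finset.univ \ insert v C.toFinset := by
      intro u hu
      have hu := (Finset.mem_filter.1 hu).2
      simp [hu.1, hu.2]
    have h' := Finset.card_le_card h
    rw [Finset.card_sdiff_of_subset (Finset.subset_univ _), Finset.card_univ,
      Finset.card_insert_of_notMem (by simpa using hv),
      List.toFinset_card_of_nodup hC.cyc.1] at h'
    omega
  obtain ⟨b, hb, b', hb', hbb⟩ := Finset.one_lt_card.1
    (by rw [Finset.card_erase_of_mem hg]; omega : 1 < ((nb G v).erase g).card)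
  obtain ⟨hbg, hbA⟩ := Finset.mem_erase.1 hb
  obtain ⟨hbg', hbA'⟩ := Finset.mem_erase.1 hb'
  obtain ⟨K, k1, k2, -, -, k5, k6, hr⟩ := X.conf hC hv hbA hbA' hbb
  have hs := Conf.xs_eq (k1.trans (hx b hb).1)
  have ht := Conf.xt_eq (k2.trans (hx b' hb').1)
  have D := K.duo K.xo K.swap.xo
  rw [hgI] at hglen
  simp only [List.length_cons] at hglen
  by_cases hL : Lg = []
  · have hw : ∀ a ∈ (nb G v).erase g, ∃ w ∈ F, G.Adj (x a) w := by
      intro a ha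
      by_contra! hno
      have hsub : nb G (x a) \ nb G v ⊆ {y a} := by
        intro u hu
        rw [Finset.mem_singleton]
        rcases X.short_nb hC hv hgI hshort (Finset.mem_of_mem_erase ha)
          (Finset.ne_of_mem_erase ha) (hx a ha).1 hu with h | h | h
        · exact h
        · exact absurd (mem_nb.1 (Finset.mem_sdiff.1 hu).1)
            (hno u (Finset.mem_filter.2 ⟨Finset.mem_univ _, h⟩))
        · exact absurd hL h.1
      have h1 := Finset.card_le_card hsub
      have h2 := hlow a ha
      rw [Finset.card_singleton] at h1
      omega
    obtain ⟨w, hwF, hw1⟩ := hw b hb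
    obtain ⟨w', hwF', hw2⟩ := hw b' hb'
    obtain rfl := Finset.card_le_one.1 (by omega : F.card ≤ 1) w hwF w' hwF'
    obtain ⟨-, hwC, hwv⟩ := Finset.mem_filter.1 hwF
    refine D.off S (by simpa using hwC) (by simpa using hwv)
      (show G.Adj K.xt w from ht.symm ▸ hw2) (hs.symm ▸ hw1)
  · obtain ⟨z, rfl⟩ : ∃ z, Lg = [z] := by
      have : 0 < Lg.length := List.length_pos_iff.2 hL
      exact List.length_eq_one_iff.1 (by omega)
    simp only [List.length_cons, List.length_nil] at hglen
    have hadj : ∀ a ∈ (nb G v).erase g, G.Adj (x a) yg ∧ G.Adj (x a) z := by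
      intro a ha
      have hsub : nb G (x a) \ nb G v ⊆ {y a, yg, z} := by
        intro u hu
        simp only [Finset.mem_insert, Finset.mem_singleton]
        rcases X.short_nb hC hv hgI hshort (Finset.mem_of_mem_erase ha)
          (Finset.ne_of_mem_erase ha) (hx a ha).1 hu with h | h | h
        · exact Or.inl h
        · have : 0 < F.card := Finset.card_pos.2
            ⟨u, Finset.mem_filter.2 ⟨Finset.mem_univ _, h⟩⟩
          omega
        · exact Or.inr (by simpa using h.2)
      have h2 := hlow a ha
      have h4 : ({y a, yg, z} : Finset V).card ≤ 3 := Finset.card_le_three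
      have heq := Finset.eq_of_subset_of_card_le hsub (by omega)
      have hin : ∀ u ∈ ({y a, yg, z} : Finset V), G.Adj (x a) u := by
        intro u hu
        rw [← heq] at hu
        exact mem_nb.1 (Finset.mem_sdiff.1 hu).1
      exact ⟨hin _ (by simp), hin _ (by simp)⟩
    have hygI : yg ∈ interval (nb G v) C g := by rw [hgI]; simp
    have hyr : C ~r yg :: z :: (rg ++ [g, xg]) := by
      have := isRotated_append [g, xg] (yg :: ([z] ++ rg))
      exact hgr.trans (by simpa using this)
    have hyA : yg ∉ nb G v := fun h => (hgv yg hygI).2 (mem_nb.1 h)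
    rcases hC.infix_of_succ hr hyr
      (fun h => hbg (X.interval_inj hC hv hbA hg (k1 ▸ h) hygI))
      (fun h => hbg' (X.interval_inj hC hv hbA' hg (k2 ▸ h) hygI))
      (fun h => hyA (h ▸ K.g1A)) (fun h => hyA (h ▸ K.g2A)) with h | h
    · exact D.cross S (infix_append_right h) (show G.Adj K.xt yg from ht.symm ▸ (hadj b' hb').1)
        (hs.symm ▸ (hadj b hb).2)
    · exact D.symm.cross S (infix_append_right h) (hs.symm ▸ (hadj b hb).1)
        (show G.Adj K.xt z from ht.symm ▸ (hadj b' hb').2)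

/-- There is no counterexample containing a longest cycle. -/
theorem Counter.contradiction (X : Counter G t) (hC : Longest G C) : False := by
  obtain ⟨u, hu⟩ : ∃ u, u ∉ C := by
    by_contra! h
    have := X.spare C hC
    have h' : (Finset.univ : Finset V) ⊆ C.toFinset := fun u _ => List.mem_toFinset.2 (h u)
    have h' := (Finset.card_le_card h').trans (List.toFinset_card_le _)
    rw [Finset.card_univ] at h'
    omega
  obtain ⟨v, hvl, hmax⟩ := Finset.exists_max_image (Finset.univ.filter (Light G))
    (fun z => (nb G z).card) ⟨u, Finset.mem_filter.2 ⟨Finset.mem_univ _, C, hC, hu⟩⟩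
  have hmax : ∀ z, Light G z → (nb G z).card ≤ (nb G v).card := fun z hz =>
    hmax z (Finset.mem_filter.2 ⟨Finset.mem_univ _, hz⟩)
  obtain ⟨C₁, hC₁, hv₁⟩ := (Finset.mem_filter.1 hvl).2
  obtain ⟨K, O, y, hO, hy⟩ := X.exists_light hC₁ hv₁
  have e : (C₁ : Multiset V) = ((K.Is ++ (K.B1 ++ K.It ++ K.B2) : List V) : Multiset V) := by
    refine K.hC.symm.trans ?_
    simp only [← Multiset.coe_add]
    abel
  have S₁ := X.base hC₁ hv₁
  have hC₂ : Longest G (K.Is ++ (K.B1 ++ K.It ++ K.B2)) :=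
    hC₁.of_card K.path_all K.e4 (Multiset.coe_nodup.1 (e ▸ S₁.nd))
      (Multiset.coe_eq_coe.1 e).length_eq.symm
  have hv₂ : v ∉ K.Is ++ (K.B1 ++ K.It ++ K.B2) := fun h =>
    hv₁ ((Multiset.coe_eq_coe.1 e).mem_iff.2 h)
  have hr : K.Is ++ (K.B1 ++ K.It ++ K.B2) = K.Is ++ K.B1 ++ K.It ++ K.B2 := by simp
  generalize K.Is ++ (K.B1 ++ K.It ++ K.B2) = C₂ at e hC₂ hv₂ hr
  generalize (C₁ : Multiset V) = Cm at K O hO e hr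
  subst e
  have hA2 := (X.base hC₂ hv₂).A2
  rcases Nat.lt_or_ge 2 (nb G v).card with h | h
  · exact X.three_false hC₂ hv₂ h (X.card_le hC₂ hv₂ hmax h (hr ▸ List.IsRotated.refl _) hO hy)
  · exact X.two_false hC₂ hv₂ hmax (by omega) hO hy

end

section

variable {G : SimpleGraph V}

theorem exists_longest_list (P : List V → Prop) [Fintype V] (h0 : ∃ l, P l)
    (hP : ∀ l, P l → l.Nodup) : ∃ l, P l ∧ ∀ l', P l' → l'.length ≤ l.length := by
  have hb : BddAbove {k | ∃ l, P l ∧ l.length = k} :=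
    ⟨Fintype.card V, by rintro _ ⟨l, hl, rfl⟩; exact (hP l hl).length_le_card⟩
  obtain ⟨l₀, hl₀⟩ := h0
  obtain ⟨l, hl, e⟩ := Nat.sSup_mem (s := {k | ∃ l, P l ∧ l.length = k}) ⟨_, l₀, hl₀, rfl⟩ hb
  exact ⟨l, hl, fun l' hl' => e ▸ le_csSup hb ⟨l', hl', rfl⟩⟩

/-- A cycle given by its list of vertices is a cycle. -/
theorem Cyc.exists_isCycle {C : List V} (hC : Cyc G C) (h3 : 3 ≤ C.length) :
    ∃ (a : V) (w : G.Walk a a), w.IsCycle ∧ w.length = C.length := by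
  obtain ⟨nd, x, y, p, adj⟩ := hC
  obtain ⟨t, rfl⟩ := p.eq_cons
  have hne : x :: t ≠ [] := List.cons_ne_nil x t
  have hy : (x :: t).getLast hne = y :=
    Option.some.inj ((List.getLast?_eq_some_getLast hne).symm.trans p.2.2)
  obtain ⟨w, hw, hl⟩ : ∃ w : G.Walk x y, w.IsPath ∧ w.length + 1 = (x :: t).length := by
    subst hy
    refine ⟨SimpleGraph.Walk.ofSupport (x :: t) hne p.1, ?_, ?_⟩
    · refine (SimpleGraph.Walk.isPath_def _).2 ?_
      exact (SimpleGraph.Walk.support_ofSupport hne p.1).symm ▸ nd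
    · exact congrArg (· + 1) (SimpleGraph.Walk.length_ofSupport hne p.1)
  refine ⟨y, SimpleGraph.Walk.cons adj w, ?_, by simpa using hl⟩
  rw [SimpleGraph.Walk.cons_isCycle_iff]
  refine ⟨hw, fun h => ?_⟩
  rw [Sym2.eq_swap] at h
  have := hw.length_eq_one_of_mem_edges h
  omega

variable [Fintype V]

theorem ncard_eq_card_filter (p : V → Prop) [DecidablePred p] :
    {u | p u}.ncard = (Finset.univ.filter p).card := by
  rw [Set.ncard_eq_toFinset_card']
  congr 1
  ext
  simp

theorem deg_eq (x : V) : deg G x = (nb G x).card := ncard_eq_card_filter (G.Adj x)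

theorem Tough.exists_adj_ne (hT : Tough G) (hn : 3 ≤ Fintype.card V) {x a : V} (hxa : x ≠ a) :
    ∃ b, b ≠ a ∧ G.Adj x b := by
  by_contra! hno
  obtain ⟨z, hz⟩ : ∃ z, z ∉ ({x, a} : Finset V) := by
    by_contra! h
    have h1 := Finset.card_le_card (fun u _ => h u : (Finset.univ : Finset V) ⊆ {x, a})
    have h2 : ({x, a} : Finset V).card ≤ 2 := Finset.card_le_two
    rw [Finset.card_univ] at h1
    omega
  simp only [Finset.mem_insert, Finset.mem_singleton, not_or] at hz
  refine hT.false_of_colours {a} ⟨a, by simp⟩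
    (fun u => if u = x then Sum.inr true else Sum.inr false) ?_
    {Sum.inr true, Sum.inr false} ?_ (by simp)
  · intro u w hu hw adj
    rw [Finset.mem_singleton] at hu hw
    have h1 : u ≠ x := by
      rintro rfl
      exact hno w hw adj
    have h2 : w ≠ x := by
      rintro rfl
      exact hno u hu adj.symm
    simp [h1, h2]
  · intro s hs
    rcases Finset.mem_insert.1 hs with rfl | hs
    · exact ⟨x, by simpa using hxa, if_pos rfl⟩
    · rw [Finset.mem_singleton.1 hs]
      exact ⟨z, by simpa using hz.2, if_neg hz.1⟩

/-- A tough graph on at least three vertices has a longest cycle. -/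
theorem Tough.exists_longest (hT : Tough G) (hn : 3 ≤ Fintype.card V) : ∃ C, Longest G C := by
  obtain ⟨v₀⟩ := Fintype.card_pos_iff.1 (by omega : 0 < Fintype.card V)
  obtain ⟨l, ⟨hl, nd⟩, hmax⟩ := exists_longest_list (fun l : List V => l.IsChain G.Adj ∧ l.Nodup)
    ⟨[], by simp⟩ fun _ h => h.2
  have hin : ∀ {x : V} {s : List V}, l = x :: s → ∀ b, G.Adj x b → b ∈ s := by
    rintro x s rfl b hb
    by_contra hbs
    have := hmax (b :: x :: s) ⟨List.isChain_cons_cons.2 ⟨hb.symm, hl⟩,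
      List.nodup_cons.2 ⟨by simp [hbs, hb.ne'], nd⟩⟩
    simp at this
  obtain ⟨C, hC, h3⟩ : ∃ C, Cyc G C ∧ 3 ≤ C.length := by
    rcases l with _ | ⟨x, _ | ⟨y, s⟩⟩
    · have := hmax [v₀] (by simp)
      simp at this
    · obtain ⟨a, ha⟩ := Fintype.exists_ne_of_one_lt_card (by omega : 1 < Fintype.card V) x
      obtain ⟨b, -, hb⟩ := hT.exists_adj_ne hn ha.symm
      exact absurd (hin rfl b hb) (by simp)
    · have hxy : G.Adj x y := (List.isChain_cons_cons.1 hl).1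
      obtain ⟨b, hby, hb⟩ := hT.exists_adj_ne hn hxy.ne
      obtain ⟨p, q, rfl⟩ := List.append_of_mem
        ((List.mem_cons.1 (hin rfl b hb)).resolve_left hby)
      have e : x :: y :: (p ++ b :: q) = (x :: y :: (p ++ [b])) ++ q := by simp
      rw [e] at hl nd
      refine ⟨x :: y :: (p ++ [b]), ⟨(List.nodup_append.1 nd).1, x, b,
        ⟨(List.isChain_append.1 hl).1, rfl, ?_⟩, hb.symm⟩, by simp⟩
      rw [← List.cons_append, ← List.cons_append, List.getLast?_concat]
  obtain ⟨C, ⟨hC, h3⟩, hmax⟩ := exists_longest_list (fun C => Cyc G C ∧ 3 ≤ C.length)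
    ⟨C, hC, h3⟩ fun _ h => h.1.1
  exact ⟨C, hC, h3, fun C' h h' => hmax C' ⟨h, h'⟩⟩

theorem Longest.length_le_circumference {C : List V} (hC : Longest G C) :
    C.length ≤ circumference G := by
  refine le_csSup ⟨Fintype.card V, ?_⟩ (hC.cyc.exists_isCycle hC.three)
  rintro _ ⟨a, w, hw, rfl⟩
  have := hw.support_nodup.length_le_card
  simpa using this

theorem OneTough.tough (h : OneTough G) : Tough G := by
  intro S f hS hf
  have hk := h (S : Set V) (Finset.coe_nonempty.2 hS)
  rw [Set.ncard_coe_finset] at hk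
  refine le_trans ?_ hk
  let F : (G.induce (S : Set V)ᶜ).ConnectedComponent → V ⊕ Bool :=
    SimpleGraph.ConnectedComponent.lift (fun u => f u) (by
      intro u w p hp
      clear hp
      induction p with
      | nil => rfl
      | @cons u w z adj p ih => exact (hf u w u.2 w.2 adj).trans ih)
  have hsub : Sᶜ.image f ⊆ Finset.univ.image F := by
    intro s hs
    obtain ⟨u, hu, rfl⟩ := Finset.mem_image.1 hs
    have hu' : u ∈ (S : Set V)ᶜ := by simpa using hu
    exact Finset.mem_image.2 ⟨SimpleGraph.connectedComponentMk _ ⟨u, hu'⟩, Finset.mem_univ _, rfl⟩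
  rw [Nat.card_eq_fintype_card]
  exact (Finset.card_le_card hsub).trans Finset.card_image_le

theorem heavy_of_le_sigma3 (h : Fintype.card V ≤ sigma3 G) : Heavy G := by
  intro p q r hpq hpr hqr npq npr nqr
  have hs : IsIndepTriple G {p, q, r} := by
    refine ⟨Finset.card_eq_three.2 ⟨p, q, r, hpq, hpr, hqr, rfl⟩, ?_⟩
    intro x hx y hy hxy
    simp only [Finset.mem_insert, Finset.mem_singleton] at hx hy
    rcases hx with rfl | rfl | rfl <;> rcases hy with rfl | rfl | rfl <;>
      first
        | exact absurd rfl hxy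
        | assumption
        | exact fun e => absurd e.symm ‹_›
  rw [sigma3, if_pos ⟨_, hs⟩] at h
  refine h.trans (Nat.sInf_le ⟨_, hs, ?_⟩)
  rw [Finset.sum_insert (by simp [hpq, hpr]), Finset.sum_insert (by simp [hqr]),
    Finset.sum_singleton, deg_eq, deg_eq, deg_eq, add_assoc]

theorem NC2_le {x y z : V} (hne : x ≠ y) (hn : ¬ G.Adj x y) (hx : G.Adj x z) (hy : G.Adj y z) :
    NC2 G ≤ (Finset.univ.filter fun u => G.Adj x u ∨ G.Adj y u).card := by
  have hG : G ≠ ⊤ := by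
    rintro rfl
    exact hn hne
  rw [NC2, if_neg hG]
  refine Nat.sInf_le ⟨x, y, ?_, ?_⟩
  · let w : G.Walk x y := .cons hx (.cons hy.symm .nil)
    have h1 : G.dist x y ≤ 2 := SimpleGraph.dist_le w
    have h2 : G.dist x y ≠ 0 := fun e => hne (w.reachable.dist_eq_zero_iff.1 e)
    have h3 : G.dist x y ≠ 1 := fun e => hn (SimpleGraph.dist_eq_one_iff_adj.1 e)
    omega
  · exact ncard_eq_card_filter fun u => G.Adj x u ∨ G.Adj y u

end

theorem stmt2 {V : Type*} [Fintype V] (G : SimpleGraph V)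
    (hn : 3 ≤ Fintype.card V) (htough : OneTough G) (hsig : Fintype.card V ≤ sigma3 G)
    (hnc : G ≠ ⊤) :
    min (Fintype.card V) (2 * NC2 G) ≤ circumference G := by
  by_contra! hlt
  have hT := htough.tough
  obtain ⟨C, hC⟩ := hT.exists_longest hn
  have X : Counter G (NC2 G) :=
    { tough := hT
      heavy := heavy_of_le_sigma3 hsig
      spare := fun C hC => by
        have := hC.length_le_circumference
        omega
      small := fun C hC => by
        have := hC.length_le_circumference
        omega
      nc := fun x y hne hn h => by
        obtain ⟨z, hx, hy⟩ := h
        exact NC2_le hne hn hx hy }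
  exact X.contradiction hC

end
end Paper
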